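/- Let m ≥ 4 and let i : ℝ^m → ℝ^{m+1} be an infinitely differentiable, injective, proper map whose Fréchet derivative is injective at every point (a proper smooth embedding). Then the complement ℝ^{m+1} ∖ range i has exactly two connected components, and for each connected component c there exists a map f : ℝ^m × ℝ → ℝ^{m+1}, infinitely differentiable, such that f(x, 0) = i(x) for all x, the restriction of f to the closed half-space H := ℝ^m × [0,∞) is injective and proper and has injective Fréchet derivative at every point of H, and f(H) equals the closure of c. -/

import Mathlib

open Set Filter Topology
open scoped ContDiff
set_option linter.all false

namespace CS

/-- Global diffeomorphism between normed spaces. -/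
structure Df (E F : Type*) [NormedAddCommGroup E] [NormedSpace ℝ E] [NormedAddCommGroup F]
    [NormedSpace ℝ F] extends E ≃ F where
  smooth' : ContDiff ℝ ∞ toFun
  smooth_inv' : ContDiff ℝ ∞ invFun

namespace Df
variable {E F G : Type*} [NormedAddCommGroup E] [NormedSpace ℝ E] [NormedAddCommGroup F]
    [NormedSpace ℝ F] [NormedAddCommGroup G] [NormedSpace ℝ G]

instance : CoeFun (Df E F) (fun _ => E → F) := ⟨fun f => f.toEquiv⟩

theorem smooth (f : Df E F) : ContDiff ℝ ∞ f := f.smooth'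
theorem continuous (f : Df E F) : Continuous f := f.smooth.continuous
theorem injective (f : Df E F) : Function.Injective f := f.toEquiv.injective
theorem surjective (f : Df E F) : Function.Surjective f := f.toEquiv.surjective

def symm (f : Df E F) : Df F E := ⟨f.toEquiv.symm, f.smooth_inv', f.smooth'⟩
def refl (E : Type*) [NormedAddCommGroup E] [NormedSpace ℝ E] : Df E E :=
  ⟨Equiv.refl E, contDiff_id, contDiff_id⟩
def trans (f : Df E F) (g : Df F G) : Df E G :=
  ⟨f.toEquiv.trans g.toEquiv, g.smooth.comp f.smooth, f.symm.smooth.comp g.symm.smooth⟩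

@[simp] theorem refl_apply (x : E) : Df.refl E x = x := rfl
@[simp] theorem trans_apply (f : Df E F) (g : Df F G) (x : E) : f.trans g x = g (f x) := rfl
@[simp] theorem symm_apply_apply (f : Df E F) (x : E) : f.symm (f x) = x :=
  f.toEquiv.symm_apply_apply x
@[simp] theorem apply_symm_apply (f : Df E F) (x : F) : f (f.symm x) = x :=
  f.toEquiv.apply_symm_apply x
@[simp] theorem symm_symm (f : Df E F) : f.symm.symm = f := rfl
theorem symm_trans_apply (f : Df E F) (g : Df F G) (x : G) :
  (f.trans g).symm x = f.symm (g.symm x) := rfl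
theorem eq_symm (f : Df E F) {x : E} {y : F} : x = f.symm y ↔ f x = y := by
  constructor
  · rintro rfl; simp
  · rintro rfl; simp
theorem symm_eq (f : Df E F) {x : E} {y : F} : f.symm y = x ↔ y = f x := by
  constructor
  · rintro rfl; simp
  · rintro rfl; simp

/-- explicit construction -/
def mk' (f : E → F) (g : F → E) (hf : ContDiff ℝ ∞ f) (hg : ContDiff ℝ ∞ g)
    (h1 : ∀ x, g (f x) = x) (h2 : ∀ y, f (g y) = y) : Df E F := ⟨⟨f, g, h1, h2⟩, hf, hg⟩
@[simp] theorem mk'_apply (f : E → F) (g : F → E) (hf hg h1 h2) (x : E) :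
  (Df.mk' f g hf hg h1 h2) x = f x := rfl
@[simp] theorem mk'_symm_apply (f : E → F) (g : F → E) (hf hg h1 h2) (x : F) :
  (Df.mk' f g hf hg h1 h2).symm x = g x := rfl

def ofCLE (L : E ≃L[ℝ] F) : Df E F := ⟨L.toEquiv, L.contDiff, L.symm.contDiff⟩
@[simp] theorem ofCLE_apply (L : E ≃L[ℝ] F) (x : E) : Df.ofCLE L x = L x := rfl
@[simp] theorem ofCLE_symm_apply (L : E ≃L[ℝ] F) (x : F) : (Df.ofCLE L).symm x = L.symm x := rfl

def toHomeo (f : Df E F) : E ≃ₜ F := ⟨f.toEquiv, f.continuous, f.symm.continuous⟩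
@[simp] theorem toHomeo_apply (f : Df E F) (x : E) : f.toHomeo x = f x := rfl

theorem fderiv_injective (f : Df E F) (x : E) : Function.Injective (fderiv ℝ f x) := by
  have h : (fderiv ℝ f.symm (f x)).comp (fderiv ℝ f x) = ContinuousLinearMap.id ℝ E := by
    rw [← fderiv_comp]
    · have : (f.symm ∘ f) = id := by funext y; simp
      rw [this, fderiv_id]
    · exact (f.symm.smooth.differentiable (by simp)).differentiableAt
    · exact (f.smooth.differentiable (by simp)).differentiableAt
  intro a b hab
  have := congrArg (fun L => L a) h
  have h2 := congrArg (fun L => L b) h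
  simp at this h2
  rw [← this, ← h2, hab]

theorem image_compact (f : Df E F) {K : Set E} (hK : IsCompact K) : IsCompact (f '' K) :=
  hK.image f.continuous
theorem image_open (f : Df E F) {K : Set E} (hK : IsOpen K) : IsOpen (f '' K) :=
  f.toHomeo.isOpenMap K hK
theorem image_closed (f : Df E F) {K : Set E} (hK : IsClosed K) : IsClosed (f '' K) :=
  f.toHomeo.isClosedMap K hK

theorem image_eq_preimage (f : Df E F) (K : Set E) : f '' K = f.symm ⁻¹' K :=
  f.toEquiv.image_eq_preimage_symm K

/-- bounded preimages -/
theorem exists_bound [ProperSpace F] (f : Df E F) (R : ℝ) : ∃ R', ∀ x, ‖f x‖ ≤ R → ‖x‖ ≤ R' := by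
  have hc : IsCompact (f.symm '' Metric.closedBall 0 R) :=
    f.symm.image_compact (isCompact_closedBall _ _)
  obtain ⟨R', hR'⟩ := hc.isBounded.exists_norm_le
  exact ⟨R', fun x hx => hR' x ⟨f x, by simpa using hx, by simp⟩⟩

end Df

section inv
variable {E F : Type*} [NormedAddCommGroup E] [NormedSpace ℝ E] [NormedAddCommGroup F]
    [NormedSpace ℝ F] [FiniteDimensional ℝ E] [FiniteDimensional ℝ F]

/-- derivative as an equivalence -/
theorem exists_cle (hdim : Module.finrank ℝ E = Module.finrank ℝ F) {L : E →L[ℝ] F}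
    (hL : Function.Injective L) : ∃ L' : E ≃L[ℝ] F, (L' : E →L[ℝ] F) = L := by
  refine ⟨(LinearEquiv.ofInjectiveOfFinrankEq (L : E →ₗ[ℝ] F) hL hdim).toContinuousLinearEquiv, ?_⟩
  ext x; rfl

theorem local_diffeo (hdim : Module.finrank ℝ E = Module.finrank ℝ F) {f : E → F} {x : E}
    (hf : ContDiffAt ℝ ∞ f x) (hd : Function.Injective (fderiv ℝ f x)) :
    map f (𝓝 x) = 𝓝 (f x) ∧ ∃ g : F → E, ContDiffAt ℝ ∞ g (f x) ∧ g (f x) = x ∧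
      ∀ᶠ y in 𝓝 (f x), f (g y) = y := by
  obtain ⟨L, hL⟩ := exists_cle hdim hd
  have h1 : HasFDerivAt f (L : E →L[ℝ] F) x := by
    rw [hL]; exact (hf.differentiableAt (by simp)).hasFDerivAt
  have : CompleteSpace E := FiniteDimensional.complete ℝ E
  have h2 : HasStrictFDerivAt f (L : E →L[ℝ] F) x := hf.hasStrictFDerivAt' h1 (by simp)
  refine ⟨h2.map_nhds_eq_of_equiv, hf.localInverse h1 (by simp), hf.to_localInverse h1 (by simp),
    hf.localInverse_apply_image h1 (by simp), ?_⟩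
  exact h2.eventually_right_inverse

theorem isOpen_image_of (hdim : Module.finrank ℝ E = Module.finrank ℝ F) {f : E → F} {U : Set E}
    (hU : IsOpen U) (hf : ∀ x ∈ U, ContDiffAt ℝ ∞ f x)
    (hd : ∀ x ∈ U, Function.Injective (fderiv ℝ f x)) : IsOpen (f '' U) := by
  rw [isOpen_iff_mem_nhds]
  rintro _ ⟨x, hx, rfl⟩
  rw [← (local_diffeo hdim (hf x hx) (hd x hx)).1]
  exact image_mem_map (hU.mem_nhds hx)

theorem contDiffAt_leftInv (hdim : Module.finrank ℝ E = Module.finrank ℝ F) {f : E → F} {U : Set E}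
    (hU : IsOpen U) (hf : ∀ x ∈ U, ContDiffAt ℝ ∞ f x)
    (hd : ∀ x ∈ U, Function.Injective (fderiv ℝ f x)) {g : F → E} (hg : ∀ x ∈ U, g (f x) = x)
    {x : E} (hx : x ∈ U) : ContDiffAt ℝ ∞ g (f x) := by
  obtain ⟨-, g', h1, h2, h3⟩ := local_diffeo hdim (hf x hx) (hd x hx)
  refine h1.congr_of_eventuallyEq ?_
  have h4 : ∀ᶠ y in 𝓝 (f x), g' y ∈ U := by
    apply h1.continuousAt
    rw [h2]; exact hU.mem_nhds hx
  filter_upwards [h3, h4] with y hy hy'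
  conv_lhs => rw [← hy]
  exact hg _ hy'

theorem exists_Df_of_bijective (hdim : Module.finrank ℝ E = Module.finrank ℝ F) {f : E → F}
    (hf : ContDiff ℝ ∞ f) (hb : Function.Bijective f)
    (hd : ∀ x, Function.Injective (fderiv ℝ f x)) : ∃ h : Df E F, ∀ x, h x = f x := by
  have hs : ContDiff ℝ ∞ (Equiv.ofBijective f hb).symm := by
    rw [contDiff_iff_contDiffAt]
    intro y
    obtain ⟨x, rfl⟩ := hb.2 y
    exact contDiffAt_leftInv hdim isOpen_univ (fun x _ => hf.contDiffAt) (fun x _ => hd x)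
      (fun x _ => Equiv.ofBijective_symm_apply_apply f hb x) (mem_univ x)
  exact ⟨⟨Equiv.ofBijective f hb, hf, hs⟩, fun x => rfl⟩

/-- injectivity of the derivative from a local left inverse -/
theorem fderiv_injective_of_leftInv {f : E → F} {g : F → E} {x : E}
    (hf : DifferentiableAt ℝ f x) (hg : DifferentiableAt ℝ g (f x))
    (h : ∀ᶠ y in 𝓝 x, g (f y) = y) : Function.Injective (fderiv ℝ f x) := by
  have h1 : fderiv ℝ (g ∘ f) x = ContinuousLinearMap.id ℝ E := by
    have : (g ∘ f) =ᶠ[𝓝 x] id := h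
    rw [this.fderiv_eq, fderiv_id]
  rw [fderiv_comp x hg hf] at h1
  intro a b hab
  have := congrArg (fun L => L a) h1
  have h2 := congrArg (fun L => L b) h1
  simp at this h2
  rw [← this, ← h2, hab]

/-- open embedding data on an open set -/
structure OEmb (θ : E → F) (U : Set E) : Prop where
  isOpen : IsOpen U
  smooth : ∀ x ∈ U, ContDiffAt ℝ ∞ θ x
  inj : InjOn θ U
  deriv_inj : ∀ x ∈ U, Function.Injective (fderiv ℝ θ x)

theorem OEmb.comp_Df {θ : E → F} {U : Set E} (h : OEmb θ U) (g : Df E E) (hg : ∀ x ∈ U, g x ∈ U) :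
    ∀ x ∈ U, ContDiffAt ℝ ∞ (fun x => θ (g x)) x := by
  intro x hx
  exact (h.smooth _ (hg x hx)).comp x g.smooth.contDiffAt

/-- **Transport lemma.** -/
theorem transport (hdim : Module.finrank ℝ E = Module.finrank ℝ F) {θ : E → F} {U : Set E}
    (h : OEmb θ U) (g : Df E E) {Z : Set E} (hZU : Z ⊆ U) (hZ : IsClosed (θ '' Z))
    (hg : ∀ x, x ∉ Z → g x = x) :
    ∃ H : Df F F, (∀ x ∈ U, H (θ x) = θ (g x)) ∧ ∀ y, y ∉ θ '' Z → H y = y := by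
  classical
  -- invariance
  have inv1 : ∀ g : Df E E, (∀ x, x ∉ Z → g x = x) → ∀ x ∈ U, g x ∈ U := by
    intro g hg x hx
    by_cases hxz : g x ∈ Z
    · exact hZU hxz
    · have : g (g x) = g x := hg _ hxz
      rw [g.injective this]; exact hx
  have gsymm : ∀ x, x ∉ Z → g.symm x = x := by
    intro x hx
    rw [Df.symm_eq, hg x hx]
  let φ : F → E := Function.invFunOn θ U
  have hφ : ∀ x ∈ U, φ (θ x) = x := fun x hx => h.inj.leftInvOn_invFunOn hx
  let hh : Df E E → F → F := fun g y => if y ∈ θ '' U then θ (g (φ y)) else y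
  have hval : ∀ g x, x ∈ U → hh g (θ x) = θ (g x) := by
    intro g x hx
    have : θ x ∈ θ '' U := mem_image_of_mem _ hx
    simp only [hh, this, if_true, hφ x hx]
  have hoff : ∀ g : Df E E, (∀ x, x ∉ Z → g x = x) → ∀ y, y ∉ θ '' Z → hh g y = y := by
    intro g hg y hy
    by_cases hyU : y ∈ θ '' U
    · obtain ⟨x, hx, rfl⟩ := hyU
      rw [hval g x hx, hg]
      intro hxZ; exact hy (mem_image_of_mem _ hxZ)
    · simp only [hh, hyU, if_false]
  have hsm : ∀ g : Df E E, (∀ x, x ∉ Z → g x = x) → ContDiff ℝ ∞ (hh g) := by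
    intro g hg
    rw [contDiff_iff_contDiffAt]
    intro y
    by_cases hyU : y ∈ θ '' U
    · have hop : IsOpen (θ '' U) := isOpen_image_of hdim h.isOpen h.smooth h.deriv_inj
      obtain ⟨x, hx, rfl⟩ := hyU
      have h1 : ContDiffAt ℝ ∞ (fun y => θ (g (φ y))) (θ x) := by
        have h2 : ContDiffAt ℝ ∞ φ (θ x) := contDiffAt_leftInv hdim h.isOpen h.smooth h.deriv_inj hφ hx
        have h3 : ContDiffAt ℝ ∞ (fun x => θ (g x)) (φ (θ x)) := by
          rw [hφ x hx]; exact h.comp_Df g (inv1 g hg) x hx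
        exact h3.comp (θ x) h2
      refine h1.congr_of_eventuallyEq ?_
      filter_upwards [hop.mem_nhds (mem_image_of_mem θ hx)] with z hz
      simp only [hh, hz, if_true]
    · have hy : y ∈ (θ '' Z)ᶜ := fun hy => hyU (image_mono hZU hy)
      refine contDiffAt_id.congr_of_eventuallyEq ?_
      filter_upwards [hZ.isOpen_compl.mem_nhds hy] with z hz
      exact hoff g hg z hz
  have hinv : ∀ g : Df E E, (∀ x, x ∉ Z → g x = x) → (∀ x, x ∉ Z → g.symm x = x) →
      ∀ y, hh g.symm (hh g y) = y := by
    intro g hg hg' y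
    by_cases hyU : y ∈ θ '' U
    · obtain ⟨x, hx, rfl⟩ := hyU
      rw [hval g x hx, hval _ _ (inv1 g hg x hx)]
      simp
    · have hy : y ∉ θ '' Z := fun hy => hyU (image_mono hZU hy)
      rw [hoff g hg y hy, hoff _ hg' y hy]
  refine ⟨Df.mk' (hh g) (hh g.symm) (hsm g hg) (hsm g.symm gsymm) (hinv g hg gsymm)
    (hinv g.symm gsymm hg), ?_, ?_⟩
  · intro x hx; exact hval g x hx
  · intro y hy; exact hoff g hg y hy

end inv
end CS


namespace CS

section select
variable {E F : Type*} [NormedAddCommGroup E] [NormedSpace ℝ E] [FiniteDimensional ℝ E]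
  [NormedAddCommGroup F] [NormedSpace ℝ F]
open scoped Manifold

theorem smooth_select_local {t : E → Set F} (ht : ∀ x, Convex ℝ (t x))
    (Hloc : ∀ x, ∃ U ∈ 𝓝 x, ∃ g : E → F, ContDiffOn ℝ ∞ g U ∧ ∀ y ∈ U, g y ∈ t y) :
    ∃ f : E → F, ContDiff ℝ ∞ f ∧ ∀ x, f x ∈ t x := by
  have : ProperSpace E := FiniteDimensional.proper ℝ E
  obtain ⟨g, hg⟩ := exists_contMDiffMap_forall_mem_convex_of_local (n := ⊤) 𝓘(ℝ, E) ht (by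
    intro x
    obtain ⟨U, hU, g, hg, h⟩ := Hloc x
    exact ⟨U, hU, g, contMDiffOn_iff_contDiffOn.2 hg, h⟩)
  exact ⟨g, contMDiff_iff_contDiff.1 g.contMDiff, hg⟩

theorem smooth_select {t : E → Set F} (ht : ∀ x, Convex ℝ (t x))
    (Hloc : ∀ x, ∃ c : F, ∀ᶠ y in 𝓝 x, c ∈ t y) :
    ∃ f : E → F, ContDiff ℝ ∞ f ∧ ∀ x, f x ∈ t x :=
  smooth_select_local ht fun x => by
    obtain ⟨c, hc⟩ := Hloc x
    exact ⟨_, hc, fun _ => c, contDiffOn_const, fun _ => id⟩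

/-- smooth positive function below a locally-bounded-below positive one -/
theorem smooth_below {P : E → ℝ → Prop} (hP : ∀ x a b, P x a → 0 < b → b ≤ a → P x b)
    (Hloc : ∀ x, ∃ c > 0, ∀ᶠ y in 𝓝 x, P y c) :
    ∃ f : E → ℝ, ContDiff ℝ ∞ f ∧ ∀ x, 0 < f x ∧ P x (f x) := by
  obtain ⟨f, hf, h⟩ := smooth_select (t := fun x => {a | 0 < a ∧ P x a}) (by
      intro x
      apply OrdConnected.convex
      constructor
      rintro a ⟨ha, ha'⟩ b ⟨hb, hb'⟩ c ⟨hc, hc'⟩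
      exact ⟨lt_of_lt_of_le ha hc, hP x b c hb' (lt_of_lt_of_le ha hc) hc'⟩) (by
      intro x
      obtain ⟨c, hc, h⟩ := Hloc x
      exact ⟨c, by filter_upwards [h] with y hy using ⟨hc, hy⟩⟩)
  exact ⟨f, hf, h⟩

theorem smooth_above {P : E → ℝ → Prop} (hP : ∀ x a b, P x a → a ≤ b → P x b)
    (Hloc : ∀ x, ∃ c, ∀ᶠ y in 𝓝 x, P y c) :
    ∃ f : E → ℝ, ContDiff ℝ ∞ f ∧ ∀ x, P x (f x) := by
  obtain ⟨f, hf, h⟩ := smooth_select (t := fun x => {a | P x a}) (by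
      intro x
      apply OrdConnected.convex
      constructor
      rintro a ha b hb c ⟨hc, hc'⟩
      exact hP x a c ha hc) Hloc
  exact ⟨f, hf, h⟩

theorem exists_bump (c : E) {a b : ℝ} (ha : 0 < a) (hab : a < b) :
    ∃ χ : E → ℝ, ContDiff ℝ ∞ χ ∧ (∀ x, 0 ≤ χ x) ∧ (∀ x, χ x ≤ 1) ∧ (∀ x, ‖x - c‖ ≤ a → χ x = 1) ∧
      (∀ x, b ≤ ‖x - c‖ → χ x = 0) ∧ (∀ x, ‖x - c‖ < b → 0 < χ x) := by
  let f : ContDiffBump c := ⟨a, b, ha, hab⟩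
  refine ⟨f, f.contDiff, f.nonneg', fun x => f.le_one, fun x hx => f.one_of_mem_closedBall ?_,
    fun x hx => f.zero_of_le_dist ?_, fun x hx => f.pos_of_mem_ball ?_⟩
  · rwa [mem_closedBall_iff_norm]
  · rwa [dist_eq_norm]
  · rwa [mem_ball_iff_norm]

end select

theorem hasDerivAt_antideriv {u : ℝ → ℝ} (hu : ContDiff ℝ ∞ u) (a y : ℝ) :
    HasDerivAt (fun y => ∫ x in a..y, u x) (u y) y :=
  (hu.continuous.integral_hasStrictDerivAt a y).hasDerivAt

theorem contDiff_antideriv {u : ℝ → ℝ} (hu : ContDiff ℝ ∞ u) (a : ℝ) :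
    ContDiff ℝ ∞ (fun y => ∫ x in a..y, u x) := by
  rw [contDiff_infty_iff_deriv]
  constructor
  · intro y; exact (hasDerivAt_antideriv hu a y).differentiableAt
  · have : deriv (fun y => ∫ x in a..y, u x) = u := by
      funext y; exact (hasDerivAt_antideriv hu a y).deriv
    rw [this]; exact hu

/-- one dimensional squeezing diffeomorphism -/
theorem squeeze1D {δ Y Y₂ : ℝ} (hδ : 0 < δ) (hY : δ < Y) (hY2 : Y < Y₂) :
    ∃ φ : ℝ → ℝ, ContDiff ℝ ∞ φ ∧ (∀ y, 0 < deriv φ y) ∧ (∀ y ≤ δ / 2, φ y = y) ∧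
      (∀ y, Y₂ ≤ y → φ y = y) ∧ (∀ y ≤ Y, φ y < 2 * δ) := by
  obtain ⟨b1, s1, n1, l1, o1, z1, p1⟩ := exists_bump ((δ + Y) / 2) (a := (Y - δ) / 2)
    (b := (Y - δ) / 2 + min (δ/2) ((Y₂ - Y)/2)) (by linarith)
    (by have : 0 < min (δ/2) ((Y₂ - Y)/2) := lt_min (by linarith) (by linarith)
        linarith)
  obtain ⟨b2, s2, n2, l2, o2, z2, p2⟩ := exists_bump ((Y + Y₂) / 2) (a := (Y₂ - Y) / 4)
    (b := (Y₂ - Y) / 2) (by linarith) (by linarith)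
  have m1 := min_le_left (δ/2) ((Y₂ - Y)/2)
  have m2 := min_le_right (δ/2) ((Y₂ - Y)/2)
  simp only [Real.norm_eq_abs] at *
  have b1z : ∀ y ≤ δ/2, b1 y = 0 := fun y hy => z1 y (by rw [abs_of_neg (by linarith)]; linarith)
  have b1z' : ∀ y, Y₂ ≤ y → b1 y = 0 := fun y hy => z1 y (by rw [abs_of_pos (by linarith)]; linarith)
  have b2z : ∀ y ≤ Y, b2 y = 0 := fun y hy => z2 y (by rw [abs_of_neg (by linarith)]; linarith)
  have b2z' : ∀ y, Y₂ ≤ y → b2 y = 0 := fun y hy => z2 y (by rw [abs_of_pos (by linarith)]; linarith)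
  have b1o : ∀ y, δ ≤ y → y ≤ Y → b1 y = 1 := fun y h1 h2 => o1 y (by rw [abs_le]; constructor <;> linarith)
  let ε : ℝ := min (1/2) (δ / (2 * Y))
  have hε : 0 < ε := lt_min (by norm_num) (by have : 0 < Y := by linarith
                                              positivity)
  have hε1 : ε ≤ 1/2 := min_le_left _ _
  have hε2 : ε * Y ≤ δ / 2 := by
    have : ε ≤ δ / (2 * Y) := min_le_right _ _
    have hY0 : 0 < Y := by linarith
    calc ε * Y ≤ δ / (2 * Y) * Y := by gcongr
      _ = δ / 2 := by field_simp
  have i2pos : 0 < ∫ x in (0:ℝ)..Y₂, b2 x := by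
    have h1 : 0 < ∫ x in Y..Y₂, b2 x := by
      apply intervalIntegral.intervalIntegral_pos_of_pos_on (s2.continuous.intervalIntegrable _ _) _ hY2
      intro x hx
      exact p2 x (by rw [abs_lt]; constructor <;> linarith [hx.1, hx.2])
    have h2 : 0 ≤ ∫ x in (0:ℝ)..Y, b2 x :=
      intervalIntegral.integral_nonneg (by linarith) (fun x _ => n2 x)
    rw [← intervalIntegral.integral_add_adjacent_intervals (s2.continuous.intervalIntegrable 0 Y)
      (s2.continuous.intervalIntegrable Y Y₂)]
    linarith
  have i1nn : 0 ≤ ∫ x in (0:ℝ)..Y₂, b1 x :=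
    intervalIntegral.integral_nonneg (by linarith) (fun x _ => n1 x)
  let c : ℝ := (1 - ε) * (∫ x in (0:ℝ)..Y₂, b1 x) / ∫ x in (0:ℝ)..Y₂, b2 x
  have hc : 0 ≤ c := by
    apply div_nonneg _ i2pos.le
    apply mul_nonneg (by linarith) i1nn
  let u : ℝ → ℝ := fun y => c * b2 y - (1 - ε) * b1 y
  have hu : ContDiff ℝ ∞ u := (contDiff_const.mul s2).sub (contDiff_const.mul s1)
  have hu1 : ∀ y, -1 < u y := by
    intro y
    have := mul_nonneg hc (n2 y)
    have := l1 y
    have : (1 - ε) * b1 y ≤ (1 - ε) * 1 := by gcongr; linarith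
    simp only [u]; linarith
  have hD : ∀ y, HasDerivAt (fun y => y + ∫ x in (0:ℝ)..y, u x) (1 + u y) y := fun y =>
    (hasDerivAt_id y).add (hasDerivAt_antideriv hu 0 y)
  refine ⟨fun y => y + ∫ x in (0:ℝ)..y, u x, contDiff_id.add (contDiff_antideriv hu 0), ?_, ?_, ?_, ?_⟩
  · intro y; rw [(hD y).deriv]; linarith [hu1 y]
  · intro y hy
    have : ∫ x in (0:ℝ)..y, u x = 0 := by
      rw [intervalIntegral.integral_congr (g := fun _ => 0)]
      · simp
      · intro x hx
        have hx' : x ≤ δ/2 := by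
          rcases le_total 0 y with h | h
          · rw [uIcc_of_le h] at hx; linarith [hx.2]
          · rw [uIcc_of_ge h] at hx; linarith [hx.2]
        simp only [u, b1z x hx', b2z x (by linarith)]; ring
    simp [this]
  · intro y hy
    have h1 : ∫ x in Y₂..y, u x = 0 := by
      rw [intervalIntegral.integral_congr (g := fun _ => 0)]
      · simp
      · intro x hx
        rw [uIcc_of_le hy] at hx
        simp only [u, b1z' x hx.1, b2z' x hx.1]; ring
    have h2 : ∫ x in (0:ℝ)..Y₂, u x = 0 := by
      simp only [u]
      rw [intervalIntegral.integral_sub, intervalIntegral.integral_const_mul,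
        intervalIntegral.integral_const_mul]
      · simp only [c]; field_simp; ring
      · exact ((contDiff_const.mul s2).continuous).intervalIntegrable _ _
      · exact ((contDiff_const.mul s1).continuous).intervalIntegrable _ _
    have : ∫ x in (0:ℝ)..y, u x = 0 := by
      rw [← intervalIntegral.integral_add_adjacent_intervals (hu.continuous.intervalIntegrable 0 Y₂)
        (hu.continuous.intervalIntegrable Y₂ y), h1, h2]; simp
    simp [this]
  · intro y hy
    have hmono : StrictMono (fun y => y + ∫ x in (0:ℝ)..y, u x) :=
      strictMono_of_deriv_pos (fun y => by rw [(hD y).deriv]; linarith [hu1 y])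
    refine lt_of_le_of_lt (hmono.monotone hy) ?_
    show Y + ∫ x in (0:ℝ)..Y, u x < 2 * δ
    rw [← intervalIntegral.integral_add_adjacent_intervals (hu.continuous.intervalIntegrable 0 δ)
        (hu.continuous.intervalIntegrable δ Y)]
    have h1 : ∫ x in (0:ℝ)..δ, u x ≤ ∫ x in (0:ℝ)..δ, (0:ℝ) := by
      apply intervalIntegral.integral_mono_on hδ.le (hu.continuous.intervalIntegrable _ _) (by simp)
      intro x hx
      simp only [u, b2z x (by linarith [hx.2])]
      nlinarith [n1 x, hx.1, hε1]
    have h2 : ∫ x in δ..Y, u x = ∫ x in δ..Y, (-(1-ε)) := by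
      apply intervalIntegral.integral_congr
      intro x hx
      rw [uIcc_of_le hY.le] at hx
      simp only [u, b2z x hx.2, b1o x hx.1 hx.2]; ring
    rw [h2]
    simp only [intervalIntegral.integral_const, smul_eq_mul] at h1 ⊢
    nlinarith [mul_pos hε hδ]

section fib
variable {X : Type*} [NormedAddCommGroup X] [NormedSpace ℝ X] [FiniteDimensional ℝ X]

/-- fiberwise diffeomorphisms -/
theorem fiberwise_Df {φ : X × ℝ → ℝ} (hφ : ContDiff ℝ ∞ φ)
    (hd : ∀ x s, 0 < deriv (fun s => φ (x, s)) s) (hs : ∀ x, Function.Surjective (fun s => φ (x, s))) :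
    ∃ h : Df (X × ℝ) (X × ℝ), ∀ p, h p = (p.1, φ p) := by
  have hsm : ContDiff ℝ ∞ (fun p : X × ℝ => (p.1, φ p)) := contDiff_fst.prodMk hφ
  refine exists_Df_of_bijective rfl hsm ⟨?_, ?_⟩ ?_
  · rintro ⟨x, s⟩ ⟨x', s'⟩ h
    simp only [Prod.mk.injEq] at h
    obtain ⟨rfl, h⟩ := h
    have := (strictMono_of_deriv_pos (hd x)).injective h
    rw [this]
  · rintro ⟨x, s⟩
    obtain ⟨s', hs'⟩ := hs x s
    exact ⟨(x, s'), by simp at hs'; simp [hs']⟩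
  · rintro ⟨x, s⟩
    have hφd : HasFDerivAt φ (fderiv ℝ φ (x, s)) (x, s) :=
      ((hφ.differentiable (by simp)) (x, s)).hasFDerivAt
    have h1 : HasFDerivAt (fun p : X × ℝ => (p.1, φ p))
      ((ContinuousLinearMap.fst ℝ X ℝ).prod (fderiv ℝ φ (x, s))) (x, s) :=
      hasFDerivAt_fst.prodMk hφd
    rw [h1.fderiv, injective_iff_map_eq_zero]
    rintro ⟨a, b⟩ hab
    simp only [ContinuousLinearMap.prod_apply, ContinuousLinearMap.coe_fst', Prod.mk_eq_zero] at hab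
    obtain ⟨rfl, hab⟩ := hab
    have h2 : HasDerivAt (fun s => φ (x, s)) (fderiv ℝ φ (x, s) (0, 1)) s := by
      have := hφd.comp_hasDerivAt s ((hasDerivAt_const s x).prodMk (hasDerivAt_id s))
      exact this
    have h3 := hd x s
    rw [h2.deriv] at h3
    have h4 : fderiv ℝ φ (x, s) (0, b) = b * fderiv ℝ φ (x, s) (0, 1) := by
      have : ((0:X), b) = b • ((0:X), (1:ℝ)) := by simp
      rw [this, map_smul, smul_eq_mul]
    rw [h4] at hab
    have : b = 0 := by
      rcases mul_eq_zero.1 hab with h | h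
      · exact h
      · linarith
    rw [this]; rfl

theorem surjective_of_id_off {f : ℝ → ℝ} (hf : Continuous f) {R : ℝ} (h1 : ∀ s, R ≤ s → f s = s)
    (h2 : ∀ s, s ≤ -R → f s = s) : Function.Surjective f := by
  apply hf.surjective
  · apply tendsto_id.congr'
    filter_upwards [eventually_ge_atTop R] with s hs
    exact (h1 s hs).symm
  · apply tendsto_id.congr'
    filter_upwards [eventually_le_atBot (-R)] with s hs
    exact (h2 s hs).symm

/-- perturbation of the identity -/
theorem id_add_Df {w : X → X} (hw : ContDiff ℝ ∞ w) (h : ∀ x, ‖fderiv ℝ w x‖ ≤ 1/2) :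
    ∃ T : Df X X, ∀ x, T x = x + w x := by
  have hc : CompleteSpace X := FiniteDimensional.complete ℝ X
  have hdiff : Differentiable ℝ w := hw.differentiable (by simp)
  have hlip : LipschitzWith (1/2) w := lipschitzWith_of_nnnorm_fderiv_le hdiff (fun x => by
    rw [← NNReal.coe_le_coe]; simpa using h x)
  refine exists_Df_of_bijective rfl (contDiff_id.add hw) ⟨?_, ?_⟩ ?_
  · intro x y hxy
    have h1 : dist (w x) (w y) ≤ (1/2) * dist x y := by simpa using hlip.dist_le_mul x y
    have h2 : dist (w x) (w y) = dist x y := by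
      have : w x - w y = y - x := by
        have : x + w x = y + w y := hxy
        rw [sub_eq_sub_iff_add_eq_add, add_comm, this, add_comm]
      rw [dist_eq_norm, this, dist_comm, dist_eq_norm]
    rw [h2] at h1
    have := dist_nonneg (x := x) (y := y)
    exact dist_eq_zero.1 (by linarith)
  · intro y
    have hcw : ContractingWith (1/2) (fun x => y - w x) := by
      refine ⟨by rw [← NNReal.coe_lt_coe]; norm_num, ?_⟩
      apply LipschitzWith.of_dist_le_mul
      intro a b
      rw [dist_sub_left]; exact hlip.dist_le_mul a b
    refine ⟨hcw.fixedPoint, ?_⟩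
    have := hcw.fixedPoint_isFixedPt
    simp only [Function.IsFixedPt] at this
    show hcw.fixedPoint + w hcw.fixedPoint = y
    nth_rewrite 1 [← this]
    simp
  · intro x
    have h1 : HasFDerivAt (fun x => x + w x) (ContinuousLinearMap.id ℝ X + fderiv ℝ w x) x :=
      (hasFDerivAt_id x).add (hdiff x).hasFDerivAt
    rw [h1.fderiv, injective_iff_map_eq_zero]
    intro v hv
    simp at hv
    have h3 : ‖fderiv ℝ w x v‖ ≤ 1/2 * ‖v‖ := (fderiv ℝ w x).le_of_opNorm_le (h x) v
    have h4 : ‖v‖ = ‖fderiv ℝ w x v‖ := by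
      rw [← norm_neg (fderiv ℝ w x v)]; congr 1; exact eq_neg_of_add_eq_zero_left hv
    have := norm_nonneg v
    exact norm_eq_zero.1 (by linarith)
end fib
end CS


namespace CS

section defs
variable {D E : Type*} [NormedAddCommGroup D] [NormedSpace ℝ D] [NormedAddCommGroup E]
    [NormedSpace ℝ E]

/-- tube data -/
structure Tube (I : D × ℝ → E) : Prop where
  smooth : ContDiff ℝ ∞ I
  inj : Function.Injective I
  dinj : ∀ p, Function.Injective (fderiv ℝ I p)
  slab : ∀ R, ∃ R', ∀ p : D × ℝ, |p.2| ≤ 1 → ‖I p‖ ≤ R → ‖p‖ ≤ R'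

/-- `V` is the positive side of the tube. -/
structure Side (I : D × ℝ → E) (V : Set E) : Prop where
  isOpen : IsOpen V
  mem_iff : ∀ p, I p ∈ V ↔ 0 < p.2
  closure_sub : closure V ⊆ V ∪ I '' {p | p.2 = 0}

/-- engulfing property -/
def Eng (V : Set E) : Prop := ∀ O : Set E, IsOpen O → Vᶜ ⊆ O → ∀ K : Set E, IsCompact K →
  ∃ h : Df E E, ∃ N : Set E, IsOpen N ∧ Vᶜ ⊆ N ∧ (∀ y ∈ N, h y = y) ∧ h '' K ⊆ O

theorem Tube.oEmb [FiniteDimensional ℝ D] [FiniteDimensional ℝ E] {I : D × ℝ → E} (h : Tube I) :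
    OEmb I univ := ⟨isOpen_univ, fun x _ => h.smooth.contDiffAt, h.inj.injOn, fun x _ => h.dinj x⟩

theorem Tube.isOpenEmbedding [FiniteDimensional ℝ D] [FiniteDimensional ℝ E]
    (hdim : Module.finrank ℝ (D × ℝ) = Module.finrank ℝ E) {I : D × ℝ → E} (h : Tube I) :
    IsOpenEmbedding I := by
  apply IsOpenEmbedding.of_continuous_injective_isOpenMap h.smooth.continuous h.inj
  intro U hU
  exact isOpen_image_of hdim hU (fun x _ => h.smooth.contDiffAt) (fun x _ => h.dinj x)

theorem Side.mem_closure {I : D × ℝ → E} {V : Set E} (hI : Continuous I) (h : Side I V)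
   (p : D × ℝ) : I p ∈ closure V ↔ 0 ≤ p.2 ∨ I p ∈ I '' {p | p.2 = 0} := by
  constructor
  · intro hp
    rcases h.closure_sub hp with hp | hp
    · left; exact ((h.mem_iff p).1 hp).le
    · exact Or.inr hp
  · have key : ∀ p : D × ℝ, 0 ≤ p.2 → I p ∈ closure V := by
      rintro ⟨x, s⟩ hs
      simp only at hs
      have ht : Tendsto (fun n : ℕ => I (x, s + 1 / ((n:ℝ) + 1))) atTop (𝓝 (I (x, s + 0))) := by
        apply (hI.tendsto _).comp
        apply Tendsto.prodMk_nhds tendsto_const_nhds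
        exact tendsto_const_nhds.add tendsto_one_div_add_atTop_nhds_zero_nat
      rw [add_zero] at ht
      refine mem_closure_of_tendsto ht (Eventually.of_forall fun n => ?_)
      rw [h.mem_iff]
      simp only
      positivity
    rintro (hp | ⟨q, hq, hqp⟩)
    · exact key p hp
    · rw [← hqp]; exact key q (le_of_eq hq.symm)

end defs

section limit
variable {D E : Type*} [NormedAddCommGroup D] [NormedSpace ℝ D] [NormedAddCommGroup E]
    [NormedSpace ℝ E] [FiniteDimensional ℝ D] [FiniteDimensional ℝ E]
    (hdim : Module.finrank ℝ (D × ℝ) = Module.finrank ℝ E)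
    {I : D × ℝ → E} {V : Set E} (hI : Tube I) (hV : Side I V)
include hdim hI hV

theorem isOpen_O : IsOpen (Vᶜ ∪ range I) := by
  have hr : IsOpen (range I) := (hI.isOpenEmbedding hdim).isOpen_range
  have : Vᶜ ∪ range I = (closure V)ᶜ ∪ range I := by
    ext y
    constructor
    · rintro (hy | hy)
      · by_cases hc : y ∈ closure V
        · rcases hV.closure_sub hc with h | ⟨p, -, rfl⟩
          · exact absurd h hy
          · exact Or.inr (mem_range_self p)
        · exact Or.inl hc
      · exact Or.inr hy
    · rintro (hy | hy)
      · exact Or.inl (fun h => hy (subset_closure h))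
      · exact Or.inr hy
  rw [this]
  exact isClosed_closure.isOpen_compl.union hr

theorem eng2 (hE : Eng V) {j : ℝ} (hj : 1 ≤ j) {K : Set E} (hK : IsCompact K) :
    ∃ h : Df E E, (∀ y ∈ Vᶜ, h y = y) ∧ (∀ p : D × ℝ, ‖p‖ ≤ j → h (I p) = I p) ∧
      h '' K ⊆ Vᶜ ∪ range I := by
  have : ProperSpace (D × ℝ) := FiniteDimensional.proper ℝ _
  have : ProperSpace D := FiniteDimensional.proper ℝ _
  have hB : IsCompact (I '' Metric.closedBall (0 : D × ℝ) (j+1)) :=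
    (isCompact_closedBall _ _).image hI.smooth.continuous
  obtain ⟨h₀, N, hN, hVN, hfix, him⟩ := hE _ (isOpen_O hdim hI hV) subset_union_left _ (hK.union hB)
  -- epsilon
  obtain ⟨ε, hε, hεN⟩ : ∃ ε > 0, ∀ x : D, ∀ s : ℝ, ‖x‖ ≤ j → |s| ≤ ε → I (x, s) ∈ N := by
    have hc : IsCompact ((Metric.closedBall (0:D) j) ×ˢ ({0} : Set ℝ)) :=
      (isCompact_closedBall _ _).prod isCompact_singleton
    have hsub : (Metric.closedBall (0:D) j) ×ˢ ({0} : Set ℝ) ⊆ I ⁻¹' N := by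
      rintro ⟨x, s⟩ ⟨-, hs⟩
      apply hVN
      simp only [mem_singleton_iff] at hs
      rw [mem_compl_iff, hV.mem_iff]; simp [hs]
    obtain ⟨ε, hε, h⟩ := hc.exists_cthickening_subset_open (hN.preimage hI.smooth.continuous) hsub
    refine ⟨ε, hε, fun x s hx hs => ?_⟩
    apply h
    apply Metric.mem_cthickening_of_dist_le (x, s) (x, 0)
    · exact ⟨by simpa using hx, rfl⟩
    · simpa [Prod.dist_eq, hε.le] using hs
  -- the squeeze
  obtain ⟨φ, sφ, dφ, φ1, φ2, φ3⟩ := squeeze1D (δ := min (ε/2) (1/2)) (Y := j) (Y₂ := j+1)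
    (by positivity) (by have := min_le_right (ε/2) (1/2); linarith) (by linarith)
  have hδ1 : 2 * min (ε/2) (1/2) ≤ ε := by have := min_le_left (ε/2) (1/2); linarith
  have hδ0 : 0 < min (ε/2) (1/2) := by positivity
  obtain ⟨a, sa, a0, a1, aone, azero, -⟩ := exists_bump (0:D) (a := j) (b := j+1) (by linarith) (by linarith)
  simp only [sub_zero] at aone azero
  have φmono : StrictMono φ := strictMono_of_deriv_pos dφ
  obtain ⟨ς, hς⟩ := fiberwise_Df (X := D) (φ := fun p => (1 - a p.1) * p.2 + a p.1 * φ p.2)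
    (((contDiff_const.sub (sa.comp contDiff_fst)).mul contDiff_snd).add
      ((sa.comp contDiff_fst).mul (sφ.comp contDiff_snd))) (by
      intro x s
      have h1 : HasDerivAt (fun s => (1 - a x) * s + a x * φ s) ((1 - a x) * 1 + a x * deriv φ s) s :=
        ((hasDerivAt_id s).const_mul _).add
          (((sφ.differentiable (by simp)) s).hasDerivAt.const_mul _)
      rw [h1.deriv]
      have h2 := dφ s
      have h3 := a0 x
      have h4 := a1 x
      rcases eq_or_lt_of_le h3 with h | h
      · rw [← h]; norm_num
      · have := mul_pos h h2; nlinarith) (by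
      intro x
      apply surjective_of_id_off (R := j + 1)
      · have := sφ.continuous
        fun_prop
      · intro s hs; simp only [φ2 s hs]; ring
      · intro s hs; simp only [φ1 s (by linarith)]; ring)
  -- transport
  obtain ⟨S, hS1, hS2⟩ := transport hdim hI.oEmb ς (Z := Metric.closedBall (0 : D × ℝ) (j+1))
    (subset_univ _) hB.isClosed (by
      rintro ⟨x, s⟩ hp
      rw [hς]
      simp only [Metric.mem_closedBall, dist_zero_right, not_le, Prod.norm_def, lt_max_iff] at hp
      rcases hp with hp | hp
      · simp [azero x hp.le]
      · have : φ s = s := by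
          rw [Real.norm_eq_abs, lt_abs] at hp
          rcases hp with hp | hp
          · exact φ2 s hp.le
          · exact φ1 s (by linarith)
        simp only [this]
        congr 1; ring)
  have hS1' : ∀ p, S (I p) = I (ς p) := fun p => hS1 p (mem_univ _)
  have SV : ∀ y ∈ Vᶜ, S y = y := by
    intro y hy
    by_cases hyB : y ∈ I '' Metric.closedBall (0 : D × ℝ) (j+1)
    · obtain ⟨p, hp, rfl⟩ := hyB
      rw [mem_compl_iff, hV.mem_iff, not_lt] at hy
      rw [hS1' p, hς, φ1 p.2 (by linarith)]
      congr 1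
      ext <;> simp
      ring
    · exact hS2 y hyB
  have SsV : ∀ y ∈ Vᶜ, S.symm y = y := fun y hy => by rw [Df.symm_eq, SV y hy]
  have SsO : ∀ y ∈ Vᶜ ∪ range I, S.symm y ∈ Vᶜ ∪ range I := by
    rintro y (hy | ⟨p, rfl⟩)
    · left; rw [SsV y hy]; exact hy
    · right; exact ⟨ς.symm p, by rw [Df.eq_symm, hS1']; simp⟩
  refine ⟨(S.trans h₀).trans S.symm, ?_, ?_, ?_⟩
  · intro y hy
    simp only [Df.trans_apply, SV y hy, hfix y (hVN hy), SsV y hy]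
  · rintro p hp
    by_cases hps : 0 < p.2
    · have : S (I p) ∈ N := by
        rw [hS1', hς]
        have hx : ‖p.1‖ ≤ j := (norm_fst_le p).trans hp
        have hs : p.2 ≤ j := (le_abs_self _).trans ((norm_snd_le p).trans hp)
        apply hεN _ _ hx
        rw [aone _ hx]
        have h1 := φ3 p.2 hs
        have h2 : φ 0 ≤ φ p.2 := φmono.monotone hps.le
        rw [φ1 0 (by positivity)] at h2
        rw [abs_le]; constructor <;> linarith
      simp only [Df.trans_apply, hfix _ this, Df.symm_apply_apply]
    · have hy : I p ∈ Vᶜ := by rwa [mem_compl_iff, hV.mem_iff]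
      simp only [Df.trans_apply, SV _ hy, hfix _ (hVN hy), SsV _ hy]
  · rintro _ ⟨y, hy, rfl⟩
    simp only [Df.trans_apply]
    apply SsO
    apply him
    apply mem_image_of_mem
    by_cases hyB : y ∈ I '' Metric.closedBall (0 : D × ℝ) (j+1)
    · right
      obtain ⟨p, hp, rfl⟩ := hyB
      rw [hS1']
      by_contra hcon
      have : S (I (ς p)) = I (ς p) := hS2 _ hcon
      rw [← hS1'] at this
      have h3 := S.injective this
      rw [← hS1', h3] at hcon
      exact hcon (mem_image_of_mem _ hp)
    · left; rw [hS2 y hyB]; exact hy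

theorem limit_step (hE : Eng V) (j : ℕ) (H : Df E E) (n : ℕ) (hn : 1 ≤ n)
    (hH : ∀ y ∈ Vᶜ, H y = y) :
    ∃ (H' : Df E E) (n' : ℕ), (∀ y ∈ Vᶜ, H' y = y) ∧ n < n' ∧
      (∀ p, ‖p‖ ≤ n → H' (I p) = H (I p)) ∧
      (∀ y ∈ closure V, ‖y‖ ≤ j → ∃ p : D × ℝ, 0 ≤ p.2 ∧ ‖p‖ ≤ n' ∧ H' (I p) = y) := by
  have : ProperSpace E := FiniteDimensional.proper ℝ _
  have hK : IsCompact (H.symm '' Metric.closedBall (0:E) j) :=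
    H.symm.image_compact (isCompact_closedBall _ _)
  obtain ⟨h, h1, h2, h3⟩ := eng2 hdim hI hV hE (j := n) (by exact_mod_cast hn) hK
  have hC : IsCompact (h '' (H.symm '' Metric.closedBall (0:E) j) ∩ closure V) :=
    (h.image_compact hK).inter_right isClosed_closure
  have hsub : h '' (H.symm '' Metric.closedBall (0:E) j) ∩ closure V ⊆ range I := by
    rintro y ⟨hy, hy'⟩
    rcases h3 hy with hh | hh
    · rcases hV.closure_sub hy' with h4 | ⟨p, -, rfl⟩
      · exact absurd h4 hh
      · exact mem_range_self p
    · exact hh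
  have hC' : IsCompact (I ⁻¹' (h '' (H.symm '' Metric.closedBall (0:E) j) ∩ closure V)) :=
    (hI.isOpenEmbedding hdim).isInducing.isCompact_preimage' hC hsub
  obtain ⟨R, hR⟩ := hC'.isBounded.exists_norm_le
  have hclos : ∀ y ∈ closure V, ∀ g : Df E E, (∀ y ∈ Vᶜ, g y = y) → g.symm y ∈ closure V := by
    intro y hy g hg
    have : closure V = g '' closure V := by
      have hgV : g '' V = V := by
        ext z
        constructor
        · rintro ⟨w, hw, rfl⟩
          by_contra hz
          have := g.injective (hg _ hz)
          rw [this] at hz; exact hz hw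
        · intro hz
          refine ⟨g.symm z, ?_, by simp⟩
          by_contra hw
          have := hg _ hw
          rw [Df.apply_symm_apply] at this
          rw [← this] at hw; exact hw hz
      have := g.toHomeo.image_closure V
      change g '' closure V = closure (g '' V) at this
      rw [this, hgV]
    rw [this] at hy
    obtain ⟨z, hz, rfl⟩ := hy
    simpa using hz
  refine ⟨h.symm.trans H, max (n+1) ⌈R⌉₊, ?_, ?_, ?_, ?_⟩
  · intro y hy
    have : h.symm y = y := by rw [Df.symm_eq, h1 y hy]
    rw [Df.trans_apply, this, hH y hy]
  · exact lt_of_lt_of_le (Nat.lt_succ_self n) (le_max_left _ _)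
  · intro p hp
    have : h.symm (I p) = I p := by rw [Df.symm_eq, h2 p hp]
    rw [Df.trans_apply, this]
  · intro y hy hyj
    have hz1 : h (H.symm y) ∈ closure V := by
      have h5 := hclos y hy H hH
      have h6 := hclos _ h5 h.symm (fun y hy => by rw [Df.symm_eq, h1 y hy])
      simpa using h6
    have hz2 : h (H.symm y) ∈ h '' (H.symm '' Metric.closedBall (0:E) j) ∩ closure V :=
      ⟨mem_image_of_mem _ (mem_image_of_mem _ (by simpa using hyj)), hz1⟩
    obtain ⟨p, hp⟩ := hsub hz2
    have hpn : ‖p‖ ≤ (max (n+1) ⌈R⌉₊ : ℕ) := by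
      refine (hR p (by rw [mem_preimage, hp]; exact hz2)).trans ?_
      refine (Nat.le_ceil R).trans ?_
      exact_mod_cast le_max_right _ _
    refine ⟨p, ?_, hpn, ?_⟩
    · rw [← hp, hV.mem_closure hI.smooth.continuous] at hz1
      rcases hz1 with h | ⟨q, hq, hqp⟩
      · exact h
      · rw [← hI.inj hqp]; exact le_of_eq hq.symm
    · simp [hp]

theorem limit_thm (hE : Eng V) : ∃ f : D × ℝ → E, ContDiff ℝ ∞ f ∧ (∀ x, f (x, 0) = I (x, 0)) ∧
    Function.Injective f ∧ (∀ p, Function.Injective (fderiv ℝ f p)) ∧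
    f '' {p | 0 ≤ p.2} = closure V ∧ ∀ R, ∃ R', ∀ p : D × ℝ, 0 ≤ p.2 → ‖f p‖ ≤ R → ‖p‖ ≤ R' := by
  classical
  let St := {q : Df E E × ℕ // 1 ≤ q.2 ∧ ∀ y ∈ Vᶜ, q.1 y = y}
  have step : ∀ (j : ℕ) (q : St), ∃ q' : St, q.1.2 < q'.1.2 ∧
      (∀ p, ‖p‖ ≤ q.1.2 → q'.1.1 (I p) = q.1.1 (I p)) ∧
      (∀ y ∈ closure V, ‖y‖ ≤ j → ∃ p : D × ℝ, 0 ≤ p.2 ∧ ‖p‖ ≤ q'.1.2 ∧ q'.1.1 (I p) = y) := by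
    rintro j ⟨⟨H, n⟩, hn, hH⟩
    obtain ⟨H', n', h1, h2, h3, h4⟩ := limit_step hdim hI hV hE j H n hn hH
    exact ⟨⟨⟨H', n'⟩, hn.trans h2.le, h1⟩, h2, h3, h4⟩
  choose nxt hn1 hn2 hn3 using step
  let seq : ℕ → St := fun k => Nat.rec ⟨⟨Df.refl E, 1⟩, le_refl _, fun y _ => rfl⟩ (fun j q => nxt j q) k
  have seqS : ∀ k, seq (k+1) = nxt k (seq k) := fun k => rfl
  have sn : ∀ k, k < (seq k).1.2 := by
    intro k
    induction k with
    | zero => exact (seq 0).2.1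
    | succ k ih => have := hn1 k (seq k); rw [← seqS] at this; omega
  have snm : Monotone (fun k => (seq k).1.2) := monotone_nat_of_le_succ (fun k => (hn1 k (seq k)).le)
  have agree : ∀ k l, k ≤ l → ∀ p, ‖p‖ ≤ (seq k).1.2 → (seq l).1.1 (I p) = (seq k).1.1 (I p) := by
    intro k l hkl
    induction l, hkl using Nat.le_induction with
    | base => intro p _; rfl
    | succ l hl ih =>
      intro p hp
      rw [← ih p hp, seqS]
      apply hn2
      exact hp.trans (by exact_mod_cast snm hl)
  let f : D × ℝ → E := fun p => (seq ⌈‖p‖⌉₊).1.1 (I p)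
  have hf : ∀ k p, ‖p‖ ≤ (seq k).1.2 → f p = (seq k).1.1 (I p) := by
    intro k p hp
    have h1 : ‖p‖ ≤ (seq ⌈‖p‖⌉₊).1.2 := (Nat.le_ceil _).trans (by exact_mod_cast (sn _).le)
    rcases le_total k ⌈‖p‖⌉₊ with h | h
    · exact agree _ _ h p hp
    · exact (agree _ _ h p h1).symm
  have hfev : ∀ p, ∃ k, f =ᶠ[𝓝 p] fun p => (seq k).1.1 (I p) := by
    intro p
    obtain ⟨k, hk⟩ := exists_nat_gt ‖p‖
    refine ⟨k, ?_⟩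
    have : ∀ᶠ q in 𝓝 p, ‖q‖ < k := (continuous_norm.tendsto p).eventually (gt_mem_nhds hk)
    filter_upwards [this] with q hq
    exact hf k q (hq.le.trans (by exact_mod_cast (sn k).le))
  have finj : Function.Injective f := by
    intro p q hpq
    obtain ⟨k, hk⟩ := exists_nat_gt (max ‖p‖ ‖q‖)
    have hk' : (k:ℝ) ≤ (seq k).1.2 := by exact_mod_cast (sn k).le
    rw [hf k p (by linarith [le_max_left ‖p‖ ‖q‖]), hf k q (by linarith [le_max_right ‖p‖ ‖q‖])] at hpq
    exact hI.inj ((seq k).1.1.injective hpq)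
  have fsurj : ∀ y ∈ closure V, ∀ j : ℕ, ‖y‖ ≤ j → ∃ p : D × ℝ, 0 ≤ p.2 ∧ ‖p‖ ≤ (seq (j+1)).1.2 ∧ f p = y := by
    intro y hy j hj
    obtain ⟨p, hp0, hp1, hp2⟩ := hn3 j (seq j) y hy hj
    rw [← seqS] at hp1 hp2
    exact ⟨p, hp0, hp1, by rw [hf (j+1) p hp1, hp2]⟩
  have fcl : ∀ p : D × ℝ, 0 ≤ p.2 → f p ∈ closure V := by
    intro p hp
    rcases eq_or_lt_of_le hp with h | h
    · have : I p ∈ Vᶜ := by rw [mem_compl_iff, hV.mem_iff]; linarith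
      have h2 : f p = I p := (seq _).2.2 _ this
      rw [h2, hV.mem_closure hI.smooth.continuous]; exact Or.inl hp
    · apply subset_closure
      by_contra hcon
      have := (seq _).1.1.injective ((seq _).2.2 _ hcon)
      have h3 : I p ∈ Vᶜ := by rw [← this]; exact hcon
      exact h3 ((hV.mem_iff p).2 h)
  refine ⟨f, ?_, ?_, finj, ?_, ?_, ?_⟩
  · rw [contDiff_iff_contDiffAt]
    intro p
    obtain ⟨k, hk⟩ := hfev p
    exact (((seq k).1.1.smooth.comp hI.smooth).contDiffAt).congr_of_eventuallyEq hk
  · intro x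
    apply (seq _).2.2
    rw [mem_compl_iff, hV.mem_iff]; simp
  · intro p
    obtain ⟨k, hk⟩ := hfev p
    rw [hk.fderiv_eq]
    have : fderiv ℝ (fun p => (seq k).1.1 (I p)) p = (fderiv ℝ (seq k).1.1 (I p)).comp (fderiv ℝ I p) :=
      fderiv_comp p ((seq k).1.1.smooth.differentiable (by simp)).differentiableAt
        (hI.smooth.differentiable (by simp)).differentiableAt
    rw [this]
    exact ((seq k).1.1.fderiv_injective _).comp (hI.dinj p)
  · apply Subset.antisymm
    · rintro _ ⟨p, hp, rfl⟩; exact fcl p hp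
    · intro y hy
      obtain ⟨j, hj⟩ := exists_nat_ge ‖y‖
      obtain ⟨p, h1, -, h2⟩ := fsurj y hy j hj
      exact ⟨p, h1, h2⟩
  · intro R
    obtain ⟨j, hj⟩ := exists_nat_ge R
    refine ⟨(seq (j+1)).1.2, fun p hp hR => ?_⟩
    obtain ⟨q, h1, h2, h3⟩ := fsurj (f p) (fcl p hp) j (hR.trans hj)
    rwa [← finj h3]
end limit
end CS


namespace CS

theorem isClosed_image_of_bound {X Y : Type*} [NormedAddCommGroup X] [ProperSpace X]
    [NormedAddCommGroup Y] {f : X → Y} (hf : Continuous f) {C : Set X} (hC : IsClosed C)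
    (hb : ∀ R, ∃ R', ∀ x ∈ C, ‖f x‖ ≤ R → ‖x‖ ≤ R') : IsClosed (f '' C) := by
  rw [← closure_subset_iff_isClosed]
  intro y hy
  obtain ⟨R', hR'⟩ := hb (‖y‖ + 1)
  have hcomp : IsCompact (f '' (C ∩ Metric.closedBall 0 R')) :=
    ((isCompact_closedBall (0:X) R').inter_left hC).image hf
  have h1 : y ∈ closure (f '' C ∩ Metric.ball y 1) := by
    rw [mem_closure_iff_nhds] at hy ⊢
    intro t ht
    obtain ⟨z, hz1, hz2⟩ := hy (t ∩ Metric.ball y 1) (inter_mem ht (Metric.ball_mem_nhds y one_pos))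
    exact ⟨z, hz1.1, hz2, hz1.2⟩
  have h2 : f '' C ∩ Metric.ball y 1 ⊆ f '' (C ∩ Metric.closedBall 0 R') := by
    rintro _ ⟨⟨x, hx, rfl⟩, hb⟩
    refine ⟨x, ⟨hx, ?_⟩, rfl⟩
    rw [mem_closedBall_zero_iff]
    apply hR' x hx
    rw [mem_ball_iff_norm] at hb
    calc ‖f x‖ = ‖(f x - y) + y‖ := by simp
      _ ≤ ‖f x - y‖ + ‖y‖ := norm_add_le _ _
      _ ≤ _ := by linarith
  have h3 : y ∈ f '' (C ∩ Metric.closedBall 0 R') := closure_minimal h2 hcomp.isClosed h1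
  exact image_mono inter_subset_left h3

/-- smooth local left inverse for a function of one variable -/
theorem local_leftInv {f : ℝ → ℝ} (hf : ContDiff ℝ ∞ f) {t₀ : ℝ} (h : deriv f t₀ ≠ 0) :
    ∃ U : Set ℝ, IsOpen U ∧ t₀ ∈ U ∧ IsOpen (f '' U) ∧ ∃ g : ℝ → ℝ, ContDiffOn ℝ ∞ g (f '' U) ∧
      ∀ t ∈ U, g (f t) = t := by
  have hinj : ∀ t, deriv f t ≠ 0 → Function.Injective (fderiv ℝ f t) := by
    intro t ht
    rw [injective_iff_map_eq_zero]
    intro a ha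
    have : fderiv ℝ f t a = a * deriv f t := by
      rw [← fderiv_apply_one_eq_deriv, ← smul_eq_mul, ← map_smul]; simp
    rw [this] at ha
    exact (mul_eq_zero.1 ha).resolve_right ht
  obtain ⟨L, hL⟩ := exists_cle (rfl) (hinj t₀ h)
  have h1 : HasFDerivAt f (L : ℝ →L[ℝ] ℝ) t₀ := by
    rw [hL]; exact (hf.contDiffAt.differentiableAt (by simp)).hasFDerivAt
  have h2 : HasStrictFDerivAt f (L : ℝ →L[ℝ] ℝ) t₀ := hf.contDiffAt.hasStrictFDerivAt' h1 (by simp)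
  have h3 := h2.eventually_left_inverse
  have h4 : ∀ᶠ t in 𝓝 t₀, deriv f t ≠ 0 :=
    (hf.continuous_deriv (by simp)).continuousAt.eventually_ne h
  obtain ⟨U, hU, hUo, ht⟩ := eventually_nhds_iff.1 (h3.and h4)
  refine ⟨U, hUo, ht, isOpen_image_of rfl hUo (fun x _ => hf.contDiffAt) (fun x hx => hinj x (hU x hx).2),
    h2.localInverse, ?_, fun t ht => (hU t ht).1⟩
  rintro _ ⟨t, ht, rfl⟩
  exact (contDiffAt_leftInv rfl hUo (fun x _ => hf.contDiffAt) (fun x hx => hinj x (hU x hx).2)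
    (fun x hx => (hU x hx).1) ht).contDiffWithinAt

section line
variable {Y : Type*} [NormedAddCommGroup Y] [NormedSpace ℝ Y] [FiniteDimensional ℝ Y]

/-- extension of a function off a properly embedded curve -/
theorem extend_off_curve {y : ℝ → Y} (hy : ContDiff ℝ ∞ y) (hinj : Function.Injective y)
    (hd : ∀ t, deriv y t ≠ 0) (hp : ∀ R, ∃ R', ∀ t, ‖y t‖ ≤ R → ‖t‖ ≤ R') {b : ℝ → ℝ}
    (hb : ContDiff ℝ ∞ b) : ∃ ψ : Y → ℝ, ContDiff ℝ ∞ ψ ∧ ∀ t, ψ (y t) = b t := by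
  have hclosed : ∀ C : Set ℝ, IsClosed C → IsClosed (y '' C) := fun C hC =>
    isClosed_image_of_bound hy.continuous hC (fun R => by
      obtain ⟨R', h⟩ := hp R
      exact ⟨R', fun x _ => h x⟩)
  obtain ⟨ψ, hψ, h⟩ := smooth_select_local (E := Y) (F := ℝ) (t := fun p => {c | ∀ t, y t = p → c = b t}) (by
      intro p u hu v hv α β hα hβ hαβ t ht
      simp only [mem_setOf_eq] at hu hv
      rw [hu t ht, hv t ht]
      simp only [smul_eq_mul]
      rw [← add_mul, hαβ, one_mul]) (by
      intro p
      by_cases hpr : p ∈ range y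
      · obtain ⟨t₀, rfl⟩ := hpr
        obtain ⟨l, hl1, hl2⟩ := exists_dual_vector ℝ (deriv y t₀) (norm_ne_zero_iff.2 (hd t₀))
        have hder : ∀ t, HasDerivAt (fun t => l (y t)) (l (deriv y t)) t := fun t =>
          l.hasFDerivAt.comp_hasDerivAt t ((hy.differentiable (by simp)) t).hasDerivAt
        obtain ⟨U, hUo, htU, hfo, g, hg, hgl⟩ := local_leftInv (f := fun t => l (y t))
          (l.contDiff.comp hy) (t₀ := t₀) (by
            rw [(hder t₀).deriv, hl2]; simpa using hd t₀)
        refine ⟨(l ⁻¹' ((fun t => l (y t)) '' U)) ∩ (y '' Uᶜ)ᶜ, ?_, fun q => b (g (l q)), ?_, ?_⟩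
        · apply inter_mem
          · apply (hfo.preimage l.continuous).mem_nhds
            exact ⟨t₀, htU, rfl⟩
          · apply (hclosed _ hUo.isClosed_compl).isOpen_compl.mem_nhds
            rintro ⟨t, ht, hty⟩
            rw [hinj hty] at ht
            exact ht htU
        · apply hb.comp_contDiffOn
          apply hg.comp l.contDiff.contDiffOn
          intro q hq; exact hq.1
        · rintro q ⟨hq1, hq2⟩ t rfl
          have htU' : t ∈ U := by
            by_contra hcon
            exact hq2 ⟨t, hcon, rfl⟩
          show b (g (l (y t))) = b t
          rw [hgl t htU']
      · refine ⟨(range y)ᶜ, ?_, fun _ => 0, contDiffOn_const, ?_⟩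
        · rw [← image_univ] at hpr ⊢
          exact (hclosed _ isClosed_univ).isOpen_compl.mem_nhds hpr
        · rintro q hq t rfl
          exact absurd (mem_range_self t) hq)
  exact ⟨ψ, hψ, fun t => h (y t) t rfl⟩

/-- **Line straightening** -/
theorem line_straighten (hY : 4 ≤ Module.finrank ℝ Y) {z : ℝ → ℝ} {y : ℝ → Y} (hz : ContDiff ℝ ∞ z)
    (hy : ContDiff ℝ ∞ y) (hinj : ∀ t u, z t = z u → y t = y u → t = u)
    (hd : ∀ t, deriv z t ≠ 0 ∨ deriv y t ≠ 0)
    (hp : ∀ R, ∃ R', ∀ t, |z t| ≤ R → ‖y t‖ ≤ R → |t| ≤ R') :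
    ∃ Φ : Df (ℝ × Y) (ℝ × Y), ∀ t, Φ (z t, y t) = (t, 0) := by
  have : ProperSpace Y := FiniteDimensional.proper ℝ Y
  -- S0
  obtain ⟨y₀, hy₀⟩ : ∃ y₀, y₀ ∉ range y := by
    have := (hy.of_le (n := ∞) (m := 1) (by simp)).dense_compl_range_of_finrank_lt_finrank (by simp; omega)
    exact this.nonempty
  have hne : ∀ t, 0 < ‖y t - y₀‖ := fun t => norm_pos_iff.2 (fun h => hy₀ ⟨t, by rwa [sub_eq_zero] at h⟩)
  -- S1
  obtain ⟨A, sA, hA⟩ := smooth_above (E := ℝ) (P := fun ζ a => 0 < a ∧ ∀ t, z t = ζ → |ζ| ≤ a * ‖y t - y₀‖)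
    (by
      rintro ζ a b ⟨ha, h⟩ hab
      refine ⟨lt_of_lt_of_le ha hab, fun t ht => (h t ht).trans ?_⟩
      gcongr) (by
      intro ζ
      obtain ⟨R', hR'⟩ := hp (|ζ| + 1 + ‖y₀‖ + 1)
      have hcomp : IsCompact (Icc (-R') R') := isCompact_Icc
      obtain ⟨μ, hμ, hμb⟩ : ∃ μ > 0, ∀ t ∈ Icc (-R') R', μ ≤ ‖y t - y₀‖ := by
        rcases (Icc (-R') R').eq_empty_or_nonempty with h | h
        · exact ⟨1, one_pos, by simp [h]⟩
        · obtain ⟨t, ht, hmin⟩ := hcomp.exists_isMinOn h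
            (f := fun t => ‖y t - y₀‖) ((hy.continuous.sub continuous_const).norm.continuousOn)
          exact ⟨_, hne t, fun u hu => hmin hu⟩
      have hm : 0 < min μ 1 := lt_min hμ one_pos
      refine ⟨(|ζ| + 1) / min μ 1, ?_⟩
      filter_upwards [Metric.ball_mem_nhds ζ one_pos] with ζ' hζ'
      rw [Metric.mem_ball, Real.dist_eq] at hζ'
      have hz' : |ζ'| ≤ |ζ| + 1 := by
        have := abs_sub_abs_le_abs_sub ζ' ζ; linarith
      refine ⟨by positivity, fun t ht => ?_⟩
      have hmin : min μ 1 ≤ ‖y t - y₀‖ := by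
        by_cases h1 : ‖y t - y₀‖ ≤ 1
        · apply (min_le_left _ _).trans
          apply hμb t
          rw [mem_Icc, ← abs_le]
          have h2 : ‖y t‖ ≤ ‖y t - y₀‖ + ‖y₀‖ := by
            simpa using norm_add_le (y t - y₀) y₀
          have := norm_nonneg y₀
          have := abs_nonneg ζ
          exact hR' t (by rw [ht]; linarith) (by linarith)
        · exact (min_le_right _ _).trans (not_le.1 h1).le
      calc |ζ'| ≤ |ζ| + 1 := hz'
        _ = (|ζ| + 1) / min μ 1 * min μ 1 := by field_simp
        _ ≤ _ := by gcongr)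
  let y1 : ℝ → Y := fun t => A (z t) • (y t - y₀)
  have sy1 : ContDiff ℝ ∞ y1 := (sA.comp hz).smul (hy.sub contDiff_const)
  have hzy1 : ∀ t, |z t| ≤ ‖y1 t‖ := fun t => by
    have := (hA (z t)).2 t rfl
    rwa [norm_smul, Real.norm_of_nonneg (hA (z t)).1.le]
  let Φ1 : Df (ℝ × Y) (ℝ × Y) := Df.mk' (fun p => (p.1, A p.1 • (p.2 - y₀)))
    (fun p => (p.1, (A p.1)⁻¹ • p.2 + y₀))
    (contDiff_fst.prodMk ((sA.comp contDiff_fst).smul (contDiff_snd.sub contDiff_const)))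
    (contDiff_fst.prodMk ((((sA.comp contDiff_fst).inv (fun x => (hA x.1).1.ne'))).smul contDiff_snd |>.add contDiff_const))
    (fun p => by simp [smul_smul, inv_mul_cancel₀ (hA p.1).1.ne'])
    (fun p => by simp [smul_smul, mul_inv_cancel₀ (hA p.1).1.ne'])
  have hΦ1 : ∀ t, Φ1 (z t, y t) = (z t, y1 t) := fun t => rfl
  have sr : ContDiff ℝ ∞ (fun t => (z t, y t)) := hz.prodMk hy
  have hinj1 : ∀ t u, z t = z u → y1 t = y1 u → t = u := by
    intro t u h1 h2
    have : (z t, y t) = (z u, y u) := Φ1.injective (by rw [hΦ1, hΦ1, h1, h2])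
    simp only [Prod.mk.injEq] at this
    exact hinj t u this.1 this.2
  have hdz : ∀ t, HasDerivAt z (deriv z t) t := fun t => ((hz.differentiable (by simp)) t).hasDerivAt
  have hdy : ∀ t, HasDerivAt y (deriv y t) t := fun t => ((hy.differentiable (by simp)) t).hasDerivAt
  have hdy1 : ∀ t, HasDerivAt y1 (deriv y1 t) t := fun t => ((sy1.differentiable (by simp)) t).hasDerivAt
  have hd1 : ∀ t, deriv z t ≠ 0 ∨ deriv y1 t ≠ 0 := by
    intro t
    by_contra hcon
    push Not at hcon
    have h1 : HasDerivAt (fun t => Φ1 (z t, y t)) (fderiv ℝ Φ1 (z t, y t) (deriv z t, deriv y t)) t :=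
      ((Φ1.smooth.differentiable (by simp)) _).hasFDerivAt.comp_hasDerivAt t ((hdz t).prodMk (hdy t))
    have h2 : HasDerivAt (fun t => Φ1 (z t, y t)) (deriv z t, deriv y1 t) t := (hdz t).prodMk (hdy1 t)
    have h3 := h1.unique h2
    rw [hcon.1, hcon.2] at h3
    have h4 : fderiv ℝ Φ1 (z t, y t) (0, deriv y t) = fderiv ℝ Φ1 (z t, y t) 0 := by
      rw [h3, map_zero]; rfl
    have h5 := Φ1.fderiv_injective _ h4
    rcases hd t with h | h
    · exact h hcon.1
    · exact h (congrArg Prod.snd h5)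
  have hp1 : ∀ R, ∃ R', ∀ t, ‖y1 t‖ ≤ R → |t| ≤ R' := by
    intro R
    obtain ⟨R1, h1⟩ := Φ1.exists_bound R
    obtain ⟨R2, h2⟩ := hp R1
    refine ⟨R2, fun t ht => ?_⟩
    have := h1 (z t, y t) (by
      rw [hΦ1, Prod.norm_def]; exact max_le ((hzy1 t).trans ht) ht)
    exact h2 t ((norm_fst_le (z t, y t)).trans this) ((norm_snd_le (z t, y t)).trans this)
  -- S2
  obtain ⟨v, hv, hv1, hv2⟩ : ∃ v : Y, ‖v‖ ≤ 1/2 ∧ (∀ t u w : ℝ, v ≠ w • (y1 t - y1 u)) ∧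
      ∀ t w : ℝ, v ≠ w • deriv y1 t := by
    let m1 : ℝ × ℝ × ℝ → Y := fun p => p.2.2 • (y1 p.1 - y1 p.2.1)
    let m2 : ℝ × ℝ × ℝ → Y := fun p => p.2.2 • (deriv y1 p.1)
    have sm1 : ContDiff ℝ ∞ m1 := contDiff_snd.snd.smul
      ((sy1.comp contDiff_fst).sub (sy1.comp (contDiff_fst.comp contDiff_snd)))
    have sdy1 : ContDiff ℝ ∞ (deriv y1) := (contDiff_infty_iff_deriv.1 sy1).2
    have sm2 : ContDiff ℝ ∞ m2 := contDiff_snd.snd.smul (sdy1.comp contDiff_fst)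
    have d1 := (sm1.of_le (n := ∞) (m := 1) (by simp)).dimH_range_le
    have d2 := (sm2.of_le (n := ∞) (m := 1) (by simp)).dimH_range_le
    have hdense : Dense ((range m1 ∪ range m2)ᶜ) := by
      apply dense_compl_of_dimH_lt_finrank
      rw [dimH_union]
      have h3 : Module.finrank ℝ (ℝ × ℝ × ℝ) = 3 := by simp
      rw [h3] at d1 d2
      refine lt_of_le_of_lt (max_le d1 d2) ?_
      exact_mod_cast (by omega : 3 < Module.finrank ℝ Y)
    obtain ⟨v, hvb, hvm⟩ := hdense.inter_open_nonempty (Metric.ball 0 (1/2)) Metric.isOpen_ball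
      ⟨0, by simp⟩
    refine ⟨v, by simpa using (mem_ball_zero_iff.1 hvb).le, ?_, ?_⟩
    · rintro t u w rfl
      exact hvm (Or.inl ⟨(t, u, w), rfl⟩)
    · rintro t w rfl
      exact hvm (Or.inr ⟨(t, 0, w), rfl⟩)
  let y2 : ℝ → Y := fun t => y1 t - z t • v
  have sy2 : ContDiff ℝ ∞ y2 := sy1.sub (hz.smul contDiff_const)
  have hinj2 : Function.Injective y2 := by
    intro t u htu
    have h1 : y1 t - y1 u = (z t - z u) • v := by
      have h : y1 t - z t • v = y1 u - z u • v := htu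
      rw [sub_smul]
      rw [sub_eq_sub_iff_add_eq_add] at h ⊢
      rw [add_comm (z t • v), h]; 
    by_cases h : z t = z u
    · rw [h, sub_self, zero_smul, sub_eq_zero] at h1
      exact hinj1 t u h h1
    · exfalso
      apply hv1 t u (z t - z u)⁻¹
      rw [h1, smul_smul, inv_mul_cancel₀ (sub_ne_zero.2 h), one_smul]
  have hd2 : ∀ t, deriv y2 t ≠ 0 := by
    intro t h
    have h1 : HasDerivAt y2 (deriv y1 t - deriv z t • v) t := (hdy1 t).sub ((hdz t).smul_const v)
    rw [h1.deriv, sub_eq_zero] at h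
    by_cases h0 : deriv z t = 0
    · rcases hd1 t with h' | h'
      · exact h' h0
      · rw [h0, zero_smul] at h; exact h' h
    · apply hv2 t (deriv z t)⁻¹
      rw [h, smul_smul, inv_mul_cancel₀ h0, one_smul]
  have hp2 : ∀ R, ∃ R', ∀ t, ‖y2 t‖ ≤ R → ‖t‖ ≤ R' := by
    intro R
    obtain ⟨R', h⟩ := hp1 (2 * R)
    refine ⟨R', fun t ht => h t ?_⟩
    have h1 : ‖y1 t‖ ≤ ‖y2 t‖ + ‖z t • v‖ := by
      have := norm_add_le (y2 t) (z t • v)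
      simpa [y2] using this
    have h2 : ‖z t • v‖ ≤ ‖y1 t‖ * (1/2) := by
      rw [norm_smul]
      exact mul_le_mul (hzy1 t) hv (norm_nonneg _) (norm_nonneg _)
    linarith
  let Φ2 : Df (ℝ × Y) (ℝ × Y) := Df.mk' (fun p => (p.1, p.2 - p.1 • v)) (fun p => (p.1, p.2 + p.1 • v))
    (contDiff_fst.prodMk (contDiff_snd.sub (contDiff_fst.smul contDiff_const)))
    (contDiff_fst.prodMk (contDiff_snd.add (contDiff_fst.smul contDiff_const)))
    (fun p => by simp) (fun p => by simp)
  -- S3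
  obtain ⟨ψ, sψ, hψ⟩ := extend_off_curve sy2 hinj2 hd2 hp2 (b := fun t => t - z t) (contDiff_id.sub hz)
  let Φ3 : Df (ℝ × Y) (ℝ × Y) := Df.mk' (fun p => (p.1 + ψ p.2, p.2)) (fun p => (p.1 - ψ p.2, p.2))
    ((contDiff_fst.add (sψ.comp contDiff_snd)).prodMk contDiff_snd)
    ((contDiff_fst.sub (sψ.comp contDiff_snd)).prodMk contDiff_snd)
    (fun p => by simp) (fun p => by simp)
  let Φ4 : Df (ℝ × Y) (ℝ × Y) := Df.mk' (fun p => (p.1, p.2 - y2 p.1)) (fun p => (p.1, p.2 + y2 p.1))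
    (contDiff_fst.prodMk (contDiff_snd.sub (sy2.comp contDiff_fst)))
    (contDiff_fst.prodMk (contDiff_snd.add (sy2.comp contDiff_fst)))
    (fun p => by simp) (fun p => by simp)
  refine ⟨((Φ1.trans Φ2).trans Φ3).trans Φ4, fun t => ?_⟩
  have e2 : Φ2 (z t, y1 t) = (z t, y2 t) := rfl
  have e3 : Φ3 (z t, y2 t) = (t, y2 t) := by simp [Φ3, hψ]
  have e4 : Φ4 (t, y2 t) = (t, 0) := by simp [Φ4]
  rw [Df.trans_apply, Df.trans_apply, Df.trans_apply, hΦ1, e2, e3, e4]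

end line
end CS


namespace CS
section germ
variable {Y : Type*} [NormedAddCommGroup Y] [NormedSpace ℝ Y] [FiniteDimensional ℝ Y]

theorem germ_T : ∃ γ > 0, ∀ R : ℝ × Y → ℝ × Y, ContDiff ℝ ∞ R → (∀ t, R (t, 0) = 0) →
    (∀ t, ‖fderiv ℝ R (t, 0)‖ ≤ γ) → ∃ ε : ℝ → ℝ, ContDiff ℝ ∞ ε ∧ (∀ t, 0 < ε t) ∧ (∀ t, ε t ≤ 1) ∧
      ∃ T : Df (ℝ × Y) (ℝ × Y), ∀ t y, ‖y‖ ≤ ε t → T (t, y) = (t, y) + R (t, y) := by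
  have : ProperSpace Y := FiniteDimensional.proper ℝ Y
  obtain ⟨χ, sχ, χ0, χ1, χone, χzero, -⟩ := exists_bump (0:Y) (a := 1) (b := 2) (by norm_num) (by norm_num)
  simp only [sub_zero] at χone χzero
  obtain ⟨C, hC⟩ : ∃ C, ∀ y ∈ Metric.closedBall (0:Y) 2, ‖fderiv ℝ χ y‖ ≤ C :=
    (isCompact_closedBall (0:Y) 2).exists_bound_of_continuousOn
      (sχ.continuous_fderiv (by simp)).continuousOn
  have hC0 : 0 ≤ C := (norm_nonneg _).trans (hC 0 (by simp))
  refine ⟨1 / (4 + 16 * C), by positivity, fun R sR R0 dR => ?_⟩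
  set γ := 1 / (4 + 16 * C) with hγ
  have hγ0 : 0 < γ := by positivity
  have hγC : 2 * γ + 8 * γ * C = 1/2 := by rw [hγ]; field_simp; ring
  have cdR : Continuous (fderiv ℝ R) := sR.continuous_fderiv (by simp)
  -- choose h
  obtain ⟨h, sh, hh⟩ := smooth_below (E := ℝ) (P := fun u a => a ≤ 1/2 ∧ ∀ t ∈ Icc (u-1) u, ∀ y : Y,
      ‖y‖ ≤ 2 * a → ‖fderiv ℝ R (t, y)‖ ≤ 2 * γ) (by
      rintro u a b ⟨h1, h2⟩ hb hba
      exact ⟨hba.trans h1, fun t ht y hy => h2 t ht y (hy.trans (by linarith))⟩) (by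
      intro u₀
      have hc : IsCompact ((Icc (u₀ - 2) (u₀ + 1)) ×ˢ ({0} : Set Y)) :=
        isCompact_Icc.prod isCompact_singleton
      have ho : IsOpen {p : ℝ × Y | ‖fderiv ℝ R p‖ < 2 * γ} :=
        isOpen_lt cdR.norm continuous_const
      obtain ⟨e, he, hsub⟩ := hc.exists_cthickening_subset_open ho (by
        rintro ⟨t, y⟩ ⟨-, hy⟩
        rw [mem_singleton_iff] at hy
        simp only at hy
        subst hy
        have := dR t
        simp only [mem_setOf_eq]; linarith)
      refine ⟨min (e/2) (1/2), by positivity, ?_⟩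
      filter_upwards [Metric.ball_mem_nhds u₀ one_pos] with u hu
      rw [Metric.mem_ball, Real.dist_eq, abs_lt] at hu
      refine ⟨min_le_right _ _, fun t ht y hy => ?_⟩
      have h1 : ‖y‖ ≤ e := by have := min_le_left (e/2) (1/2); linarith
      have : (t, y) ∈ {p : ℝ × Y | ‖fderiv ℝ R p‖ < 2 * γ} := by
        apply hsub
        apply Metric.mem_cthickening_of_dist_le (t, y) (t, 0)
        · exact ⟨⟨by linarith [ht.1], by linarith [ht.2]⟩, rfl⟩
        · simpa [Prod.dist_eq, he.le] using h1
      exact le_of_lt this)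
  let H : ℝ → ℝ := fun t => ∫ x in (0:ℝ)..t, h x
  have sH : ContDiff ℝ ∞ H := contDiff_antideriv sh 0
  have dH : ∀ t, HasDerivAt H (h t) t := hasDerivAt_antideriv sh 0
  let ε : ℝ → ℝ := fun t => H (t + 1) - H t
  have sε : ContDiff ℝ ∞ ε := (sH.comp (contDiff_id.add contDiff_const)).sub sH
  have dε : ∀ t, HasDerivAt ε (h (t+1) - h t) t := fun t =>
    ((dH (t+1)).comp_add_const t 1).sub (dH t)
  have εint : ∀ t, ε t = ∫ x in t..(t+1), h x := fun t =>
    intervalIntegral.integral_interval_sub_left (sh.continuous.intervalIntegrable _ _)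
      (sh.continuous.intervalIntegrable _ _)
  have εpos : ∀ t, 0 < ε t := fun t => by
    rw [εint]
    exact intervalIntegral.intervalIntegral_pos_of_pos_on (sh.continuous.intervalIntegrable _ _)
      (fun x _ => (hh x).1) (by linarith)
  have εu : ∀ t, ∃ u, t ∈ Icc (u - 1) u ∧ ε t ≤ h u := by
    intro t
    obtain ⟨u, hu, hmax⟩ := (isCompact_Icc (a := t) (b := t+1)).exists_isMaxOn
      (nonempty_Icc.2 (by linarith)) sh.continuous.continuousOn
    refine ⟨u, ⟨by linarith [hu.2], hu.1⟩, ?_⟩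
    rw [εint]
    have := intervalIntegral.integral_mono_on (a := t) (b := t+1) (by linarith)
      (sh.continuous.intervalIntegrable (μ := MeasureTheory.volume) _ _) (g := fun _ => h u) (by simp) (fun x hx => hmax hx)
    simpa using this
  have ε1 : ∀ t, ε t ≤ 1 := fun t => by
    obtain ⟨u, -, h2⟩ := εu t
    have := (hh u).2.1; linarith
  have εR : ∀ t y, ‖y‖ ≤ 2 * ε t → ‖fderiv ℝ R (t, y)‖ ≤ 2 * γ := by
    intro t y hy
    obtain ⟨u, h1, h2⟩ := εu t
    exact (hh u).2.2 t h1 y (hy.trans (by linarith))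
  have εd : ∀ t, |h (t+1) - h t| ≤ 1/2 := fun t => by
    rw [abs_le]
    have := hh t
    have := hh (t+1)
    constructor <;> linarith
  have Rb : ∀ t y, ‖y‖ ≤ 2 * ε t → ‖R (t, y)‖ ≤ 4 * γ * ε t := by
    intro t y hy
    have hconv : Convex ℝ ({t} ×ˢ Metric.closedBall (0:Y) (2 * ε t)) :=
      (convex_singleton t).prod (convex_closedBall _ _)
    have := hconv.norm_image_sub_le_of_norm_fderiv_le (𝕜 := ℝ) (f := R) (C := 2 * γ)
      (x := (t, 0)) (y := (t, y)) (fun x _ => (sR.differentiable (by simp)) x) (by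
        rintro ⟨t', y'⟩ ⟨h1, h2⟩
        rw [mem_singleton_iff] at h1
        simp only at h1
        subst h1
        exact εR _ y' (by simpa using h2)) ⟨rfl, by simp [(εpos t).le]⟩ ⟨rfl, by simpa using hy⟩
    rw [R0, sub_zero] at this
    refine this.trans ?_
    have h3 : ‖(t, y) - (t, 0)‖ = ‖y‖ := by simp [Prod.norm_def]
    rw [h3]
    nlinarith
  -- cutoff
  let k : ℝ × Y → Y := fun p => (ε p.1)⁻¹ • p.2
  have sk : ContDiff ℝ ∞ k := ((sε.comp contDiff_fst).inv (fun p => (εpos p.1).ne')).smul contDiff_snd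
  let w : ℝ × Y → ℝ × Y := fun p => χ (k p) • R p
  have sw : ContDiff ℝ ∞ w := (sχ.comp sk).smul sR
  have nk : ∀ t y, ‖k (t, y)‖ = ‖y‖ / ε t := fun t y => by
    simp only [k, norm_smul, norm_inv, Real.norm_of_nonneg (εpos t).le]; field_simp
  have kd : ∀ t y, ‖y‖ ≤ 2 * ε t → ‖fderiv ℝ k (t, y)‖ ≤ 2 / ε t := by
    intro t y hy
    have h1 : HasFDerivAt (fun p : ℝ × Y => (ε p.1)⁻¹)
        ((-(h (t+1) - h t) / ε t ^ 2) • ContinuousLinearMap.fst ℝ ℝ Y) (t, y) :=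
      HasDerivAt.comp_hasFDerivAt (h₂ := fun u : ℝ => (ε u)⁻¹) (f := Prod.fst) (t, y)
        ((dε t).inv (εpos t).ne') hasFDerivAt_fst
    have h2 := (h1.smul (hasFDerivAt_snd (𝕜 := ℝ) (p := (t, y))))
    have h2' : HasFDerivAt k _ (t, y) := h2
    rw [h2'.fderiv]
    apply ContinuousLinearMap.opNorm_le_bound _ (by have := εpos t; positivity)
    rintro ⟨a, b⟩
    simp only [ContinuousLinearMap.add_apply, ContinuousLinearMap.smul_apply,
      ContinuousLinearMap.smulRight_apply, ContinuousLinearMap.coe_fst', ContinuousLinearMap.coe_snd', smul_eq_mul]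
    have e0 := εpos t
    have hb : ‖b‖ ≤ ‖(a, b)‖ := norm_snd_le (a, b)
    have ha : |a| ≤ ‖(a, b)‖ := norm_fst_le (a, b)
    have t1 : ‖(ε t)⁻¹ • b‖ ≤ 1 / ε t * ‖(a, b)‖ := by
      rw [norm_smul, norm_inv, Real.norm_of_nonneg e0.le, one_div]; gcongr
    have t2 : ‖(-(h (t + 1) - h t) / ε t ^ 2 * a) • y‖ ≤ 1 / ε t * ‖(a, b)‖ := by
      rw [norm_smul, norm_mul, norm_div, norm_neg, norm_pow, Real.norm_of_nonneg e0.le,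
        Real.norm_eq_abs, Real.norm_eq_abs]
      calc |h (t+1) - h t| / ε t ^ 2 * |a| * ‖y‖ ≤ (1/2) / ε t ^ 2 * ‖(a, b)‖ * (2 * ε t) := by
            gcongr; exact εd t
        _ = 1 / ε t * ‖(a, b)‖ := by field_simp
    calc _ ≤ ‖(ε t)⁻¹ • b‖ + ‖(-(h (t + 1) - h t) / ε t ^ 2 * a) • y‖ := norm_add_le _ _
      _ ≤ 1 / ε t * ‖(a, b)‖ + 1 / ε t * ‖(a, b)‖ := add_le_add t1 t2
      _ = _ := by ring
  have wd : ∀ p, ‖fderiv ℝ w p‖ ≤ 1/2 := by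
    rintro ⟨t, y⟩
    by_cases hy : ‖y‖ ≤ 2 * ε t
    · have h1 : HasFDerivAt (fun p => χ (k p)) ((fderiv ℝ χ (k (t, y))).comp (fderiv ℝ k (t, y))) (t, y) :=
        ((sχ.differentiable (by simp)) _).hasFDerivAt.comp (t, y) ((sk.differentiable (by simp)) _).hasFDerivAt
      have h2 : HasFDerivAt w _ (t, y) := h1.smul ((sR.differentiable (by simp)) (t, y)).hasFDerivAt
      rw [h2.fderiv]
      have e0 := εpos t
      have hk2 : k (t, y) ∈ Metric.closedBall (0:Y) 2 := by
        rw [mem_closedBall_zero_iff, nk, div_le_iff₀ e0]; exact hy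
      have t1 : ‖χ (k (t, y)) • fderiv ℝ R (t, y)‖ ≤ 2 * γ := by
        rw [norm_smul, Real.norm_of_nonneg (χ0 _)]
        calc _ ≤ 1 * (2 * γ) := by gcongr; exact χ1 _; exact εR t y hy
          _ = _ := one_mul _
      have t2 : ‖((fderiv ℝ χ (k (t, y))).comp (fderiv ℝ k (t, y))).smulRight (R (t, y))‖ ≤ 8 * γ * C := by
        rw [ContinuousLinearMap.norm_smulRight_apply]
        calc _ ≤ (C * (2 / ε t)) * (4 * γ * ε t) := by
              gcongr
              · exact (ContinuousLinearMap.opNorm_comp_le _ _).trans (by gcongr; exact hC _ hk2; exact kd t y hy)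
              · exact Rb t y hy
          _ = _ := by field_simp; ring
      calc _ ≤ _ := norm_add_le _ _
        _ ≤ 2 * γ + 8 * γ * C := add_le_add t1 t2
        _ ≤ 1/2 := hγC.le
    · have : w =ᶠ[𝓝 (t, y)] fun _ => 0 := by
        have ho : IsOpen {p : ℝ × Y | 2 * ε p.1 < ‖p.2‖} :=
          isOpen_lt (continuous_const.mul (sε.continuous.comp continuous_fst)) continuous_snd.norm
        filter_upwards [ho.mem_nhds (not_le.1 hy)] with p hp
        have : χ (k p) = 0 := by
          apply χzero
          have := nk p.1 p.2
          rw [Prod.mk.eta] at this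
          rw [this, le_div_iff₀ (εpos _)]; exact le_of_lt hp
        simp [w, this]
      rw [this.fderiv_eq]
      simp
  obtain ⟨T, hT⟩ := id_add_Df sw wd
  refine ⟨ε, sε, εpos, ε1, T, fun t y hy => ?_⟩
  rw [hT]
  have : χ (k (t, y)) = 1 := χone _ (by rw [nk, div_le_one (εpos t)]; exact hy)
  simp [w, this]

theorem germ_normal {I : ℝ × Y → ℝ × Y} (sI : ContDiff ℝ ∞ I) (hI0 : ∀ t, I (t, 0) = (t, 0))
    (hd : ∀ t, Function.Injective (fderiv ℝ I (t, 0))) :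
    ∃ (Φ : Df (ℝ × Y) (ℝ × Y)) (η ε : ℝ → ℝ), ContDiff ℝ ∞ η ∧ ContDiff ℝ ∞ ε ∧ (∀ t, 0 < η t) ∧
      (∀ t, η t ≤ 1) ∧ (∀ t, 0 < ε t) ∧ (∀ t, ε t ≤ 1) ∧
      ∀ t y, ‖y‖ ≤ ε t → Φ (I (t, η t • y)) = (t, y) := by
  have : CompleteSpace Y := FiniteDimensional.complete ℝ Y
  obtain ⟨γ, hγ, hT⟩ := germ_T (Y := Y)
  have sdI : ContDiff ℝ ∞ (fun t : ℝ => fderiv ℝ I (t, 0)) :=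
    (contDiff_infty_iff_fderiv.1 sI).2.comp (contDiff_id.prodMk contDiff_const)
  let c : ℝ → Y →L[ℝ] ℝ := fun t => (ContinuousLinearMap.fst ℝ ℝ Y).comp
    ((fderiv ℝ I (t, 0)).comp (ContinuousLinearMap.inr ℝ ℝ Y))
  let B : ℝ → Y →L[ℝ] Y := fun t => (ContinuousLinearMap.snd ℝ ℝ Y).comp
    ((fderiv ℝ I (t, 0)).comp (ContinuousLinearMap.inr ℝ ℝ Y))
  have sc : ContDiff ℝ ∞ c := contDiff_const.clm_comp (sdI.clm_comp contDiff_const)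
  have sB : ContDiff ℝ ∞ B := contDiff_const.clm_comp (sdI.clm_comp contDiff_const)
  have dI10 : ∀ t, fderiv ℝ I (t, 0) (1, 0) = (1, 0) := by
    intro t
    have h1 : HasDerivAt (fun t : ℝ => I (t, (0:Y))) (fderiv ℝ I (t, 0) (1, 0)) t :=
      ((sI.differentiable (by simp)) (t, 0)).hasFDerivAt.comp_hasDerivAt t
        ((hasDerivAt_id t).prodMk (hasDerivAt_const t (0:Y)))
    have h2 : HasDerivAt (fun t : ℝ => I (t, (0:Y))) (1, 0) t := by
      simp only [hI0]
      exact (hasDerivAt_id t).prodMk (hasDerivAt_const t (0:Y))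
    exact h1.unique h2
  have dIab : ∀ t a b, fderiv ℝ I (t, 0) (a, b) = (a + c t b, B t b) := by
    intro t a b
    have : (a, b) = a • ((1:ℝ), (0:Y)) + (0, b) := by simp
    rw [this, map_add, map_smul, dI10]
    ext
    · simp [c]
    · simp [B]
  have Binj : ∀ t, Function.Injective (B t) := by
    intro t
    rw [injective_iff_map_eq_zero]
    intro y hy
    have h1 : fderiv ℝ I (t, 0) (-(c t y), y) = fderiv ℝ I (t, 0) 0 := by
      rw [dIab, hy, map_zero]; simp
    exact congrArg Prod.snd (hd t h1)
  choose Be hBe using fun t => exists_cle rfl (Binj t)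
  let Bi : ℝ → Y →L[ℝ] Y := fun t => (B t).inverse
  have Bi1 : ∀ t y, Bi t (B t y) = y := fun t y => by
    simp only [Bi]; rw [← hBe t]; simp
  have Bi2 : ∀ t y, B t (Bi t y) = y := fun t y => by
    simp only [Bi]; rw [← hBe t]; simp
  have sBi : ContDiff ℝ ∞ Bi := by
    rw [contDiff_iff_contDiffAt]
    intro t
    have h1 : ContDiffAt ℝ ∞ ContinuousLinearMap.inverse (B t) := by
      rw [← hBe t]; exact contDiffAt_map_inverse (Be t)
    exact h1.comp t sB.contDiffAt
  obtain ⟨η, sη, hη⟩ := smooth_below (E := ℝ) (P := fun t a => a ≤ 1 ∧ a * ‖c t‖ ≤ γ) (by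
      rintro t a b ⟨h1, h2⟩ hb hba
      exact ⟨hba.trans h1, le_trans (by gcongr) h2⟩) (by
      intro t
      have h0 := norm_nonneg (c t)
      refine ⟨min 1 (γ / (‖c t‖ + 1)), by positivity, ?_⟩
      have : ∀ᶠ u in 𝓝 t, ‖c u‖ < ‖c t‖ + 1 :=
        sc.continuous.norm.continuousAt.eventually (gt_mem_nhds (by linarith))
      filter_upwards [this] with u hu
      refine ⟨min_le_left _ _, ?_⟩
      calc min 1 (γ / (‖c t‖ + 1)) * ‖c u‖ ≤ γ / (‖c t‖ + 1) * (‖c t‖ + 1) := by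
            gcongr; exact min_le_right _ _
        _ = γ := by field_simp)
  have ηne : ∀ t, η t ≠ 0 := fun t => (hη t).1.ne'
  let A2 : Df (ℝ × Y) (ℝ × Y) := Df.mk' (fun p => (p.1, η p.1 • B p.1 p.2))
    (fun p => (p.1, (η p.1)⁻¹ • Bi p.1 p.2))
    (contDiff_fst.prodMk ((sη.comp contDiff_fst).smul ((sB.comp contDiff_fst).clm_apply contDiff_snd)))
    (contDiff_fst.prodMk (((sη.comp contDiff_fst).inv (fun p => ηne p.1)).smul
      ((sBi.comp contDiff_fst).clm_apply contDiff_snd)))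
    (fun p => by simp [Bi1, smul_smul, inv_mul_cancel₀ (ηne p.1)])
    (fun p => by simp [Bi2, smul_smul, mul_inv_cancel₀ (ηne p.1)])
  let q : ℝ × Y → ℝ × Y := fun p => (p.1, η p.1 • p.2)
  have sq : ContDiff ℝ ∞ q := contDiff_fst.prodMk ((sη.comp contDiff_fst).smul contDiff_snd)
  let I1 : ℝ × Y → ℝ × Y := fun p => A2.symm (I (q p))
  have sI1 : ContDiff ℝ ∞ I1 := A2.symm.smooth.comp (sI.comp sq)
  -- derivative along the line
  have dlin : ∀ (G : ℝ × Y → Y) (t : ℝ) (L : Y →L[ℝ] Y), ContDiff ℝ ∞ G → (∀ t, G (t, 0) = 0) →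
      (∀ y, G (t, y) = L y) → ∀ a b, fderiv ℝ G (t, 0) (a, b) = L b := by
    intro G t L sG G0 hGL a b
    have hG := ((sG.differentiable (by simp)) (t, 0)).hasFDerivAt
    have e1 : fderiv ℝ G (t, 0) (1, 0) = 0 := by
      have h1 : HasDerivAt (fun t : ℝ => G (t, (0:Y))) (fderiv ℝ G (t, 0) (1, 0)) t :=
        hG.comp_hasDerivAt t ((hasDerivAt_id t).prodMk (hasDerivAt_const t (0:Y)))
      have h2 : HasDerivAt (fun t : ℝ => G (t, (0:Y))) 0 t := by
        simp only [G0]; exact hasDerivAt_const t (0:Y)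
      exact h1.unique h2
    have e2 : (fderiv ℝ G (t, 0)).comp (ContinuousLinearMap.inr ℝ ℝ Y) = L := by
      have h1 : HasFDerivAt (fun y : Y => G (t, y)) ((fderiv ℝ G (t, 0)).comp (ContinuousLinearMap.inr ℝ ℝ Y)) 0 :=
        hG.comp (0:Y) (hasFDerivAt_prodMk_right t (0:Y))
      have h2 : HasFDerivAt (fun y : Y => G (t, y)) L 0 := by
        simp only [hGL]; exact L.hasFDerivAt
      exact h1.unique h2
    have : (a, b) = a • ((1:ℝ), (0:Y)) + (0, b) := by simp
    rw [this, map_add, map_smul, e1, smul_zero, zero_add, ← e2]; simp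
  have dI1 : ∀ t a b, fderiv ℝ I1 (t, 0) (a, b) = (a + η t * c t b, b) := by
    intro t a b
    have hq : HasFDerivAt q (fderiv ℝ q (t, 0)) (t, 0) := ((sq.differentiable (by simp)) _).hasFDerivAt
    have hq0 : q (t, 0) = (t, 0) := by simp [q]
    have hI' : HasFDerivAt I (fderiv ℝ I (t, 0)) (q (t, 0)) := by
      rw [hq0]; exact ((sI.differentiable (by simp)) _).hasFDerivAt
    have hIq0 : I (q (t, 0)) = (t, 0) := by rw [hq0, hI0]
    have hA : HasFDerivAt A2.symm (fderiv ℝ A2.symm (t, 0)) (I (q (t, 0))) := by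
      rw [hIq0]; exact ((A2.symm.smooth.differentiable (by simp)) _).hasFDerivAt
    have htot : HasFDerivAt I1 _ (t, 0) := hA.comp (t, 0) (hI'.comp (t, 0) hq)
    rw [htot.fderiv]
    simp only [ContinuousLinearMap.comp_apply]
    have d1 : ∀ a b, fderiv ℝ q (t, 0) (a, b) = (a, η t • b) := by
      intro a b
      let G : ℝ × Y → Y := fun p => η p.1 • p.2
      have sG : ContDiff ℝ ∞ G := (sη.comp contDiff_fst).smul contDiff_snd
      have hh : HasFDerivAt q ((ContinuousLinearMap.fst ℝ ℝ Y).prod (fderiv ℝ G (t, 0))) (t, 0) :=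
        hasFDerivAt_fst.prodMk ((sG.differentiable (by simp)) _).hasFDerivAt
      rw [hh.fderiv]
      have := dlin G t (η t • ContinuousLinearMap.id ℝ Y) sG (fun t => by simp [G]) (fun y => by simp [G]) a b
      simp [this]
    have d2 : ∀ a b, fderiv ℝ A2.symm (t, 0) (a, b) = (a, (η t)⁻¹ • Bi t b) := by
      intro a b
      let G : ℝ × Y → Y := fun p => (η p.1)⁻¹ • Bi p.1 p.2
      have sG : ContDiff ℝ ∞ G := ((sη.comp contDiff_fst).inv (fun p => ηne p.1)).smul
        ((sBi.comp contDiff_fst).clm_apply contDiff_snd)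
      have hh : HasFDerivAt A2.symm ((ContinuousLinearMap.fst ℝ ℝ Y).prod (fderiv ℝ G (t, 0))) (t, 0) :=
        hasFDerivAt_fst.prodMk ((sG.differentiable (by simp)) _).hasFDerivAt
      rw [hh.fderiv]
      have := dlin G t ((η t)⁻¹ • Bi t) sG (fun t => by simp [G]) (fun y => by simp [G]) a b
      simp [this]
    rw [d1, dIab, d2]
    ext
    · simp
    · simp [Bi1, smul_smul, inv_mul_cancel₀ (ηne t)]
  obtain ⟨ε, sε, ε0, ε1, T, hTT⟩ := hT (fun p => I1 p - p) (sI1.sub contDiff_id) (by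
      intro t
      have : I1 (t, 0) = (t, 0) := by
        simp only [I1]; rw [Df.symm_eq]; simp [q, hI0, A2]
      simp [this]) (by
      intro t
      have h1 : HasFDerivAt (fun p => I1 p - p) (fderiv ℝ I1 (t, 0) - ContinuousLinearMap.id ℝ _) (t, 0) :=
        ((sI1.differentiable (by simp)) _).hasFDerivAt.sub (hasFDerivAt_id _)
      rw [h1.fderiv]
      apply ContinuousLinearMap.opNorm_le_bound _ hγ.le
      rintro ⟨a, b⟩
      have h2 : (fderiv ℝ I1 (t, 0) - ContinuousLinearMap.id ℝ (ℝ × Y)) (a, b) = (η t * c t b, 0) := by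
        simp [dI1]
      rw [h2]
      have h3 : ‖(η t * c t b, (0:Y))‖ = η t * ‖c t b‖ := by
        simp [Prod.norm_def, abs_of_pos (hη t).1, (hη t).1.le]
        exact mul_nonneg (hη t).1.le (abs_nonneg _)
      rw [h3]
      calc η t * ‖c t b‖ ≤ η t * (‖c t‖ * ‖b‖) := by
            gcongr
            · exact (hη t).1.le
            · exact (c t).le_opNorm b
        _ = (η t * ‖c t‖) * ‖b‖ := by ring
        _ ≤ γ * ‖(a, b)‖ := by
            gcongr
            · exact (hη t).2.2
            · exact norm_snd_le (a, b))
  refine ⟨A2.symm.trans T.symm, η, ε, sη, sε, fun t => (hη t).1, fun t => (hη t).2.1, ε0, ε1, ?_⟩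
  intro t y hy
  rw [Df.trans_apply, Df.symm_eq, hTT t y hy]
  simp [I1, q]

end germ
end CS


namespace CS

/-- the model space -/
abbrev PP (W : Type*) := ℝ × (W × ℝ)

theorem Eng.of_image {E F : Type*} [NormedAddCommGroup E] [NormedSpace ℝ E] [NormedAddCommGroup F]
    [NormedSpace ℝ F] (Φ : Df E F) {V : Set E} (h : Eng (Φ '' V)) : Eng V := by
  intro O hO hVO K hK
  have hc : (Φ '' V)ᶜ = Φ '' Vᶜ := (image_compl_eq ⟨Φ.injective, Φ.surjective⟩).symm
  obtain ⟨g, N, hN, hVN, hgN, hgK⟩ := h (Φ '' O) (Φ.image_open hO)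
    (by rw [hc]; exact image_mono hVO) (Φ '' K) (Φ.image_compact hK)
  refine ⟨(Φ.trans g).trans Φ.symm, Φ ⁻¹' N, hN.preimage Φ.continuous, ?_, ?_, ?_⟩
  · intro y hy
    apply hVN; rw [hc]; exact ⟨y, hy, rfl⟩
  · intro y hy
    simp [hgN _ hy]
  · rintro _ ⟨x, hx, rfl⟩
    obtain ⟨o, ho, hoe⟩ := hgK ⟨Φ x, ⟨x, hx, rfl⟩, rfl⟩
    simp only [Df.trans_apply]
    rw [← hoe]; simpa using ho

section
variable {W : Type*} [NormedAddCommGroup W] [InnerProductSpace ℝ W] [FiniteDimensional ℝ W]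

/-- tube data on the model -/
structure PT (I : PP W → PP W) : Prop where
  smooth : ContDiff ℝ ∞ I
  inj : Function.Injective I
  dinj : ∀ p, Function.Injective (fderiv ℝ I p)
  slab : ∀ R, ∃ R', ∀ p : PP W, |p.2.2| ≤ 1 → ‖I p‖ ≤ R → ‖p‖ ≤ R'

/-- side data on the model -/
structure PS (I : PP W → PP W) (V : Set (PP W)) : Prop where
  isOpen : IsOpen V
  mem_iff : ∀ p, I p ∈ V ↔ 0 < p.2.2
  closure_sub : closure V ⊆ V ∪ I '' {p | p.2.2 = 0}

/-- normal form -/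
structure NF (I : PP W → PP W) : Prop where
  lt : ∀ t w s, t < 1 → I (t, w, s) = (t, w, s)
  core : ∀ t w s, ‖w‖ < 3 → |s| < 3 → I (t, w, s) = (t, w, s)

theorem PT.comp {I : PP W → PP W} (h : PT I) (Φ q : Df (PP W) (PP W))
    (hq : ∀ p, |p.2.2| ≤ 1 → |(q p).2.2| ≤ 1) : PT (fun p => Φ (I (q p))) := by
  refine ⟨Φ.smooth.comp (h.smooth.comp q.smooth), Φ.injective.comp (h.inj.comp q.injective), ?_, ?_⟩
  · intro p
    have h1 : HasFDerivAt (fun p => Φ (I (q p))) _ p :=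
      (((Φ.smooth.differentiable (by simp)) (I (q p))).hasFDerivAt).comp p
      ((((h.smooth.differentiable (by simp)) (q p)).hasFDerivAt).comp p
        ((q.smooth.differentiable (by simp)) p).hasFDerivAt)
    rw [h1.fderiv]
    simp only [ContinuousLinearMap.coe_comp]
    exact (Φ.fderiv_injective _).comp ((h.dinj _).comp (q.fderiv_injective _))
  · intro R
    obtain ⟨R1, h1⟩ := Φ.exists_bound R
    obtain ⟨R2, h2⟩ := h.slab R1
    obtain ⟨R3, h3⟩ := q.exists_bound R2
    exact ⟨R3, fun p hp hI => h3 _ (h2 _ (hq _ hp) (h1 _ hI))⟩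

theorem PS.comp {I : PP W → PP W} {V : Set (PP W)} (h : PS I V) (Φ q : Df (PP W) (PP W))
    (hq : ∀ p, 0 < (q p).2.2 ↔ 0 < p.2.2) (hq' : ∀ p, p.2.2 = 0 → (q.symm p).2.2 = 0) :
    PS (fun p => Φ (I (q p))) (Φ '' V) := by
  refine ⟨Φ.image_open h.isOpen, ?_, ?_⟩
  · intro p
    rw [Φ.injective.mem_set_image, h.mem_iff, hq]
  · have : closure (Φ '' V) = Φ '' closure V := (Φ.toHomeo.image_closure V).symm
    rw [this]
    rintro _ ⟨x, hx, rfl⟩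
    rcases h.closure_sub hx with hx | ⟨p, hp, rfl⟩
    · left; exact ⟨x, hx, rfl⟩
    · right; exact ⟨q.symm p, hq' _ hp, by simp⟩

theorem exists_NF (hW : 4 ≤ Module.finrank ℝ (W × ℝ)) {I : PP W → PP W} {V : Set (PP W)} (h : PT I) (hV : PS I V) :
    ∃ (Φ : Df (PP W) (PP W)) (J : PP W → PP W), PT J ∧ PS J (Φ '' V) ∧ NF J := by
  -- straighten
  have hl : ContDiff ℝ ∞ (fun t : ℝ => ((t, 0) : PP W)) := contDiff_id.prodMk contDiff_const
  obtain ⟨Φ1, h1⟩ := line_straighten hW (z := fun t => (I (t, 0)).1) (y := fun t => (I (t, 0)).2)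
    (contDiff_fst.comp (h.smooth.comp hl)) (contDiff_snd.comp (h.smooth.comp hl))
    (fun t u e1 e2 => by
      have := h.inj (Prod.ext e1 e2)
      exact congrArg Prod.fst this)
    (fun t => by
      by_contra hc
      push Not at hc
      have hI := (h.smooth.differentiable (by simp) (t, 0)).hasFDerivAt
      have hd : HasDerivAt (fun t : ℝ => I (t, 0)) (fderiv ℝ I (t, 0) (1, 0)) t :=
        hI.comp_hasDerivAt t ((hasDerivAt_id t).prodMk (hasDerivAt_const t (0 : W × ℝ)))
      have e1 : deriv (fun t => (I (t, 0)).1) t = (fderiv ℝ I (t, 0) (1, 0)).1 := 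
        ((ContinuousLinearMap.fst ℝ ℝ (W × ℝ)).hasFDerivAt.comp_hasDerivAt t hd).deriv
      have e2 : deriv (fun t => (I (t, 0)).2) t = (fderiv ℝ I (t, 0) (1, 0)).2 := 
        ((ContinuousLinearMap.snd ℝ ℝ (W × ℝ)).hasFDerivAt.comp_hasDerivAt t hd).deriv
      rw [e1, e2] at hc
      have h0 : fderiv ℝ I (t, 0) (1, 0) = 0 := Prod.ext hc.1 hc.2
      have := h.dinj (t, 0) (h0.trans (map_zero _).symm)
      simpa using congrArg Prod.fst this)
    (fun R => by
      obtain ⟨R', hR'⟩ := h.slab R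
      refine ⟨R', fun t a b => ?_⟩
      have := hR' (t, 0) (by simp) (by rw [Prod.norm_def]; exact max_le a b)
      exact (norm_fst_le _).trans this)
  have P1 : PT (fun p => Φ1 (I (Df.refl _ p))) := h.comp Φ1 (Df.refl _) (fun p hp => hp)
  obtain ⟨Φ2, η, ε, sη, sε, η0, η1, ε0, ε1, h2⟩ := germ_normal (I := fun p => Φ1 (I p)) P1.smooth
    (fun t => h1 t) (fun t => P1.dinj _)
  have sN : ContDiff ℝ ∞ (fun y : W × ℝ => ‖y.1‖ ^ 2 + y.2 ^ 2) :=
    (contDiff_fst.norm_sq ℝ).add (contDiff_snd.pow 2)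
  have sκ : ContDiff ℝ ∞ (fun t : ℝ => ε t / (3 + t ^ 2)) :=
    sε.div (contDiff_const.add (contDiff_id.pow 2)) (fun t => by positivity)
  obtain ⟨N, hN⟩ : ∃ N : W × ℝ → ℝ, N = (fun y : W × ℝ => ‖y.1‖ ^ 2 + y.2 ^ 2) := ⟨_, rfl⟩
  obtain ⟨κ, hκ⟩ : ∃ κ : ℝ → ℝ, κ = (fun t : ℝ => ε t / (3 + t ^ 2)) := ⟨_, rfl⟩
  rw [← hN] at sN
  rw [← hκ] at sκ
  have κ0 : ∀ t, 0 < κ t := fun t => by rw [hκ]; have := ε0 t; positivity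
  have κ1 : ∀ t, κ t ≤ 1 := fun t => by
    rw [hκ]; simp only; rw [div_le_one (by positivity)]; nlinarith [ε1 t, sq_nonneg t]
  let ei : Df (PP W) (PP W) := Df.mk' (fun p => (p.1 - N p.2, κ (p.1 - N p.2) • p.2))
    (fun p => (p.1 + N ((κ p.1)⁻¹ • p.2), (κ p.1)⁻¹ • p.2))
    ((contDiff_fst.sub (sN.comp contDiff_snd)).prodMk
      ((sκ.comp (contDiff_fst.sub (sN.comp contDiff_snd))).smul contDiff_snd))
    (by
      have hh : ContDiff ℝ ∞ (fun p : PP W => (κ p.1)⁻¹ • p.2) :=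
        ((sκ.comp contDiff_fst).inv (fun p => (κ0 p.1).ne')).smul contDiff_snd
      exact (contDiff_fst.add (sN.comp hh)).prodMk hh)
    (fun p => by
      have := (κ0 (p.1 - N p.2)).ne'
      simp [smul_smul, inv_mul_cancel₀ this])
    (fun p => by
      have := (κ0 p.1).ne'
      simp [smul_smul, mul_inv_cancel₀ this])
  let q : Df (PP W) (PP W) := Df.mk' (fun p => (p.1, η p.1 • p.2)) (fun p => (p.1, (η p.1)⁻¹ • p.2))
    (contDiff_fst.prodMk ((sη.comp contDiff_fst).smul contDiff_snd))
    (contDiff_fst.prodMk (((sη.comp contDiff_fst).inv (fun p => (η0 p.1).ne')).smul contDiff_snd))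
    (fun p => by simp [smul_smul, inv_mul_cancel₀ (η0 p.1).ne'])
    (fun p => by simp [smul_smul, mul_inv_cancel₀ (η0 p.1).ne'])
  have key : ∀ t y, ‖y‖ ≤ 3 + (t - N y) ^ 2 → ei.symm (Φ2 (Φ1 (I (q (ei (t, y)))))) = (t, y) := by
    intro t y hy
    rw [Df.symm_eq]
    have : Φ2 (Φ1 (I (q (ei (t, y))))) = (t - N y, κ (t - N y) • y) := by
      apply h2
      change ‖κ (t - N y) • y‖ ≤ ε (t - N y)
      rw [norm_smul, Real.norm_of_nonneg (κ0 _).le, hκ]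
      simp only
      rw [div_mul_eq_mul_div, div_le_iff₀ (by positivity)]
      exact mul_le_mul_of_nonneg_left hy (ε0 _).le
    rw [this]; rfl
  refine ⟨(Φ1.trans Φ2).trans ei.symm,
    fun p => ((Φ1.trans Φ2).trans ei.symm) (I ((ei.trans q) p)), ?_, ?_, ?_, ?_⟩
  · apply h.comp
    intro p hp
    have : ((ei.trans q) p).2.2 = η (p.1 - N p.2) * (κ (p.1 - N p.2) * p.2.2) := rfl
    rw [this, abs_mul, abs_mul, abs_of_pos (η0 _), abs_of_pos (κ0 _)]
    exact mul_le_one₀ (η1 _) (by have := κ0 (p.1 - N p.2); positivity)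
      (mul_le_one₀ (κ1 _) (abs_nonneg _) hp)
  · apply hV.comp
    · intro p
      have : ((ei.trans q) p).2.2 = η (p.1 - N p.2) * (κ (p.1 - N p.2) * p.2.2) := rfl
      rw [this, mul_pos_iff_of_pos_left (η0 _), mul_pos_iff_of_pos_left (κ0 _)]
    · rintro ⟨t, w, s⟩ hp
      have : ((ei.trans q).symm (t, w, s)).2.2 = (κ t)⁻¹ * ((η t)⁻¹ * s) := rfl
      simp only at hp
      rw [this, hp]; simp
  · intro t w s ht
    apply key
    have hn : ‖((w, s) : W × ℝ)‖ ^ 2 ≤ N (w, s) := by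
      rw [hN, Prod.norm_def]
      simp only
      rcases max_cases ‖w‖ ‖s‖ with ⟨h, -⟩ | ⟨h, -⟩ <;> rw [h]
      · nlinarith [sq_nonneg s]
      · rw [Real.norm_eq_abs, sq_abs]; nlinarith [sq_nonneg ‖w‖]
    set n := ‖((w, s) : W × ℝ)‖
    set u := N (w, s)
    apply abs_le_of_sq_le_sq' _ (by positivity) |>.2
    nlinarith [sq_nonneg (t - u), sq_nonneg (t - u + 1), sq_nonneg ((t-u)^2)]
  · intro t w s hw hs
    apply key
    have : ‖((w, s) : W × ℝ)‖ ≤ 3 := by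
      rw [Prod.norm_def]; exact max_le hw.le hs.le
    nlinarith [sq_nonneg (t - N (w, s))]

end
end CS


namespace CS
section polar
variable {W : Type*} [NormedAddCommGroup W] [InnerProductSpace ℝ W] [FiniteDimensional ℝ W]

/-- polar coordinates around the positive half plane -/
noncomputable def pol (x : (ℝ × W) × ℝ) : PP W :=
  (Real.exp x.1.1 * Real.cos x.2, x.1.2, Real.exp x.1.1 * Real.sin x.2)

/-- minus the complex coordinate -/
noncomputable def zc (p : PP W) : ℂ := Complex.equivRealProdCLM.symm (-p.1, -p.2.2)

noncomputable def plog (p : PP W) : (ℝ × W) × ℝ :=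
  (((Complex.log (zc p)).re, p.2.1), (Complex.log (zc p)).im + Real.pi)

theorem zc_re (p : PP W) : (zc p).re = -p.1 := by simp [zc, Complex.equivRealProdCLM_symm_apply]
theorem zc_im (p : PP W) : (zc p).im = -p.2.2 := by simp [zc, Complex.equivRealProdCLM_symm_apply]

theorem contDiff_zc : ContDiff ℝ ∞ (zc : PP W → ℂ) :=
  Complex.equivRealProdCLM.symm.contDiff.comp
    (contDiff_fst.neg.prodMk (contDiff_snd.comp contDiff_snd).neg)

theorem contDiff_pol : ContDiff ℝ ∞ (pol : (ℝ × W) × ℝ → PP W) := by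
  have h1 : ContDiff ℝ ∞ (fun x : (ℝ × W) × ℝ => x.1.1) := contDiff_fst.comp contDiff_fst
  have h2 : ContDiff ℝ ∞ (fun x : (ℝ × W) × ℝ => x.1.2) := contDiff_snd.comp contDiff_fst
  have h3 : ContDiff ℝ ∞ (fun x : (ℝ × W) × ℝ => x.2) := contDiff_snd
  exact (h1.exp.mul h3.cos).prodMk (h2.prodMk (h1.exp.mul h3.sin))

theorem zc_pol (x : (ℝ × W) × ℝ) : zc (pol x) = Complex.exp (⟨x.1.1, x.2 - Real.pi⟩ : ℂ) := by
  apply Complex.ext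
  · rw [zc_re, Complex.exp_re]; simp [pol, Real.cos_sub_pi]
  · rw [zc_im, Complex.exp_im]; simp [pol, Real.sin_sub_pi]

theorem plog_pol {x : (ℝ × W) × ℝ} (h0 : 0 < x.2) (h1 : x.2 < 2 * Real.pi) : plog (pol x) = x := by
  have : Complex.log (zc (pol x)) = ⟨x.1.1, x.2 - Real.pi⟩ := by
    rw [zc_pol, Complex.log_exp]
    · simp only; linarith
    · simp only; linarith
  rw [plog, this]
  simp [pol]

theorem pol_plog {p : PP W} (h : p.1 ≠ 0 ∨ p.2.2 ≠ 0) : pol (plog p) = p := by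
  have hz : zc p ≠ 0 := by
    intro h0
    have h1 := zc_re p
    have h2 := zc_im p
    rw [h0] at h1 h2
    simp at h1 h2
    rcases h with h | h
    · exact h h1
    · exact h h2
  have he : Complex.exp (Complex.log (zc p)) = zc p := Complex.exp_log hz
  have e1 := congrArg Complex.re he
  have e2 := congrArg Complex.im he
  rw [Complex.exp_re, zc_re] at e1
  rw [Complex.exp_im, zc_im] at e2
  have : pol (plog p) = (-(Real.exp (Complex.log (zc p)).re * Real.cos (Complex.log (zc p)).im), p.2.1,
    -(Real.exp (Complex.log (zc p)).re * Real.sin (Complex.log (zc p)).im)) := by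
    simp [pol, plog, Real.cos_add_pi, Real.sin_add_pi]
  rw [this, e1, e2]
  simp

theorem zc_slit {p : PP W} (h : p.1 < 0 ∨ p.2.2 ≠ 0) : zc p ∈ Complex.slitPlane := by
  rw [Complex.mem_slitPlane_iff, zc_re, zc_im]
  rcases h with h | h
  · left; linarith
  · right; simpa using h

theorem contDiffAt_plog {p : PP W} (h : p.1 < 0 ∨ p.2.2 ≠ 0) : ContDiffAt ℝ ∞ plog p := by
  have h1 : ContDiffAt ℝ ∞ (fun p : PP W => Complex.log (zc p)) p :=
    ContDiffAt.comp p ((Complex.contDiffAt_log (zc_slit h)).restrict_scalars ℝ) contDiff_zc.contDiffAt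
  have h2 : ContDiffAt ℝ ∞ (fun p : PP W => (Complex.log (zc p)).re) p :=
    Complex.reCLM.contDiff.contDiffAt.comp p h1
  have h3 : ContDiffAt ℝ ∞ (fun p : PP W => (Complex.log (zc p)).im) p :=
    Complex.imCLM.contDiff.contDiffAt.comp p h1
  exact (h2.prodMk (contDiff_fst.comp contDiff_snd).contDiffAt).prodMk (h3.add contDiffAt_const)

theorem plog_pos (p : PP W) : 0 < (plog p).2 := by
  simp only [plog, Complex.log_im]
  linarith [Complex.neg_pi_lt_arg (zc p)]

theorem plog_lt {p : PP W} (h : p.1 < 0 ∨ p.2.2 ≠ 0) : (plog p).2 < 2 * Real.pi := by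
  simp only [plog, Complex.log_im]
  have h1 := Complex.arg_le_pi (zc p)
  have h2 := (Complex.mem_slitPlane_iff_arg.1 (zc_slit h)).1
  have := lt_of_le_of_ne h1 h2
  linarith

theorem plog_of_pos {p : PP W} (h : 0 < p.2.2) :
    (plog p).2 = Complex.arg (Complex.equivRealProdCLM.symm (p.1, p.2.2)) := by
  simp only [plog, Complex.log_im]
  have : zc p = - Complex.equivRealProdCLM.symm (p.1, p.2.2) := by
    rw [zc, ← map_neg]; rfl
  rw [this, Complex.arg_neg_eq_arg_sub_pi_of_im_pos]
  · ring
  · simpa [Complex.equivRealProdCLM_symm_apply] using h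

theorem plog_of_neg {p : PP W} (h : p.1 < 0) (h2 : p.2.2 = 0) : (plog p).2 = Real.pi := by
  simp only [plog, Complex.log_im]
  have : zc p = ((-p.1 : ℝ) : ℂ) := by
    apply Complex.ext
    · rw [zc_re]; simp
    · rw [zc_im]; simp [h2]
  rw [this, Complex.arg_ofReal_of_nonneg (by linarith)]; simp

theorem pol_quad {x : (ℝ × W) × ℝ} (h0 : 0 < x.2) (h1 : x.2 < Real.pi / 2) :
    0 < (pol x).1 ∧ 0 < (pol x).2.2 := by
  constructor
  · exact mul_pos (Real.exp_pos _) (Real.cos_pos_of_mem_Ioo ⟨by linarith, h1⟩)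
  · exact mul_pos (Real.exp_pos _) (Real.sin_pos_of_pos_of_lt_pi h0 (by linarith [Real.pi_pos]))

theorem pol_off {x : (ℝ × W) × ℝ} (h0 : 0 < x.2) (h1 : x.2 < 2 * Real.pi) :
    (pol x).1 < 0 ∨ (pol x).2.2 ≠ 0 := by
  have h : zc (pol x) ∈ Complex.slitPlane := by
    rw [Complex.mem_slitPlane_iff_arg]
    constructor
    · have := plog_pol h0 h1
      have h2 := congrArg Prod.snd this
      simp only [plog, Complex.log_im] at h2
      intro h3; rw [h3] at h2; linarith
    · rw [zc_pol]; exact Complex.exp_ne_zero _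
  rw [Complex.mem_slitPlane_iff, zc_re, zc_im] at h
  rcases h with h | h
  · left; linarith
  · right; simpa using h

theorem pol_oEmb : OEmb (pol : (ℝ × W) × ℝ → PP W) {x | 0 < x.2 ∧ x.2 < 2 * Real.pi} := by
  have ho : IsOpen {x : (ℝ × W) × ℝ | 0 < x.2 ∧ x.2 < 2 * Real.pi} :=
    (isOpen_lt continuous_const continuous_snd).inter (isOpen_lt continuous_snd continuous_const)
  refine ⟨ho, fun x _ => contDiff_pol.contDiffAt, ?_, ?_⟩
  · intro x hx y hy hxy
    rw [← plog_pol hx.1 hx.2, ← plog_pol hy.1 hy.2, hxy]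
  · intro x hx
    apply fderiv_injective_of_leftInv (g := plog) (contDiff_pol.contDiffAt.differentiableAt (by simp))
      ((contDiffAt_plog (pol_off hx.1 hx.2)).differentiableAt (by simp))
    filter_upwards [ho.mem_nhds hx] with y hy
    exact plog_pol hy.1 hy.2

theorem finrank_polar : Module.finrank ℝ ((ℝ × W) × ℝ) = Module.finrank ℝ (PP W) := by
  simp [PP]; ring

theorem exists_sq {Kh T : Set (PP W)} (hK : IsCompact Kh) (hT : IsOpen T)
    (hPT : ∀ p : PP W, 0 ≤ p.1 → p.2.2 = 0 → p ∈ T) (h1 : ∀ p ∈ Kh, p ∈ T → 0 ≤ p.2.2)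
    (h2 : ∀ p ∈ Kh, p.1 ≠ 0 ∨ p.2.2 ≠ 0) :
    ∃ (g : Df (PP W) (PP W)) (C : Set (PP W)), IsCompact C ∧ (∀ p ∈ C, p.1 < 0 ∨ p.2.2 ≠ 0) ∧
      (∀ p, p ∉ C → g p = p) ∧
      ∀ p ∈ Kh, (p.1 < 0 ∨ p.2.2 ≠ 0) → g p ∈ T ∧ 0 < (g p).1 ∧ 0 < (g p).2.2 := by
  have hπ := Real.pi_pos
  -- the radial projection
  have hQ : IsCompact ((fun p => (plog p).1) '' Kh) := by
    apply hK.image_of_continuousOn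
    have e : (fun p : PP W => (plog p).1) = fun p => (Real.log ‖zc p‖, p.2.1) := by
      funext p; simp [plog, Complex.log_re]
    rw [e]
    apply ContinuousOn.prodMk
    · apply ContinuousOn.log
      · exact contDiff_zc.continuous.norm.continuousOn
      · intro p hp
        rw [norm_ne_zero_iff]
        intro h0
        have a1 := zc_re p
        have a2 := zc_im p
        rw [h0] at a1 a2
        simp at a1 a2
        rcases h2 p hp with h | h
        · exact h a1
        · exact h a2
    · exact (continuous_fst.comp continuous_snd).continuousOn
  -- angle bound
  obtain ⟨Y, hYπ, hY2, hY⟩ : ∃ Y, Real.pi ≤ Y ∧ Y < 2 * Real.pi ∧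
      ∀ p ∈ Kh, (p.1 < 0 ∨ p.2.2 ≠ 0) → (plog p).2 ≤ Y := by
    have hB : IsCompact (Kh ∩ Tᶜ ∩ {p | p.2.2 ≤ 0}) :=
      (hK.inter_right hT.isClosed_compl).inter_right
        (isClosed_le (continuous_snd.comp continuous_snd) continuous_const)
    have hoff : ∀ p ∈ Kh ∩ Tᶜ ∩ {p | p.2.2 ≤ 0}, p.1 < 0 ∨ p.2.2 ≠ 0 := by
      rintro p ⟨⟨-, hp⟩, -⟩
      by_contra hc
      push Not at hc
      exact hp (hPT p hc.1 hc.2)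
    have hco : ContinuousOn (fun p : PP W => (plog p).2) (Kh ∩ Tᶜ ∩ {p | p.2.2 ≤ 0}) := fun p hp =>
      (continuous_snd.continuousAt.comp (contDiffAt_plog (hoff p hp)).continuousAt).continuousWithinAt
    obtain ⟨Y0, hY0, hY0'⟩ : ∃ Y0, Y0 < 2 * Real.pi ∧ ∀ p ∈ Kh ∩ Tᶜ ∩ {p | p.2.2 ≤ 0}, (plog p).2 ≤ Y0 := by
      rcases (Kh ∩ Tᶜ ∩ {p | p.2.2 ≤ 0}).eq_empty_or_nonempty with he | hne
      · exact ⟨0, by linarith, fun p hp => by rw [he] at hp; exact hp.elim⟩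
      · obtain ⟨p0, hp0, hm⟩ := hB.exists_isMaxOn hne hco
        exact ⟨(plog p0).2, plog_lt (hoff p0 hp0), fun p hp => hm hp⟩
    refine ⟨max Real.pi Y0, le_max_left _ _, max_lt (by linarith) hY0, ?_⟩
    intro p hp hpo
    by_cases hs : 0 < p.2.2
    · apply le_max_of_le_left
      rw [plog_of_pos hs]; exact Complex.arg_le_pi _
    · push Not at hs
      by_cases hpT : p ∈ T
      · apply le_max_of_le_left
        have h0 : p.2.2 = 0 := le_antisymm hs (h1 p hp hpT)
        rcases hpo with h | h
        · rw [plog_of_neg h h0]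
        · exact absurd h0 h
      · exact le_max_of_le_right (hY0' p ⟨⟨hp, hpT⟩, hs⟩)
  -- tube lemma
  obtain ⟨u, v, hu, hv, hQu, h0v, huv⟩ := generalized_tube_lemma hQ (isCompact_singleton (x := (0:ℝ)))
    (hT.preimage (contDiff_pol (W := W)).continuous) (by
      rintro ⟨⟨a, w⟩, b⟩ ⟨-, hb⟩
      rw [mem_singleton_iff] at hb
      simp only at hb
      subst hb
      apply hPT
      · simp [pol, Real.exp_nonneg]
      · simp [pol])
  obtain ⟨δ0, hδ0, hδv⟩ := Metric.isOpen_iff.1 hv 0 (h0v rfl)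
  obtain ⟨δ, hδ, hδ1, hδ2⟩ : ∃ δ > 0, 2 * δ ≤ δ0 ∧ 2 * δ ≤ Real.pi / 2 := by
    refine ⟨min δ0 (Real.pi / 2) / 2, by positivity, ?_, ?_⟩
    · have := min_le_left δ0 (Real.pi / 2); linarith
    · have := min_le_right δ0 (Real.pi / 2); linarith
  obtain ⟨φ, sφ, dφ, φ1, φ2, φ3⟩ := squeeze1D hδ (Y := Y) (Y₂ := (Y + 2 * Real.pi) / 2) (by linarith) (by linarith)
  have φmono := strictMono_of_deriv_pos dφ
  have φ0 : φ 0 = 0 := φ1 0 (by linarith)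
  obtain ⟨R, hR⟩ := hQ.isBounded.exists_norm_le
  obtain ⟨c, sc, c0, c1, co, cz, -⟩ := exists_bump (0 : ℝ × W) (a := |R| + 1) (b := |R| + 2) (by positivity) (by linarith)
  let ψ : (ℝ × W) × ℝ → ℝ := fun x => (1 - c x.1) * x.2 + c x.1 * φ x.2
  have sψ : ContDiff ℝ ∞ ψ := ((contDiff_const.sub (sc.comp contDiff_fst)).mul contDiff_snd).add
    ((sc.comp contDiff_fst).mul (sφ.comp contDiff_snd))
  obtain ⟨A, hA⟩ := fiberwise_Df sψ (fun x s => by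
      have hd : HasDerivAt (fun s => ψ (x, s)) ((1 - c x) * 1 + c x * deriv φ s) s :=
        ((hasDerivAt_id s).const_mul (1 - c x)).add
          (((sφ.differentiable (by simp)) s).hasDerivAt.const_mul (c x))
      rw [hd.deriv]
      rcases (c0 x).eq_or_lt with h | h
      · rw [← h]; norm_num
      · have := mul_pos h (dφ s)
        have := c1 x
        linarith) (fun x => by
      apply surjective_of_id_off (R := 2 * Real.pi)
      · exact sψ.continuous.comp (Continuous.prodMk continuous_const continuous_id)
      · intro s hs
        simp only [ψ]; rw [φ2 s (by linarith)]; ring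
      · intro s hs
        simp only [ψ]; rw [φ1 s (by linarith)]; ring)
  let Z : Set ((ℝ × W) × ℝ) := Metric.closedBall 0 (|R| + 2) ×ˢ Icc (δ / 2) ((Y + 2 * Real.pi) / 2)
  have hZ : IsCompact Z := (isCompact_closedBall _ _).prod isCompact_Icc
  have hZU : Z ⊆ {x : (ℝ × W) × ℝ | 0 < x.2 ∧ x.2 < 2 * Real.pi} := by
    rintro ⟨x, b⟩ ⟨-, hb⟩
    exact ⟨by have := hb.1; simp only at *; linarith, by have := hb.2; simp only at *; linarith⟩
  have hCc : IsCompact (pol '' Z) := hZ.image contDiff_pol.continuous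
  obtain ⟨g, hg1, hg2⟩ := transport finrank_polar pol_oEmb A hZU hCc.isClosed (by
    rintro ⟨x, b⟩ hx
    rw [hA]
    simp only [ψ, Prod.mk.injEq, true_and]
    by_cases hxn : ‖x‖ ≤ |R| + 2
    · have hb : ¬ (δ / 2 ≤ b ∧ b ≤ (Y + 2 * Real.pi) / 2) := fun hb => hx ⟨by simpa using hxn, hb⟩
      by_cases hb1 : δ / 2 ≤ b
      · have : φ b = b := φ2 b (by by_contra h; push Not at h; exact hb ⟨hb1, h.le⟩)
        rw [this]; ring
      · rw [φ1 b (by linarith)]; ring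
    · rw [cz x (by rw [sub_zero]; linarith)]; ring)
  refine ⟨g, pol '' Z, hCc, ?_, hg2, ?_⟩
  · rintro _ ⟨x, hx, rfl⟩
    exact pol_off (hZU hx).1 (hZU hx).2
  · intro p hp hpo
    have hpp : pol (plog p) = p := pol_plog (h2 p hp)
    have hgp : g p = pol ((plog p).1, φ (plog p).2) := by
      have := hg1 (plog p) ⟨plog_pos p, plog_lt hpo⟩
      rw [hpp, hA] at this
      rw [this]
      have hc1 : c (plog p).1 = 1 := co _ (by
        rw [sub_zero]
        have := hR _ ⟨p, hp, rfl⟩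
        have := le_abs_self R
        simp only at *
        linarith)
      simp only [ψ, hc1]
      congr 2
      ring
    have hφp : 0 < φ (plog p).2 := by rw [← φ0]; exact φmono (plog_pos p)
    have hφl : φ (plog p).2 < 2 * δ := φ3 _ (hY p hp hpo)
    rw [hgp]
    refine ⟨?_, pol_quad hφp (by simp only; linarith)⟩
    apply huv
    refine ⟨hQu ⟨p, hp, rfl⟩, hδv ?_⟩
    simp only [Metric.mem_ball, dist_zero_right, Real.norm_eq_abs, abs_of_pos hφp]
    linarith

end polar
end CS


namespace CS
section psi
variable {W : Type*} [NormedAddCommGroup W] [InnerProductSpace ℝ W] [FiniteDimensional ℝ W]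

/-- straightening of the right half of the hypersurface -/
theorem exists_Psi {I : PP W → PP W} (h : PT I) (hN : NF I) :
    ∃ (Ψ : Df (PP W) (PP W)) (O₂ : Set (PP W)), IsOpen O₂ ∧
      (∀ p : PP W, 0 ≤ p.1 → p.2.2 = 0 → p ∈ O₂) ∧ ∀ p ∈ O₂, Ψ (I p) = p := by
  obtain ⟨χ, sχ, χ0, χ1, χo, χz, -⟩ := exists_bump (0 : ℝ) (a := 1/2) (b := 1) (by norm_num) (by norm_num)
  obtain ⟨T, hT⟩ : ∃ T : PP W → ℝ, T = fun p => p.1 + χ p.2.2 * ‖p.2.1‖ ^ 2 := ⟨_, rfl⟩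
  obtain ⟨l, hl⟩ : ∃ l : ℝ × ℝ → ℝ, l = fun x => 1 - χ x.2 + χ x.2 * (1 + x.1 ^ 2)⁻¹ := ⟨_, rfl⟩
  have l0 : ∀ x, 0 < l x := by
    intro x; rw [hl]; simp only
    have h1 : 0 < (1 + x.1 ^ 2)⁻¹ := by positivity
    rcases (χ0 x.2).eq_or_lt with h | h
    · rw [← h]; norm_num
    · have := mul_pos h h1
      have := χ1 x.2
      linarith
  have sl : ContDiff ℝ ∞ l := by
    rw [hl]
    have h1 : ContDiff ℝ ∞ (fun x : ℝ × ℝ => (1 + x.1 ^ 2)⁻¹) :=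
      (contDiff_const.add (contDiff_fst.pow 2)).inv (fun x => by positivity)
    exact (contDiff_const.sub (sχ.comp contDiff_snd)).add ((sχ.comp contDiff_snd).mul h1)
  have ss : ContDiff ℝ ∞ (fun p : PP W => p.2.2) := contDiff_snd.comp contDiff_snd
  have sw : ContDiff ℝ ∞ (fun p : PP W => p.2.1) := contDiff_fst.comp contDiff_snd
  have sT : ContDiff ℝ ∞ T := by
    rw [hT]
    exact contDiff_fst.add ((sχ.comp ss).mul (sw.norm_sq ℝ))
  have sli : ContDiff ℝ ∞ (fun p : PP W => (l (p.1, p.2.2))⁻¹ • p.2.1) :=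
    ((sl.comp (contDiff_fst.prodMk ss)).inv (fun p => (l0 _).ne')).smul sw
  let e : Df (PP W) (PP W) := Df.mk' (fun p => (T p, l (T p, p.2.2) • p.2.1, p.2.2))
    (fun p => (p.1 - χ p.2.2 * ‖(l (p.1, p.2.2))⁻¹ • p.2.1‖ ^ 2, (l (p.1, p.2.2))⁻¹ • p.2.1, p.2.2))
    (sT.prodMk (((sl.comp (sT.prodMk ss)).smul sw).prodMk ss))
    ((contDiff_fst.sub ((sχ.comp ss).mul (sli.norm_sq ℝ))).prodMk (sli.prodMk ss))
    (fun p => by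
      have h1 : (l (T p, p.2.2))⁻¹ • (l (T p, p.2.2) • p.2.1) = p.2.1 := by
        rw [smul_smul, inv_mul_cancel₀ (l0 _).ne', one_smul]
      simp only [h1]
      have : T p - χ p.2.2 * ‖p.2.1‖ ^ 2 = p.1 := by rw [hT]; ring
      rw [this])
    (fun p => by
      have h1 : T (p.1 - χ p.2.2 * ‖(l (p.1, p.2.2))⁻¹ • p.2.1‖ ^ 2, (l (p.1, p.2.2))⁻¹ • p.2.1, p.2.2) = p.1 := by
        rw [hT]; ring
      simp only [h1]
      rw [smul_smul, mul_inv_cancel₀ (l0 _).ne', one_smul])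
  have he : ∀ p, e p = (T p, l (T p, p.2.2) • p.2.1, p.2.2) := fun p => rfl
  let Z : Set (PP W) := {p | |p.2.2| ≤ 1}
  have hZ : IsClosed Z := isClosed_le ss.continuous.abs continuous_const
  have hIZ : IsClosed (I '' Z) := isClosed_image_of_bound h.smooth.continuous hZ (fun R => by
    obtain ⟨R', hR'⟩ := h.slab R
    exact ⟨R', fun x hx hI => hR' x hx hI⟩)
  have hI : OEmb I univ := ⟨isOpen_univ, fun x _ => h.smooth.contDiffAt, h.inj.injOn, fun x _ => h.dinj x⟩
  obtain ⟨D, hD, -⟩ := transport rfl hI e (subset_univ Z) hIZ (by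
    rintro ⟨t, w, s⟩ hp
    have hs : 1 ≤ |s| := by
      have : ¬ |s| ≤ 1 := hp
      linarith
    have hχ : χ s = 0 := χz s (by rw [sub_zero]; exact hs)
    rw [he]
    have hTp : T (t, w, s) = t := by rw [hT]; simp [hχ]
    rw [hTp, hl]; simp [hχ])
  refine ⟨D.trans e.symm, e ⁻¹' {p | ‖p.2.1‖ < 3 ∧ |p.2.2| < 3}, ?_, ?_, ?_⟩
  · apply IsOpen.preimage e.continuous
    exact (isOpen_lt sw.continuous.norm continuous_const).inter (isOpen_lt ss.continuous.abs continuous_const)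
  · rintro ⟨t, w, s⟩ ht hs
    simp only at ht hs
    subst hs
    have hχ : χ 0 = 1 := χo 0 (by norm_num)
    show _ ∧ _
    rw [he]
    simp only
    constructor
    · have hTp : T (t, w, 0) = t + ‖w‖ ^ 2 := by rw [hT]; simp [hχ]
      rw [hTp, norm_smul, Real.norm_of_nonneg (l0 _).le, hl]
      simp only [hχ]
      have hn := norm_nonneg w
      set n := ‖w‖
      have hp : 0 < 1 + (t + n ^ 2) ^ 2 := by positivity
      rw [sub_self, zero_add, one_mul, inv_mul_eq_div, div_lt_iff₀ hp]
      nlinarith [sq_nonneg (n - 1), sq_nonneg (t + n^2 - 1)]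
    · simp
  · intro p hp
    rw [Df.trans_apply, hD p (mem_univ _), Df.symm_eq]
    exact hN.core (e p).1 (e p).2.1 (e p).2.2 hp.1 hp.2

/-- the angular squeeze -/
theorem exists_tau : ∃ τ τi : PP W → PP W, 
    (∀ p : PP W, (p.1 ≠ 0 ∨ p.2.2 < 0) → ContDiffAt ℝ ∞ τ p ∧ τi (τ p) = p ∧ 
      ContDiffAt ℝ ∞ τi (τ p) ∧ (τ p).1 < 0 ∧ 0 < (τ p).2.2) ∧
    (∀ p0 : PP W, p0.1 = 0 → 0 < p0.2.2 → ∀ᶠ p in 𝓝 p0, p.1 < 0 → τ p = p) := by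
  have hπ := Real.pi_pos
  obtain ⟨φ, sφ, dφ, φ1, φ2, φ3⟩ := squeeze1D (δ := Real.pi / 4) (Y := 2 * Real.pi) (Y₂ := 2 * Real.pi + 1)
    (by positivity) (by linarith) (by linarith)
  have φmono := strictMono_of_deriv_pos dφ
  have φ0 : φ 0 = 0 := φ1 0 (by positivity)
  obtain ⟨A, hA⟩ := fiberwise_Df (X := ℝ × W) (φ := fun x => φ x.2) (sφ.comp contDiff_snd) (fun x s => dφ s)
    (fun x => by
      apply surjective_of_id_off (R := 2 * Real.pi + 1) sφ.continuous
      · intro s hs; exact φ2 s hs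
      · intro s hs; exact φ1 s (by linarith))
  have ss : ContDiff ℝ ∞ (fun p : PP W => p.2.2) := contDiff_snd.comp contDiff_snd
  have sw : ContDiff ℝ ∞ (fun p : PP W => p.2.1) := contDiff_fst.comp contDiff_snd
  let rot : Df (PP W) (PP W) := Df.mk' (fun p => (-p.2.2, p.2.1, p.1)) (fun p => (p.2.2, p.2.1, -p.1))
    (ss.neg.prodMk (sw.prodMk contDiff_fst)) (ss.prodMk (sw.prodMk contDiff_fst.neg))
    (fun p => by simp) (fun p => by simp)
  have r1 : ∀ p, rot p = (-p.2.2, p.2.1, p.1) := fun p => rfl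
  have r2 : ∀ p, rot.symm p = (p.2.2, p.2.1, -p.1) := fun p => rfl
  refine ⟨fun p => rot (pol (A (plog (rot.symm p)))), fun p => rot (pol (A.symm (plog (rot.symm p)))), ?_, ?_⟩
  · intro p hp
    have hoff : (rot.symm p).1 < 0 ∨ (rot.symm p).2.2 ≠ 0 := by
      rw [r2]
      rcases hp with h | h
      · right; simpa using h
      · left; exact h
    have hoff' : (rot.symm p).1 ≠ 0 ∨ (rot.symm p).2.2 ≠ 0 := by
      rcases hoff with h | h
      · exact Or.inl h.ne
      · exact Or.inr h
    have q0 : 0 < (A (plog (rot.symm p))).2 := by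
      rw [hA]; simp only; rw [← φ0]; exact φmono (plog_pos _)
    have q1 : (A (plog (rot.symm p))).2 < Real.pi / 2 := by
      rw [hA]; simp only
      have := φ3 _ (plog_lt hoff).le
      linarith
    have hq := pol_quad q0 q1
    have hback : plog (rot.symm (rot (pol (A (plog (rot.symm p)))))) = A (plog (rot.symm p)) := by
      rw [Df.symm_apply_apply, plog_pol q0 (by linarith)]
    refine ⟨?_, ?_, ?_, ?_, ?_⟩
    · exact (rot.smooth.comp (contDiff_pol.comp A.smooth)).contDiffAt.comp p
        ((contDiffAt_plog hoff).comp p rot.symm.smooth.contDiffAt)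
    · simp only
      rw [hback, Df.symm_apply_apply, pol_plog hoff', Df.apply_symm_apply]
    · apply (rot.smooth.comp (contDiff_pol.comp A.symm.smooth)).contDiffAt.comp _
        ((contDiffAt_plog ?_).comp _ rot.symm.smooth.contDiffAt)
      rw [Df.symm_apply_apply]
      exact Or.inr hq.2.ne'
    · simp only; rw [r1]; simp only; linarith [hq.2]
    · simp only; rw [r1]; exact hq.1
  · intro p0 h1 h2
    have hc : ContinuousAt (fun p : PP W => Complex.arg (Complex.equivRealProdCLM.symm (p.2.2, -p.1))) p0 := by
      apply ContinuousAt.comp (g := Complex.arg) (f := fun p : PP W => Complex.equivRealProdCLM.symm (p.2.2, -p.1))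
      · apply Complex.continuousAt_arg
        rw [Complex.mem_slitPlane_iff]; left
        simpa [Complex.equivRealProdCLM_symm_apply] using h2
      · exact (Complex.equivRealProdCLM.symm.continuous.comp
          (ss.continuous.prodMk continuous_fst.neg)).continuousAt
    have hv : Complex.arg (Complex.equivRealProdCLM.symm (p0.2.2, -p0.1)) = 0 := by
      rw [h1, Complex.arg_eq_zero_iff]
      simp [Complex.equivRealProdCLM_symm_apply, h2.le]
    have hev := hc.eventually_lt (continuousAt_const (y := Real.pi / 8)) (by rw [hv]; positivity)
    filter_upwards [hev] with p hp hlt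
    have hpos : 0 < (rot.symm p).2.2 := by rw [r2]; simpa using hlt
    have ha := plog_of_pos hpos
    have hAp : A (plog (rot.symm p)) = plog (rot.symm p) := by
      rw [hA, φ1]
      rw [ha, r2]; simp only; linarith
    rw [hAp, pol_plog (Or.inr hpos.ne'), Df.apply_symm_apply]

end psi
end CS


namespace CS
section eng
variable {W : Type*} [NormedAddCommGroup W] [InnerProductSpace ℝ W] [FiniteDimensional ℝ W]

theorem NF.fst_lt {I : PP W → PP W} (h : PT I) (hN : NF I) {p : PP W} (hp : (I p).1 < 1) : I p = p := by
  apply h.inj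
  exact hN.lt (I p).1 (I p).2.1 (I p).2.2 hp

theorem NF.mem_iff {I : PP W → PP W} {V : Set (PP W)} (hV : PS I V) (hN : NF I) {p : PP W} (hp : p.1 < 1) :
    p ∈ V ↔ 0 < p.2.2 := by
  have : I p = p := hN.lt p.1 p.2.1 p.2.2 hp
  rw [← hV.mem_iff, this]

open Classical in
theorem exists_theta {I : PP W → PP W} {V : Set (PP W)} (h : PT I) (hV : PS I V) (hN : NF I) :
    ∃ θ : PP W → PP W, OEmb θ {p | p.1 < 0 ∨ p ∉ I '' {p | p.2.2 = 0}} ∧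
      (∀ p, (p.1 < 0 ∨ p ∉ I '' {p | p.2.2 = 0}) → θ p ∈ V) ∧ ∀ p ∈ V, 0 ≤ p.1 → θ p = p := by
  obtain ⟨τ, τi, h1, h2⟩ := exists_tau (W := W)
  let θ : PP W → PP W := fun p => if p ∈ V ∧ 0 ≤ p.1 then p else τ p
  have θid : ∀ p ∈ V, 0 ≤ p.1 → θ p = p := fun p a b => if_pos ⟨a, b⟩
  have θτ : ∀ p, ¬ (p ∈ V ∧ 0 ≤ p.1) → θ p = τ p := fun p a => if_neg a
  have hM : IsClosed (I '' {p | p.2.2 = 0}) := isClosed_image_of_bound h.smooth.continuous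
    (isClosed_eq (continuous_snd.comp continuous_snd) continuous_const) (fun R => by
      obtain ⟨R', hR'⟩ := h.slab R
      exact ⟨R', fun x hx hI => hR' x (by rw [show x.2.2 = 0 from hx]; simp) hI⟩)
  -- the good points for tau
  have hoff : ∀ p, (p.1 < 0 ∨ p ∉ I '' {p | p.2.2 = 0}) → ¬ (p ∈ V ∧ 0 ≤ p.1) → p.1 ≠ 0 ∨ p.2.2 < 0 := by
    intro p hp hn
    by_contra hc
    push Not at hc
    obtain ⟨c1, c2⟩ := hc
    rcases hp with hp | hp
    · linarith
    · apply hn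
      refine ⟨?_, c1.ge⟩
      rw [hN.mem_iff hV (by linarith)]
      rcases c2.eq_or_lt with c2 | c2
      · exfalso
        apply hp
        exact ⟨p, c2.symm, hN.lt p.1 p.2.1 p.2.2 (by linarith)⟩
      · exact c2
  have hU : IsOpen {p : PP W | p.1 < 0 ∨ p ∉ I '' {p | p.2.2 = 0}} :=
    (isOpen_lt continuous_fst continuous_const).union hM.isOpen_compl
  -- local structure
  have hloc : ∀ p, (p.1 < 0 ∨ p ∉ I '' {p | p.2.2 = 0}) →
      (θ =ᶠ[𝓝 p] id) ∨ (θ =ᶠ[𝓝 p] τ ∧ (p.1 ≠ 0 ∨ p.2.2 < 0)) := by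
    intro p hp
    by_cases hpV : p ∈ V ∧ 0 ≤ p.1
    · left
      rcases hpV.2.eq_or_lt with h0 | h0
      · have hs : 0 < p.2.2 := (hN.mem_iff hV (by linarith)).1 hpV.1
        filter_upwards [h2 p h0.symm hs, hV.isOpen.mem_nhds hpV.1] with q hq hqV
        by_cases hq0 : 0 ≤ q.1
        · exact θid q hqV hq0
        · rw [θτ q (fun hh => hq0 hh.2)]; exact hq (by linarith)
      · filter_upwards [hV.isOpen.mem_nhds hpV.1, (isOpen_lt continuous_const continuous_fst).mem_nhds h0] with q hqV hq0
        exact θid q hqV (le_of_lt hq0)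
    · right
      refine ⟨?_, hoff p hp hpV⟩
      by_cases h0 : p.1 < 0
      · filter_upwards [(isOpen_lt continuous_fst continuous_const).mem_nhds h0] with q hq
        exact θτ q (fun hh => absurd hh.2 (not_le.2 hq))
      · have hpc : p ∉ closure V := by
          intro hc
          rcases hV.closure_sub hc with hc | hc
          · exact hpV ⟨hc, not_lt.1 h0⟩
          · rcases hp with hp | hp
            · exact h0 hp
            · exact hp hc
        filter_upwards [isClosed_closure.isOpen_compl.mem_nhds hpc] with q hq
        exact θτ q (fun hh => hq (subset_closure hh.1))
  refine ⟨θ, ⟨hU, ?_, ?_, ?_⟩, ?_, θid⟩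
  · intro p hp
    rcases hloc p hp with h | ⟨h, h'⟩
    · exact contDiffAt_id.congr_of_eventuallyEq h
    · exact (h1 p h').1.congr_of_eventuallyEq h
  · intro p hp q hq hpq
    by_cases hpV : p ∈ V ∧ 0 ≤ p.1 <;> by_cases hqV : q ∈ V ∧ 0 ≤ q.1
    · rwa [θid p hpV.1 hpV.2, θid q hqV.1 hqV.2] at hpq
    · rw [θid p hpV.1 hpV.2, θτ q hqV] at hpq
      have := (h1 q (hoff q hq hqV)).2.2.2.1
      rw [← hpq] at this
      linarith [hpV.2]
    · rw [θid q hqV.1 hqV.2, θτ p hpV] at hpq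
      have := (h1 p (hoff p hp hpV)).2.2.2.1
      rw [hpq] at this
      linarith [hqV.2]
    · rw [θτ p hpV, θτ q hqV] at hpq
      rw [← (h1 p (hoff p hp hpV)).2.1, ← (h1 q (hoff q hq hqV)).2.1, hpq]
  · intro p hp
    rcases hloc p hp with h | ⟨h, h'⟩
    · rw [h.fderiv_eq, fderiv_id]; exact Function.injective_id
    · rw [h.fderiv_eq]
      obtain ⟨a1, a2, a3, -, -⟩ := h1 p h'
      apply fderiv_injective_of_leftInv (g := τi) (a1.differentiableAt (by simp)) (a3.differentiableAt (by simp))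
      have ho : IsOpen {q : PP W | q.1 ≠ 0 ∨ q.2.2 < 0} :=
        (isOpen_ne_fun continuous_fst continuous_const).union
          (isOpen_lt (continuous_snd.comp continuous_snd) continuous_const)
      filter_upwards [ho.mem_nhds h'] with q hq
      exact (h1 q hq).2.1
  · intro p hp
    by_cases hpV : p ∈ V ∧ 0 ≤ p.1
    · rw [θid p hpV.1 hpV.2]; exact hpV.1
    · rw [θτ p hpV]
      obtain ⟨-, -, -, a4, a5⟩ := h1 p (hoff p hp hpV)
      rw [hN.mem_iff hV (by linarith)]
      exact a5

theorem eng_pos {I : PP W → PP W} {V : Set (PP W)} (h : PT I) (hV : PS I V) (hN : NF I)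
    {O : Set (PP W)} (hO : IsOpen O) (hVO : Vᶜ ⊆ O) {K : Set (PP W)} (hK : IsCompact K)
    (hK0 : ∀ p ∈ K, 0 < p.1) :
    ∃ h : Df (PP W) (PP W), ∃ N : Set (PP W), IsOpen N ∧ Vᶜ ⊆ N ∧ (∀ y ∈ N, h y = y) ∧ h '' K ⊆ O := by
  obtain ⟨Ψ, O₂, hO₂, hPO, hΨ⟩ := exists_Psi h hN
  obtain ⟨θ, hθ, θV, θid⟩ := exists_theta h hV hN
  have hMV : ∀ p : PP W, p.2.2 = 0 → I p ∉ V := fun p hp => by rw [hV.mem_iff, hp]; exact lt_irrefl _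
  have hIΨ : ∀ p q, q ∈ O₂ → Ψ p = q → p = I q := by
    intro p q hq e
    apply Ψ.injective
    rw [e, hΨ q hq]
  obtain ⟨sq, C, hC, hCoff, hsq1, hsq2⟩ := exists_sq (Kh := Ψ '' (K ∩ closure V)) (T := O₂ ∩ Ψ '' O)
    (Ψ.image_compact (hK.inter_right isClosed_closure)) (hO₂.inter (Ψ.image_open hO))
    (fun p h0 hs => ⟨hPO p h0 hs, I p, hVO (hMV p hs), hΨ p (hPO p h0 hs)⟩)
    (by
      rintro _ ⟨q, ⟨hqK, hqV⟩, rfl⟩ ⟨hq2, -⟩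
      have hq := hIΨ q (Ψ q) hq2 rfl
      rcases hV.closure_sub hqV with hv | ⟨p, hp, hpq⟩
      · rw [hq, hV.mem_iff] at hv; exact hv.le
      · rw [hq] at hpq
        rw [← h.inj hpq]; exact le_of_eq (Eq.symm hp))
    (by
      rintro _ ⟨q, ⟨hqK, hqV⟩, rfl⟩
      by_contra hc
      push Not at hc
      have hq := hIΨ q (Ψ q) (hPO _ hc.1.ge hc.2) rfl
      have : I (Ψ q) = Ψ q := hN.lt (Ψ q).1 (Ψ q).2.1 (Ψ q).2.2 (by rw [hc.1]; norm_num)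
      have h0 := hK0 q hqK
      rw [hq, this, hc.1] at h0
      exact lt_irrefl _ h0)
  have hZ : IsCompact (Ψ.symm '' C) := Ψ.symm.image_compact hC
  have hZU : Ψ.symm '' C ⊆ {p | p.1 < 0 ∨ p ∉ I '' {p | p.2.2 = 0}} := by
    rintro _ ⟨c, hc, rfl⟩
    by_contra hh
    simp only [mem_setOf_eq, not_or, not_not, not_lt] at hh
    obtain ⟨h0, x, hx, hxe⟩ := hh
    have hx0 : 0 ≤ x.1 := by
      by_contra hlt
      push Not at hlt
      have : I x = x := hN.lt x.1 x.2.1 x.2.2 (by linarith)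
      rw [← hxe, this] at h0
      linarith
    have : c = x := by
      rw [← hΨ x (hPO x hx0 hx), hxe, Df.apply_symm_apply]
    rw [this] at hc
    rcases hCoff x hc with h1 | h1
    · linarith
    · exact h1 hx
  have hθZ : IsCompact (θ '' (Ψ.symm '' C)) := hZ.image_of_continuousOn
    (fun x hx => (hθ.smooth x (hZU hx)).continuousAt.continuousWithinAt)
  obtain ⟨H, hH1, hH2⟩ := transport rfl hθ ((Ψ.trans sq).trans Ψ.symm) hZU hθZ.isClosed (by
    intro x hx
    simp only [Df.trans_apply]
    rw [hsq1, Df.symm_apply_apply]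
    intro hc
    exact hx ⟨Ψ x, hc, by simp⟩)
  have hsub : Vᶜ ⊆ (θ '' (Ψ.symm '' C))ᶜ := by
    rw [compl_subset_compl]
    rintro _ ⟨x, hx, rfl⟩
    exact θV x (hZU hx)
  refine ⟨H, (θ '' (Ψ.symm '' C))ᶜ, hθZ.isClosed.isOpen_compl, hsub, hH2, ?_⟩
  rintro _ ⟨k, hk, rfl⟩
  by_cases hkV : k ∈ V
  · have hkM : k ∉ I '' {p | p.2.2 = 0} := by
      rintro ⟨x, hx, rfl⟩
      exact hMV x hx hkV
    have e1 := hH1 k (Or.inr hkM)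
    rw [θid k hkV (hK0 k hk).le] at e1
    rw [e1]
    simp only [Df.trans_apply]
    obtain ⟨⟨t1, o, ho, hoe⟩, t2, t3⟩ := hsq2 (Ψ k) ⟨k, ⟨hk, subset_closure hkV⟩, rfl⟩ (by
      by_contra hc
      push Not at hc
      have hq := hIΨ k (Ψ k) (hPO _ hc.1 hc.2) rfl
      exact hkM ⟨Ψ k, hc.2, hq.symm⟩)
    have e2 : Ψ.symm (sq (Ψ k)) = I (sq (Ψ k)) := by
      rw [Df.symm_eq, hΨ _ t1]
    have e3 : Ψ.symm (sq (Ψ k)) = o := by rw [Df.symm_eq, hoe]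
    rw [θid]
    · rw [e3]; exact ho
    · rw [e2, hV.mem_iff]; exact t3
    · rw [e2]
      by_contra hlt
      push Not at hlt
      have := hN.fst_lt h (p := sq (Ψ k)) (by linarith)
      rw [this] at hlt
      linarith
  · rw [hH2 k (hsub hkV)]
    exact hVO hkV

theorem eng_NF {I : PP W → PP W} {V : Set (PP W)} (h : PT I) (hV : PS I V) (hN : NF I) : Eng V := by
  intro O hO hVO K hK
  obtain ⟨R, hR⟩ := hK.isBounded.exists_norm_le
  obtain ⟨c, hc⟩ : ∃ c, c = |R| + 1 := ⟨_, rfl⟩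
  have hc0 : 0 ≤ c := by rw [hc]; positivity
  let Φ : Df (PP W) (PP W) := Df.mk' (fun p => (p.1 + c, p.2)) (fun p => (p.1 - c, p.2))
    ((contDiff_fst.add contDiff_const).prodMk contDiff_snd)
    ((contDiff_fst.sub contDiff_const).prodMk contDiff_snd) (fun p => by simp) (fun p => by simp)
  have r1 : ∀ p, Φ p = (p.1 + c, p.2) := fun p => rfl
  have r2 : ∀ p, Φ.symm p = (p.1 - c, p.2) := fun p => rfl
  have hT : PT (fun p => Φ (I (Φ.symm p))) := h.comp Φ Φ.symm (fun p hp => hp)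
  have hS : PS (fun p => Φ (I (Φ.symm p))) (Φ '' V) := hV.comp Φ Φ.symm (fun p => Iff.rfl) (fun p hp => hp)
  have hF : NF (fun p => Φ (I (Φ.symm p))) := by
    constructor
    · intro t w s ht
      rw [r2, hN.lt _ _ _ (by simp only; linarith), r1]; simp
    · intro t w s hw hs
      rw [r2, hN.core _ _ _ hw hs, r1]; simp
  have hcp : (Φ '' V)ᶜ = Φ '' Vᶜ := (image_compl_eq ⟨Φ.injective, Φ.surjective⟩).symm
  obtain ⟨g, N, hN, hVN, hgN, hgK⟩ := eng_pos hT hS hF (O := Φ '' O) (Φ.image_open hO)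
    (by rw [hcp]; exact image_mono hVO) (K := Φ '' K) (Φ.image_compact hK) (by
      rintro _ ⟨k, hk, rfl⟩
      rw [r1]; simp only
      have h1 := hR k hk
      have h2 := (norm_fst_le k).trans h1
      rw [Real.norm_eq_abs] at h2
      have := neg_abs_le k.1
      have := le_abs_self R
      linarith)
  refine ⟨(Φ.trans g).trans Φ.symm, Φ ⁻¹' N, hN.preimage Φ.continuous, ?_, ?_, ?_⟩
  · intro y hy
    apply hVN; rw [hcp]; exact ⟨y, hy, rfl⟩
  · intro y hy
    simp [hgN _ hy]
  · rintro _ ⟨x, hx, rfl⟩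
    obtain ⟨o, ho, hoe⟩ := hgK ⟨Φ x, ⟨x, hx, rfl⟩, rfl⟩
    simp only [Df.trans_apply]
    rw [← hoe]; simpa using ho

theorem eng_model (hW : 4 ≤ Module.finrank ℝ (W × ℝ)) {I : PP W → PP W} {V : Set (PP W)} (h : PT I)
    (hV : PS I V) : Eng V := by
  obtain ⟨Φ, J, h1, h2, h3⟩ := exists_NF hW h hV
  exact Eng.of_image Φ (eng_NF h1 h2 h3)

end eng
end CS


namespace CS

/-- cofactor normal -/
noncomputable def nrm {m : ℕ} (T : Fin m → Fin (m+1) → ℝ) (j : Fin (m+1)) : ℝ :=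
  (-1)^(j:ℕ) * Matrix.det (Matrix.of fun a k => T a (j.succAbove k))

theorem nrm_det {m : ℕ} (T : Fin m → Fin (m+1) → ℝ) (y : Fin (m+1) → ℝ) :
    Matrix.det (Matrix.of (Fin.cons y T : Fin (m+1) → Fin (m+1) → ℝ)) = ∑ j, y j * nrm T j := by
  rw [Matrix.det_succ_row_zero]
  apply Finset.sum_congr rfl
  intro j _
  have : (Matrix.of (Fin.cons y T : Fin (m+1) → Fin (m+1) → ℝ)).submatrix Fin.succ j.succAbove
      = Matrix.of fun a k => T a (j.succAbove k) := by
    ext a k; simp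
  rw [this, nrm]; simp; ring

theorem nrm_notMem {m : ℕ} {T : Fin m → Fin (m+1) → ℝ} (hT : LinearIndependent ℝ T) :
    nrm T ∉ Submodule.span ℝ (range T) := by
  have key : ∀ y, LinearIndependent ℝ (Fin.cons y T : Fin (m+1) → Fin (m+1) → ℝ) ↔
      ∑ j, y j * nrm T j ≠ 0 := by
    intro y
    rw [← nrm_det, ← isUnit_iff_ne_zero, ← Matrix.isUnit_iff_isUnit_det,
      ← Matrix.linearIndependent_rows_iff_isUnit]
    rfl
  have h1 : nrm T ≠ 0 := by
    have : Submodule.span ℝ (range T) ≠ ⊤ := by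
      intro h
      have := finrank_span_eq_card hT
      rw [h, finrank_top] at this
      simp at this
    obtain ⟨y, -, hy⟩ := SetLike.exists_of_lt (lt_top_iff_ne_top.2 this)
    have := (key y).1 (linearIndependent_finCons.2 ⟨hT, hy⟩)
    intro h
    apply this
    simp [h]
  have h2 := (key (nrm T)).2 (by
    intro h
    apply h1
    funext j
    rw [Finset.sum_eq_zero_iff_of_nonneg (fun j _ => mul_self_nonneg _)] at h
    simpa using h j (Finset.mem_univ j))
  exact (linearIndependent_finCons.1 h2).2

theorem exists_normal {m : ℕ} {i : EuclideanSpace ℝ (Fin m) → EuclideanSpace ℝ (Fin (m+1))}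
    (hi : ContDiff ℝ ∞ i) (hd : ∀ x, Function.Injective (fderiv ℝ i x)) :
    ∃ ν : EuclideanSpace ℝ (Fin m) → EuclideanSpace ℝ (Fin (m+1)), ContDiff ℝ ∞ ν ∧
      ∀ x v (a : ℝ), fderiv ℝ i x v + a • ν x = 0 → v = 0 ∧ a = 0 := by
  let T : EuclideanSpace ℝ (Fin m) → Fin m → Fin (m+1) → ℝ := fun x a k =>
    (fderiv ℝ i x (EuclideanSpace.single a 1)) k
  have hfd : ContDiff ℝ ∞ (fderiv ℝ i) := hi.fderiv_right (by simp)
  have hTs : ∀ a k, ContDiff ℝ ∞ (fun x => T x a k) := by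
    intro a k
    have : ContDiff ℝ ∞ (fun x => fderiv ℝ i x (EuclideanSpace.single a 1)) :=
      hfd.clm_apply contDiff_const
    exact (contDiff_euclidean.1 this) k
  refine ⟨fun x => WithLp.toLp 2 (nrm (T x)), ?_, ?_⟩
  · rw [contDiff_euclidean]
    intro j
    show ContDiff ℝ ∞ (fun x => nrm (T x) j)
    unfold nrm
    simp only [Matrix.det_apply, Matrix.of_apply]
    refine contDiff_const.mul (ContDiff.sum fun σ _ => ?_)
    refine ContDiff.const_smul _ (contDiff_prod fun a _ => hTs _ _)
  · intro x v a h
    let Lx : EuclideanSpace ℝ (Fin m) →ₗ[ℝ] (Fin (m+1) → ℝ) :=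
      (WithLp.linearEquiv 2 ℝ (Fin (m+1) → ℝ)).toLinearMap ∘ₗ (fderiv ℝ i x).toLinearMap
    have hL : Function.Injective Lx := (WithLp.linearEquiv 2 ℝ (Fin (m+1) → ℝ)).injective.comp (hd x)
    have hT : T x = Lx ∘ (EuclideanSpace.basisFun (Fin m) ℝ).toBasis := by
      funext a k
      simp [T, Lx]
    have hli : LinearIndependent ℝ (T x) := by
      rw [hT]
      exact (EuclideanSpace.basisFun (Fin m) ℝ).toBasis.linearIndependent.map' Lx
        (LinearMap.ker_eq_bot.2 hL)
    have hn := nrm_notMem hli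
    have hLv : ∀ v, Lx v ∈ Submodule.span ℝ (range (T x)) := by
      intro v
      rw [hT, range_comp, ← LinearMap.map_span, Module.Basis.span_eq]
      exact Submodule.mem_map_of_mem trivial
    have h' : Lx v + a • nrm (T x) = 0 := by
      have := congrArg (WithLp.linearEquiv 2 ℝ (Fin (m+1) → ℝ)) h
      simpa [Lx] using this
    have ha : a = 0 := by
      by_contra ha
      apply hn
      have : nrm (T x) = (-a⁻¹) • Lx v := by
        rw [eq_neg_of_add_eq_zero_left h']
        simp [smul_smul, inv_mul_cancel₀ ha]
      rw [this]
      exact Submodule.smul_mem _ _ (hLv v)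
    refine ⟨?_, ha⟩
    subst ha
    apply hL
    simpa using h'

section tub
variable {D E : Type*} [NormedAddCommGroup D] [NormedSpace ℝ D] [NormedAddCommGroup E]
    [NormedSpace ℝ E] [FiniteDimensional ℝ D] [FiniteDimensional ℝ E]

theorem good_nhd (hdim : Module.finrank ℝ (D × ℝ) = Module.finrank ℝ E) {F : D × ℝ → E}
    (hF : ContDiff ℝ ∞ F) (h0 : Function.Injective fun x => F (x, 0))
    (hd : ∀ x, Function.Injective (fderiv ℝ F (x, 0))) (R : ℝ) :
    ∃ δ > 0, InjOn F {p | ‖p.1‖ ≤ R ∧ |p.2| ≤ δ} ∧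
      ∀ p : D × ℝ, ‖p.1‖ ≤ R → |p.2| ≤ δ → Function.Injective (fderiv ℝ F p) := by
  have hK : IsCompact (Metric.closedBall (0:D) R ×ˢ {(0:ℝ)}) :=
    (isCompact_closedBall _ _).prod isCompact_singleton
  have hinj : InjOn F (Metric.closedBall (0:D) R ×ˢ {(0:ℝ)}) := by
    rintro ⟨x, s⟩ ⟨-, hs⟩ ⟨y, t⟩ ⟨-, ht⟩ h
    simp only [mem_singleton_iff] at hs ht
    subst hs ht
    rw [h0 h]
  obtain ⟨t, ht, hti⟩ := hinj.exists_mem_nhdsSet hK (fun x _ => hF.continuous.continuousAt) (by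
    rintro ⟨x, s⟩ ⟨-, hs⟩
    simp only [mem_singleton_iff] at hs
    subst hs
    obtain ⟨L, hL⟩ := exists_cle hdim (hd x)
    have h1 : HasFDerivAt F (L : D × ℝ →L[ℝ] E) (x, 0) := by
      rw [hL]; exact (hF.differentiable (by simp) _).hasFDerivAt
    have h2 : HasStrictFDerivAt F (L : D × ℝ →L[ℝ] E) (x, 0) :=
      hF.contDiffAt.hasStrictFDerivAt' h1 (by simp)
    have : CompleteSpace (D × ℝ) := FiniteDimensional.complete ℝ _
    refine ⟨(h2.toOpenPartialHomeomorph F).source, ?_, ?_⟩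
    · exact (h2.toOpenPartialHomeomorph F).open_source.mem_nhds h2.mem_toOpenPartialHomeomorph_source
    · exact (h2.toOpenPartialHomeomorph F).injOn)
  obtain ⟨U, hUo, hKU, hUt⟩ := mem_nhdsSet_iff_exists.1 ht
  have hO : IsOpen {p | Function.Injective (fderiv ℝ F p)} :=
    ContinuousLinearMap.isOpen_injective.preimage (hF.continuous_fderiv (by simp))
  obtain ⟨u, v, hu, hv, hsu, htv, huv⟩ := generalized_tube_lemma
    (isCompact_closedBall (0:D) R) (isCompact_singleton (x := (0:ℝ))) (hUo.inter hO) (by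
      intro p hp
      refine ⟨hKU hp, ?_⟩
      obtain ⟨x, s⟩ := p
      have : s = 0 := hp.2
      subst this
      exact hd x)
  obtain ⟨ε, hε, hεv⟩ := Metric.isOpen_iff.1 hv 0 (htv rfl)
  have hmem : ∀ p : D × ℝ, ‖p.1‖ ≤ R → |p.2| ≤ ε/2 → p ∈ u ×ˢ v := by
    intro p h1 h2
    refine ⟨hsu (by simpa using h1), hεv ?_⟩
    simp only [Metric.mem_ball, dist_zero_right, Real.norm_eq_abs]
    linarith
  refine ⟨ε/2, by positivity, ?_, fun p h1 h2 => (huv (hmem p h1 h2)).2⟩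
  exact hti.mono fun p hp => hUt (huv (hmem p hp.1 hp.2)).1

theorem exists_tube (hdim : Module.finrank ℝ (D × ℝ) = Module.finrank ℝ E) {i ν : D → E}
    (hi : ContDiff ℝ ∞ i) (hinj : Function.Injective i) (hν : ContDiff ℝ ∞ ν)
    (hd : ∀ x v (a : ℝ), fderiv ℝ i x v + a • ν x = 0 → v = 0 ∧ a = 0)
    (hb : ∀ R, ∃ R', ∀ x, ‖i x‖ ≤ R → ‖x‖ ≤ R') :
    ∃ I : D × ℝ → E, Tube I ∧ ∀ x, I (x, 0) = i x := by
  let F : D × ℝ → E := fun p => i p.1 + p.2 • ν p.1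
  have hF : ContDiff ℝ ∞ F := by fun_prop
  have hFd : ∀ x, Function.Injective (fderiv ℝ F (x, 0)) := by
    intro x
    have h1 : HasFDerivAt F ((fderiv ℝ i x).comp (ContinuousLinearMap.fst ℝ D ℝ) +
        ((0:ℝ) • (fderiv ℝ ν x).comp (ContinuousLinearMap.fst ℝ D ℝ) +
          (ContinuousLinearMap.snd ℝ D ℝ).smulRight (ν x))) (x, 0) := by
      have e1 : HasFDerivAt (fun p : D × ℝ => i p.1) ((fderiv ℝ i x).comp (ContinuousLinearMap.fst ℝ D ℝ))
          ((x, 0) : D × ℝ) :=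
        HasFDerivAt.comp (x := ((x, 0) : D × ℝ)) (g := i)
          (hi.differentiable (by simp) x).hasFDerivAt hasFDerivAt_fst
      have e2 : HasFDerivAt (fun p : D × ℝ => ν p.1) ((fderiv ℝ ν x).comp (ContinuousLinearMap.fst ℝ D ℝ))
          ((x, 0) : D × ℝ) :=
        HasFDerivAt.comp (x := ((x, 0) : D × ℝ)) (g := ν)
          (hν.differentiable (by simp) x).hasFDerivAt hasFDerivAt_fst
      have e3 : HasFDerivAt (fun p : D × ℝ => p.2) (ContinuousLinearMap.snd ℝ D ℝ) ((x, 0) : D × ℝ) :=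
        hasFDerivAt_snd
      exact e1.add (e3.smul e2)
    rw [h1.fderiv]
    rw [injective_iff_map_eq_zero]
    rintro ⟨v, a⟩ h
    have := hd x v a (by simpa using h)
    simp [this]
  have hF0 : (fun x => F (x, 0)) = i := by funext x; simp [F]
  choose δ hδ0 hδi hδd using good_nhd hdim hF (by rw [hF0]; exact hinj) hFd
  have hρ : ∀ k : ℕ, ∃ ρ : ℝ, (k:ℝ) ≤ ρ ∧ ∀ x x', ‖x‖ ≤ k → ‖i x - i x'‖ ≤ 2 → ‖x'‖ ≤ ρ := by
    intro k
    obtain ⟨M, hM⟩ := ((isCompact_closedBall (0:D) k).image hi.continuous).isBounded.exists_norm_le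
    obtain ⟨R', hR'⟩ := hb (M + 2)
    refine ⟨max k R', le_max_left _ _, ?_⟩
    intro x x' hx hxx
    refine (hR' x' ?_).trans (le_max_right _ _)
    have h1 := hM (i x) ⟨x, by simpa using hx, rfl⟩
    have h2 : i x' = i x - (i x - i x') := by abel
    rw [h2]
    exact (norm_sub_le _ _).trans (by linarith)
  choose ρ hρ1 hρ2 using hρ
  obtain ⟨f, hf, hfP⟩ := smooth_below (E := D)
    (P := fun x v => 2 * v * ‖ν x‖ ≤ 1 ∧ ∀ k : ℕ, (k:ℝ) ≤ ‖x‖ + 1 → 2 * v ≤ δ (ρ k)) (by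
      rintro x a b ⟨h1, h2⟩ hb hab
      refine ⟨le_trans (by gcongr) h1, fun k hk => le_trans (by gcongr) (h2 k hk)⟩) (by
      intro x
      have hfin : ∃ c > 0, ∀ k ∈ Finset.range (⌈‖x‖ + 2⌉₊ + 1), 2 * c ≤ δ (ρ k) := by
        generalize ⌈‖x‖ + 2⌉₊ + 1 = n
        induction n with
        | zero => exact ⟨1, one_pos, by simp⟩
        | succ n ih =>
          obtain ⟨c, hc, h⟩ := ih
          refine ⟨min c (δ (ρ n) / 2), lt_min hc (half_pos (hδ0 _)), ?_⟩
          intro k hk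
          rw [Finset.range_add_one, Finset.mem_insert] at hk
          rcases hk with rfl | hk
          · linarith [min_le_right c (δ (ρ k) / 2)]
          · linarith [min_le_left c (δ (ρ n) / 2), h k hk]
      obtain ⟨c, hc, h⟩ := hfin
      have hpos : 0 < 2 * (‖ν x‖ + 1) := by positivity
      refine ⟨min c (1 / (2 * (‖ν x‖ + 1))), lt_min hc (by positivity), ?_⟩
      have e1 : ∀ᶠ y in 𝓝 x, ‖ν y‖ < ‖ν x‖ + 1 :=
        hν.continuous.norm.continuousAt.eventually_lt continuousAt_const (by simp)
      have e2 : ∀ᶠ y in 𝓝 x, ‖y‖ < ‖x‖ + 1 :=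
        continuous_norm.continuousAt.eventually_lt continuousAt_const (by simp)
      filter_upwards [e1, e2] with y h1 h2
      constructor
      · calc 2 * min c (1 / (2 * (‖ν x‖ + 1))) * ‖ν y‖
            ≤ 2 * (1 / (2 * (‖ν x‖ + 1))) * (‖ν x‖ + 1) := by
              gcongr
              exact min_le_right _ _
          _ = 1 := by field_simp
      · intro k hk
        have : k ∈ Finset.range (⌈‖x‖ + 2⌉₊ + 1) := by
          rw [Finset.mem_range, Nat.lt_succ_iff]
          have : (k:ℝ) ≤ ⌈‖x‖ + 2⌉₊ := le_trans (by linarith) (Nat.le_ceil _)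
          exact_mod_cast this
        linarith [h k this, min_le_left c (1 / (2 * (‖ν x‖ + 1)))])
  have hat : ∀ s : ℝ, |Real.arctan s| < 2 := by
    intro s
    rw [abs_lt]
    constructor <;> linarith [Real.neg_pi_div_two_lt_arctan s, Real.arctan_lt_pi_div_two s, Real.pi_lt_four]
  let S : D × ℝ → D × ℝ := fun p => (p.1, f p.1 * Real.arctan p.2)
  have hS : ContDiff ℝ ∞ S := by
    apply contDiff_fst.prodMk
    exact (hf.comp contDiff_fst).mul (Real.contDiff_arctan.comp contDiff_snd)
  have hS2 : ∀ p, |(S p).2| ≤ 2 * f p.1 := by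
    intro p
    simp only [S, abs_mul, abs_of_pos (hfP p.1).1]
    nlinarith [(hat p.2).le, (hfP p.1).1]
  have hSd : ∀ p, Function.Injective (fderiv ℝ S p) := by
    intro p
    refine fderiv_injective_of_leftInv (g := fun q : D × ℝ => (q.1, Real.tan (q.2 / f q.1)))
      (hS.differentiable (by simp) p) ?_ ?_
    · have hne : ∀ q : D × ℝ, f q.1 ≠ 0 := fun q => (hfP q.1).1.ne'
      have : DifferentiableAt ℝ (fun q : D × ℝ => q.2 / f q.1) (S p) := by
        exact (ContDiff.div contDiff_snd (hf.comp contDiff_fst) hne).differentiable (by simp) _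
      refine differentiableAt_fst.prodMk ?_
      have ht : DifferentiableAt ℝ Real.tan ((fun q : D × ℝ => q.2 / f q.1) (S p)) := by
        apply Real.differentiableAt_tan.2
        have : (S p).2 / f (S p).1 = Real.arctan p.2 := by
          simp only [S]
          field_simp [hne p]
        show Real.cos ((S p).2 / f (S p).1) ≠ 0
        rw [this]
        exact (Real.cos_arctan_pos _).ne'
      exact DifferentiableAt.comp (g := Real.tan) (f := fun q : D × ℝ => q.2 / f q.1) (S p) ht this
    · refine Eventually.of_forall fun q => ?_
      have hne : f q.1 ≠ 0 := (hfP q.1).1.ne'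
      simp only [S]
      rw [mul_div_cancel_left₀ _ hne, Real.tan_arctan]
  have hSi : Function.Injective S := by
    rintro ⟨x, s⟩ ⟨y, t⟩ h
    simp only [S, Prod.mk.injEq] at h
    obtain ⟨rfl, h⟩ := h
    have := Real.arctan_injective (mul_left_cancel₀ (hfP x).1.ne' h)
    rw [this]
  have hclose : ∀ p, ‖F (S p) - i p.1‖ ≤ 1 := by
    intro p
    have : F (S p) - i p.1 = (S p).2 • ν p.1 := by simp [F, S]
    rw [this, norm_smul, Real.norm_eq_abs]
    refine le_trans ?_ (hfP p.1).2.1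
    gcongr
    exact hS2 p
  have hinjS : ∀ p q : D × ℝ, ‖p.1‖ ≤ ‖q.1‖ → F (S p) = F (S q) → p = q := by
    intro p q hpq h
    have hk : ‖p.1‖ ≤ (⌈‖p.1‖⌉₊ : ℝ) := Nat.le_ceil _
    have hk' : (⌈‖p.1‖⌉₊ : ℝ) ≤ ‖p.1‖ + 1 := (Nat.ceil_lt_add_one (norm_nonneg _)).le
    have h1 : ‖i p.1 - i q.1‖ ≤ 2 := by
      have : i p.1 - i q.1 = (F (S q) - i q.1) - (F (S p) - i p.1) := by rw [h]; abel
      rw [this]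
      exact (norm_sub_le _ _).trans (by linarith [hclose p, hclose q])
    apply hSi
    refine hδi (ρ ⌈‖p.1‖⌉₊) ⟨?_, ?_⟩ ⟨?_, ?_⟩ h
    · exact hk.trans (hρ1 _)
    · exact (hS2 p).trans ((hfP p.1).2.2 _ hk')
    · exact hρ2 _ _ _ hk h1
    · exact (hS2 q).trans ((hfP q.1).2.2 _ (by linarith))
  refine ⟨fun p => F (S p), ⟨hF.comp hS, ?_, ?_, ?_⟩, ?_⟩
  · intro p q h
    rcases le_total ‖p.1‖ ‖q.1‖ with h1 | h1
    · exact hinjS p q h1 h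
    · exact (hinjS q p h1 h.symm).symm
  · intro p
    have e : fderiv ℝ (fun p => F (S p)) p = (fderiv ℝ F (S p)).comp (fderiv ℝ S p) :=
      fderiv_comp p (hF.differentiable (by simp) _) (hS.differentiable (by simp) _)
    rw [e]
    have hk : ‖p.1‖ ≤ (⌈‖p.1‖⌉₊ : ℝ) := Nat.le_ceil _
    have hk' : (⌈‖p.1‖⌉₊ : ℝ) ≤ ‖p.1‖ + 1 := (Nat.ceil_lt_add_one (norm_nonneg _)).le
    exact (hδd (ρ ⌈‖p.1‖⌉₊) (S p) (hk.trans (hρ1 _))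
      ((hS2 p).trans ((hfP p.1).2.2 _ hk'))).comp (hSd p)
  · intro R
    obtain ⟨R', hR'⟩ := hb (R + 1)
    refine ⟨max R' 1, ?_⟩
    intro p hp hIp
    rw [Prod.norm_def]
    refine max_le_max (hR' _ ?_) hp
    have : i p.1 = F (S p) - (F (S p) - i p.1) := by abel
    rw [this]
    exact (norm_sub_le _ _).trans (by linarith [hclose p])
  · intro x
    simp [F, S]

theorem Tube.flip {I : D × ℝ → E} (h : Tube I) : Tube fun p : D × ℝ => I (p.1, -p.2) := by
  have hs : ContDiff ℝ ∞ (fun p : D × ℝ => (p.1, -p.2)) := contDiff_fst.prodMk contDiff_snd.neg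
  refine ⟨h.smooth.comp hs, ?_, ?_, ?_⟩
  · rintro ⟨x, s⟩ ⟨y, t⟩ e
    have := h.inj e
    simpa using this
  · intro p
    have e : fderiv ℝ (fun p : D × ℝ => I (p.1, -p.2)) p =
        (fderiv ℝ I (p.1, -p.2)).comp (fderiv ℝ (fun p : D × ℝ => (p.1, -p.2)) p) :=
      fderiv_comp (g := I) (f := fun p : D × ℝ => (p.1, -p.2)) p (h.smooth.differentiable (by simp) _) (hs.differentiable (by simp) _)
    rw [e]
    refine (h.dinj _).comp ?_
    exact fderiv_injective_of_leftInv (g := fun p : D × ℝ => (p.1, -p.2))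
      (hs.differentiable (by simp) _) (hs.differentiable (by simp) _) (Eventually.of_forall fun q => by simp)
  · intro R
    obtain ⟨R', hR'⟩ := h.slab R
    refine ⟨R', fun p hp hI => ?_⟩
    have := hR' (p.1, -p.2) (by simpa using hp) hI
    simpa [Prod.norm_def] using this

end tub
end CS


namespace CS

section comp
variable {D E : Type*} [NormedAddCommGroup D] [NormedSpace ℝ D] [NormedAddCommGroup E]
    [NormedSpace ℝ E] [FiniteDimensional ℝ D] [FiniteDimensional ℝ E]
  {I : D × ℝ → E}

theorem tube_closed (h : Tube I) : IsClosed (I '' {p | p.2 = 0}) := by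
  have : ProperSpace (D × ℝ) := FiniteDimensional.proper ℝ _
  refine isClosed_image_of_bound h.smooth.continuous (isClosed_eq continuous_snd continuous_const) ?_
  intro R
  obtain ⟨R', hR'⟩ := h.slab R
  refine ⟨R', fun p hp => hR' p ?_⟩
  have : p.2 = 0 := hp
  simp [this]

/-- clamp to `[-1,1]` -/
noncomputable def clp (s : ℝ) : ℝ := max (-1) (min 1 s)

theorem clp_cont : Continuous clp := by unfold clp; fun_prop

theorem no_join (hdim : Module.finrank ℝ (D × ℝ) = Module.finrank ℝ E) (h : Tube I) {S : Set E}
    (hS : IsPreconnected S) (hSM : S ⊆ (I '' {p | p.2 = 0})ᶜ) (h1 : I (0, 1) ∈ S)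
    (h2 : I (0, -1) ∈ S) : False := by
  have hoe := h.isOpenEmbedding hdim
  have hpr : ProperSpace (D × ℝ) := FiniteDimensional.proper ℝ _
  let v : D × ℝ → ℂ := fun p => Complex.exp (((Real.pi * clp p.2 : ℝ) : ℂ) * Complex.I)
  have hv : Continuous v := by
    have := clp_cont
    fun_prop
  let u : E → ℂ := Function.extend I v (fun _ => -1)
  have hu : ∀ p, u (I p) = v p := fun p => h.inj.extend_apply _ _ p
  have hu' : ∀ y, y ∉ range I → u y = -1 := fun y hy => by
    apply Function.extend_apply'
    simpa using hy
  have hvout : ∀ p : D × ℝ, 1 < |p.2| → v p = -1 := by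
    intro p hp
    have : clp p.2 = 1 ∨ clp p.2 = -1 := by
      rcases lt_abs.1 hp with h | h
      · left; unfold clp; rw [min_eq_left h.le]; norm_num
      · right; unfold clp; rw [min_eq_right (by linarith), max_eq_left (by linarith)]
    rcases this with h | h
    · simp [v, h, Complex.exp_pi_mul_I]
    · simp only [v, h]
      have : ((Real.pi * -1 : ℝ) : ℂ) * Complex.I = -(Real.pi * Complex.I) := by push_cast; ring
      rw [this, Complex.exp_neg, Complex.exp_pi_mul_I]
      norm_num
  have hcl : IsClosed (I '' {p | |p.2| ≤ 1}) := by
    refine isClosed_image_of_bound h.smooth.continuous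
      (isClosed_le (continuous_abs.comp continuous_snd) continuous_const) ?_
    intro R
    obtain ⟨R', hR'⟩ := h.slab R
    exact ⟨R', fun p hp => hR' p hp⟩
  have huc : Continuous u := by
    rw [continuous_iff_continuousAt]
    intro y
    by_cases hy : y ∈ range I
    · obtain ⟨p, rfl⟩ := hy
      rw [← hoe.continuousAt_iff]
      have : u ∘ I = v := funext hu
      rw [this]; exact hv.continuousAt
    · have : u =ᶠ[𝓝 y] fun _ => -1 := by
        filter_upwards [hcl.isOpen_compl.mem_nhds (x := y)
          (fun ⟨p, _, hp⟩ => hy ⟨p, hp⟩)] with z hz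
        by_cases hz' : z ∈ range I
        · obtain ⟨p, rfl⟩ := hz'
          rw [hu, hvout]
          by_contra hp
          exact hz ⟨p, not_lt.1 hp, rfl⟩
        · exact hu' z hz'
      exact continuousAt_const.congr this.symm
  have hnorm : ∀ y, ‖u y‖ = 1 := by
    intro y
    by_cases hy : y ∈ range I
    · obtain ⟨p, rfl⟩ := hy
      rw [hu]; exact Complex.norm_exp_ofReal_mul_I _
    · rw [hu' y hy]; simp
  have hsc : IsSimplyConnected (univ : Set E) := by
    have : ContractibleSpace (univ : Set E) := Convex.contractibleSpace convex_univ ⟨0, trivial⟩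
    show SimplyConnectedSpace (univ : Set E)
    infer_instance
  obtain ⟨w, hw, hwu⟩ := Complex.exists_continuousOn_eqOn_exp_comp hsc isOpen_univ
    huc.continuousOn (by
      rintro ⟨y, -, hy⟩
      have := hnorm y
      rw [hy] at this
      simp at this)
  rw [continuousOn_univ] at hw
  have hwu' : ∀ y, Complex.exp (w y) = u y := fun y => hwu (mem_univ y)
  have hre : ∀ y, (w y).re = 0 := by
    intro y
    have := hnorm y
    rw [← hwu', Complex.norm_exp] at this
    simpa using this
  let θ : E → ℝ := fun y => (w y).im
  have hθ : Continuous θ := Complex.continuous_im.comp hw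
  have hwθ : ∀ y, w y = (θ y : ℂ) * Complex.I := by
    intro y
    apply Complex.ext <;> simp [θ, hre]
  have hnint : ∀ s : ℝ, ∃ n : ℤ, (n : ℝ) = (θ (I (0, s)) - Real.pi * clp s) / (2 * Real.pi) := by
    intro s
    have := hwu' (I (0, s))
    rw [hu, hwθ] at this
    obtain ⟨n, hn⟩ := Complex.exp_eq_exp_iff_exists_int.1 this
    refine ⟨n, ?_⟩
    have h3 := congrArg Complex.im hn
    simp at h3
    rw [h3]
    field_simp [Real.pi_ne_zero]
    ring
  choose n hn using hnint
  have hγ : Continuous fun s : ℝ => I ((0 : D), s) :=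
    h.smooth.continuous.comp (by fun_prop)
  have hnc : Continuous n := by
    rw [Int.isClosedEmbedding_coe_real.isInducing.continuous_iff]
    have : ((fun k : ℤ => (k:ℝ)) ∘ n) = fun s => (θ (I (0, s)) - Real.pi * clp s) / (2 * Real.pi) :=
      funext hn
    rw [this]
    exact ((hθ.comp hγ).sub (continuous_const.mul clp_cont)).div_const _
  have hconst : ∀ s, n s = n 0 := fun s => PreconnectedSpace.constant inferInstance hnc
  have hval : ∀ s, θ (I (0, s)) = 2 * Real.pi * n 0 + Real.pi * clp s := by
    intro s
    have := hn s
    rw [hconst s] at this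
    rw [this]
    field_simp [Real.pi_ne_zero]
    ring
  have c1 : clp 1 = 1 := by norm_num [clp]
  have c2 : clp (-1) = -1 := by norm_num [clp]
  have := hS.intermediate_value h2 h1 hθ.continuousOn
  obtain ⟨y, hyS, hy⟩ := this (show 2 * Real.pi * n 0 ∈ _ by
    rw [hval, hval, c1, c2]
    constructor <;> linarith [Real.pi_pos])
  have huy : u y = 1 := by
    rw [← hwu', hwθ, hy]
    rw [Complex.exp_eq_one_iff]
    exact ⟨n 0, by push_cast; ring⟩
  by_cases hyr : y ∈ range I
  · obtain ⟨p, rfl⟩ := hyr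
    apply hSM hyS
    refine ⟨p, ?_, rfl⟩
    rw [hu] at huy
    obtain ⟨k, hk⟩ := Complex.exp_eq_one_iff.1 huy
    have h3 := congrArg Complex.im hk
    simp at h3
    have h4 : clp p.2 = 2 * k := by
      have := Real.pi_pos
      apply mul_left_cancel₀ this.ne'
      linarith
    have h5 : -1 ≤ clp p.2 ∧ clp p.2 ≤ 1 := by
      unfold clp
      exact ⟨le_max_left _ _, max_le (by norm_num) (min_le_left _ _)⟩
    have h6 : k = 0 := by
      rw [h4] at h5
      have a1 : (-1 : ℤ) ≤ 2 * k := by exact_mod_cast h5.1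
      have a2 : 2 * k ≤ (1 : ℤ) := by exact_mod_cast h5.2
      omega
    rw [h6] at h4
    simp only [Int.cast_zero, mul_zero] at h4
    show p.2 = 0
    unfold clp at h4
    rcases lt_trichotomy p.2 0 with h7 | h7 | h7
    · have : max (-1) (min 1 p.2) < 0 := max_lt (by norm_num) (lt_of_le_of_lt (min_le_right _ _) h7)
      linarith
    · exact h7
    · have : 0 < max (-1) (min 1 p.2) := lt_max_of_lt_right (lt_min one_pos h7)
      linarith
  · rw [hu' y hyr] at huy
    norm_num at huy

theorem tube_components (hdim : Module.finrank ℝ (D × ℝ) = Module.finrank ℝ E) (h : Tube I)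
    {M : Set E} (hM : M = I '' {p | p.2 = 0}) :
    ∃ Vp Vm : Set E, (∃ x ∈ Mᶜ, Vp = connectedComponentIn Mᶜ x) ∧
      (∃ x ∈ Mᶜ, Vm = connectedComponentIn Mᶜ x) ∧ Vp ≠ Vm ∧
      (∀ x ∈ Mᶜ, connectedComponentIn Mᶜ x = Vp ∨ connectedComponentIn Mᶜ x = Vm) ∧
      Side I Vp ∧ Side (fun p : D × ℝ => I (p.1, -p.2)) Vm := by
  have hMc : IsClosed M := hM ▸ tube_closed h
  have hMo : IsOpen Mᶜ := hMc.isOpen_compl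
  have hnM : ∀ p, p.2 ≠ 0 → I p ∈ Mᶜ := by
    rintro p hp hp'
    rw [hM] at hp'
    obtain ⟨q, hq, hqp⟩ := hp'
    rw [h.inj hqp] at hq
    exact hp hq
  have hM0 : ∀ p, p.2 = 0 → I p ∈ M := fun p hp => hM ▸ ⟨p, hp, rfl⟩
  set Vp := connectedComponentIn Mᶜ (I (0, 1)) with hVp
  set Vm := connectedComponentIn Mᶜ (I (0, -1)) with hVm
  have conn : ∀ T : Set ℝ, Convex ℝ T → ∀ a ∈ T, 0 ∉ T →
      ∀ p : D × ℝ, p.2 ∈ T → I p ∈ connectedComponentIn Mᶜ (I (0, a)) := by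
    intro T hT a ha h0 p hp
    have hc : IsPreconnected (I '' ((univ : Set D) ×ˢ T)) :=
      ((convex_univ.prod hT).isPreconnected).image _ h.smooth.continuous.continuousOn
    refine hc.subset_connectedComponentIn ⟨(0, a), ⟨mem_univ _, ha⟩, rfl⟩ ?_ ⟨p, ⟨mem_univ _, hp⟩, rfl⟩
    rintro _ ⟨q, hq, rfl⟩
    apply hnM
    intro hq0
    exact h0 (hq0 ▸ hq.2)
  have hp : ∀ p : D × ℝ, 0 < p.2 → I p ∈ Vp := fun p hp =>
    conn (Ioi 0) (convex_Ioi 0) 1 (by simp) (by simp) p hp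
  have hm : ∀ p : D × ℝ, p.2 < 0 → I p ∈ Vm := fun p hp =>
    conn (Iio 0) (convex_Iio 0) (-1) (by simp) (by simp) p hp
  have hne : Vp ≠ Vm := by
    intro e
    refine no_join hdim h (S := Vp) isPreconnected_connectedComponentIn ?_ (hp _ (by simp)) ?_
    · rw [← hM]; exact connectedComponentIn_subset _ _
    · rw [e]; exact hm _ (by simp)
  have hopen : ∀ x, IsOpen (connectedComponentIn Mᶜ x) := fun x => hMo.connectedComponentIn
  have hcl : ∀ x, closure (connectedComponentIn Mᶜ x) ⊆ connectedComponentIn Mᶜ x ∪ M := by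
    intro x z hz
    by_cases hzM : z ∈ M
    · exact Or.inr hzM
    · left
      obtain ⟨y, hy1, hy2⟩ := mem_closure_iff.1 hz _ (hopen z) (mem_connectedComponentIn hzM)
      rw [connectedComponentIn_eq hy2, ← connectedComponentIn_eq hy1]
      exact mem_connectedComponentIn hzM
  have hdis : ∀ y, y ∈ Vp → y ∈ Vm → False := by
    intro y h1 h2
    exact hne ((connectedComponentIn_eq h1).trans (connectedComponentIn_eq h2).symm)
  refine ⟨Vp, Vm, ⟨_, hnM _ (by simp), rfl⟩, ⟨_, hnM _ (by simp), rfl⟩, hne, ?_, ?_, ?_⟩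
  · intro x hx
    have hmeet : ∃ z ∈ closure (connectedComponentIn Mᶜ x), z ∈ M := by
      by_contra hcon
      push Not at hcon
      have hc : IsClosed (connectedComponentIn Mᶜ x) := by
        rw [← closure_subset_iff_isClosed]
        intro z hz
        exact (hcl x hz).resolve_right (hcon z hz)
      have := IsClopen.eq_univ ⟨hc, hopen x⟩ ⟨x, mem_connectedComponentIn hx⟩
      have h3 : I (0, 0) ∈ connectedComponentIn Mᶜ x := by rw [this]; trivial
      exact connectedComponentIn_subset _ _ h3 (hM0 _ rfl)
    obtain ⟨z, hz, hzM⟩ := hmeet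
    rw [hM] at hzM
    obtain ⟨q, hq, rfl⟩ := hzM
    obtain ⟨y, ⟨p, rfl⟩, hy⟩ := mem_closure_iff.1 hz (range I)
      (h.isOpenEmbedding hdim).isOpen_range ⟨q, rfl⟩
    have hp0 : p.2 ≠ 0 := fun h0 => connectedComponentIn_subset _ _ hy (hM0 p h0)
    rcases lt_or_gt_of_ne hp0 with h0 | h0
    · right
      rw [connectedComponentIn_eq hy, hVm, connectedComponentIn_eq (hm p h0)]
    · left
      rw [connectedComponentIn_eq hy, hVp, connectedComponentIn_eq (hp p h0)]
  · refine ⟨hopen _, ?_, ?_⟩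
    · intro p
      refine ⟨fun hpV => ?_, hp p⟩
      rcases lt_trichotomy p.2 0 with h0 | h0 | h0
      · exact (hdis _ hpV (hm p h0)).elim
      · exact (connectedComponentIn_subset _ _ hpV (hM0 p h0)).elim
      · exact h0
    · rw [← hM]; exact hcl _
  · refine ⟨hopen _, ?_, ?_⟩
    · intro p
      refine ⟨fun hpV => ?_, fun h0 => hm (p.1, -p.2) (by simpa using h0)⟩
      rcases lt_trichotomy p.2 0 with h0 | h0 | h0
      · exact (hdis _ (hp (p.1, -p.2) (by simpa using h0)) hpV).elim
      · exact (connectedComponentIn_subset _ _ hpV (hM0 _ (by simpa using h0))).elim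
      · exact h0
    · have : (fun p : D × ℝ => I (p.1, -p.2)) '' {p | p.2 = 0} = M := by
        rw [hM]
        ext y
        constructor
        · rintro ⟨p, hp, rfl⟩
          have hp' : p.2 = 0 := hp
          exact ⟨(p.1, -p.2), by simpa using hp', rfl⟩
        · rintro ⟨p, hp, rfl⟩
          have hp' : p.2 = 0 := hp
          exact ⟨(p.1, -p.2), by simpa using hp', by simp⟩
      rw [this]; exact hcl _

end comp
end CS


namespace CS

section asm
variable {D E : Type*} [NormedAddCommGroup D] [NormedSpace ℝ D] [NormedAddCommGroup E]
    [NormedSpace ℝ E] [FiniteDimensional ℝ D] [FiniteDimensional ℝ E]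
    {W : Type*} [NormedAddCommGroup W] [InnerProductSpace ℝ W] [FiniteDimensional ℝ W]
  {I : D × ℝ → E} {V : Set E}

theorem eng_of_tube (hW : 4 ≤ Module.finrank ℝ (W × ℝ)) (e : (ℝ × W) ≃L[ℝ] D) (Λ : E ≃L[ℝ] PP W)
    (hI : Tube I) (hV : Side I V) : Eng V := by
  let A : PP W ≃L[ℝ] D × ℝ :=
    (ContinuousLinearEquiv.prodAssoc ℝ ℝ W ℝ).symm.trans (e.prodCongr (ContinuousLinearEquiv.refl ℝ ℝ))
  have hA : ∀ p : PP W, (A p).2 = p.2.2 := fun p => rfl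
  let Φ := Df.ofCLE Λ
  let Q := Df.ofCLE A
  have hQ : ∀ p : PP W, (Q p).2 = p.2.2 := fun p => rfl
  apply Eng.of_image Φ
  have hpt : PT (fun p => Φ (I (Q p))) := by
    refine ⟨Φ.smooth.comp (hI.smooth.comp Q.smooth), ?_, ?_, ?_⟩
    · exact Φ.injective.comp (hI.inj.comp Q.injective)
    · intro p
      have e1 : fderiv ℝ (fun p => I (Q p)) p = (fderiv ℝ I (Q p)).comp (fderiv ℝ Q p) :=
        fderiv_comp p (hI.smooth.differentiable (by simp) _) (Q.smooth.differentiable (by simp) _)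
      have e2 : fderiv ℝ (fun p => Φ (I (Q p))) p =
          (fderiv ℝ Φ (I (Q p))).comp (fderiv ℝ (fun p => I (Q p)) p) :=
        fderiv_comp (g := Φ) (f := fun p => I (Q p)) p (Φ.smooth.differentiable (by simp) _)
          ((hI.smooth.comp Q.smooth).differentiable (by simp) _)
      rw [e2, e1]
      exact (Φ.fderiv_injective _).comp ((hI.dinj _).comp (Q.fderiv_injective _))
    · intro R
      have : ProperSpace (PP W) := FiniteDimensional.proper ℝ _
      have : ProperSpace (D × ℝ) := FiniteDimensional.proper ℝ _
      obtain ⟨R1, h1⟩ := Φ.exists_bound R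
      obtain ⟨R2, h2⟩ := hI.slab R1
      obtain ⟨R3, h3⟩ := Q.exists_bound R2
      exact ⟨R3, fun p hp hIp => h3 p (h2 (Q p) (by rw [hQ]; exact hp) (h1 _ hIp))⟩
  refine eng_model hW hpt ⟨Φ.image_open hV.isOpen, ?_, ?_⟩
  · intro p
    rw [Φ.injective.mem_set_image, hV.mem_iff, hQ]
  · have hc : closure (Φ '' V) = Φ '' closure V := (Φ.toHomeo.image_closure V).symm
    rw [hc]
    rintro _ ⟨y, hy, rfl⟩
    rcases hV.closure_sub hy with h | ⟨q, hq, rfl⟩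
    · exact Or.inl ⟨y, h, rfl⟩
    · right
      refine ⟨Q.symm q, ?_, by simp⟩
      show (Q.symm q).2.2 = 0
      rw [← hQ, Df.apply_symm_apply]
      exact hq

theorem side_final (hdim : Module.finrank ℝ (D × ℝ) = Module.finrank ℝ E)
    (hW : 4 ≤ Module.finrank ℝ (W × ℝ)) (e : (ℝ × W) ≃L[ℝ] D) (Λ : E ≃L[ℝ] PP W)
    (hI : Tube I) (hV : Side I V) {i : D → E} (hi : ∀ x, I (x, 0) = i x) :
    ∃ f : D × ℝ → E, ContDiff ℝ ∞ f ∧ (∀ x, f (x, 0) = i x) ∧ Set.InjOn f {p | 0 ≤ p.2} ∧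
        IsProperMap (({p : D × ℝ | 0 ≤ p.2}).restrict f) ∧
        (∀ p : D × ℝ, 0 ≤ p.2 → Function.Injective (fderiv ℝ f p)) ∧
        f '' {p | 0 ≤ p.2} = closure V := by
  obtain ⟨f, h1, h2, h3, h4, h5, h6⟩ := limit_thm hdim hI hV (eng_of_tube hW e Λ hI hV)
  refine ⟨f, h1, fun x => (h2 x).trans (hi x), h3.injOn, ?_, fun p _ => h4 p, h5⟩
  have : ProperSpace (D × ℝ) := FiniteDimensional.proper ℝ _
  have : ProperSpace E := FiniteDimensional.proper ℝ _
  have hcl : IsClosed {p : D × ℝ | 0 ≤ p.2} := isClosed_le continuous_const continuous_snd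
  rw [isProperMap_iff_isCompact_preimage]
  refine ⟨h1.continuous.comp continuous_subtype_val, ?_⟩
  intro K hK
  rw [Topology.IsEmbedding.subtypeVal.isCompact_iff]
  obtain ⟨R, hR⟩ := hK.isBounded.exists_norm_le
  obtain ⟨R', hR'⟩ := h6 R
  have himg : Subtype.val '' (({p : D × ℝ | 0 ≤ p.2}).restrict f ⁻¹' K) =
      {p : D × ℝ | 0 ≤ p.2} ∩ f ⁻¹' K := by
    ext p
    constructor
    · rintro ⟨q, hq, rfl⟩
      exact ⟨q.2, hq⟩
    · rintro ⟨hp, hq⟩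
      exact ⟨⟨p, hp⟩, hq, rfl⟩
  rw [himg]
  refine (isCompact_closedBall (0 : D × ℝ) R').of_isClosed_subset
    (hcl.inter (hK.isClosed.preimage h1.continuous)) ?_
  rintro p ⟨hp, hq⟩
  simpa using hR' p hp (hR _ hq)

end asm
end CS


/-- Proposition 12.3: a properly smoothly embedded `ℝ^m` in `ℝ^{m+1}` (with `m ≥ 4`) splits
`ℝ^{m+1}` into two pieces, each the image of a proper smooth embedding of `ℝ^m × ℝ₊`
agreeing with the given embedding on the boundary. -/
theorem proper_embedding_splits (m : ℕ) (hm : 4 ≤ m)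
    (i : EuclideanSpace ℝ (Fin m) → EuclideanSpace ℝ (Fin (m + 1)))
    (hi_smooth : ContDiff ℝ (⊤ : ℕ∞) i)
    (hi_inj : Function.Injective i)
    (hi_proper : IsProperMap i)
    (hi_fderiv : ∀ x, Function.Injective (fderiv ℝ i x)) :
    (∃ c₁ c₂ : Set (EuclideanSpace ℝ (Fin (m + 1))), c₁ ≠ c₂ ∧
      {c | ∃ x ∈ (Set.range i)ᶜ, c = connectedComponentIn (Set.range i)ᶜ x} = {c₁, c₂}) ∧
    ∀ c : Set (EuclideanSpace ℝ (Fin (m + 1))),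
      (∃ x ∈ (Set.range i)ᶜ, c = connectedComponentIn (Set.range i)ᶜ x) →
      ∃ f : EuclideanSpace ℝ (Fin m) × ℝ → EuclideanSpace ℝ (Fin (m + 1)),
        ContDiff ℝ (⊤ : ℕ∞) f ∧
        (∀ x, f (x, 0) = i x) ∧
        Set.InjOn f {p | 0 ≤ p.2} ∧
        IsProperMap (({p : EuclideanSpace ℝ (Fin m) × ℝ | 0 ≤ p.2}).restrict f) ∧
        (∀ p : EuclideanSpace ℝ (Fin m) × ℝ, 0 ≤ p.2 →
          Function.Injective (fderiv ℝ f p)) ∧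
        f '' {p | 0 ≤ p.2} = closure c := by
  have hdim : Module.finrank ℝ (EuclideanSpace ℝ (Fin m) × ℝ) =
      Module.finrank ℝ (EuclideanSpace ℝ (Fin (m + 1))) := by simp
  have hb : ∀ R : ℝ, ∃ R', ∀ x, ‖i x‖ ≤ R → ‖x‖ ≤ R' := by
    intro R
    have hc := hi_proper.isCompact_preimage
      (isCompact_closedBall (0 : EuclideanSpace ℝ (Fin (m + 1))) R)
    obtain ⟨R', hR'⟩ := hc.isBounded.exists_norm_le
    exact ⟨R', fun x hx => hR' x (by simpa using hx)⟩
  obtain ⟨ν, hν, hνd⟩ := CS.exists_normal hi_smooth hi_fderiv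
  obtain ⟨I, hI, hIi⟩ := CS.exists_tube hdim hi_smooth hi_inj hν hνd hb
  have hM : Set.range i = I '' {p | p.2 = 0} := by
    ext y
    constructor
    · rintro ⟨x, rfl⟩
      exact ⟨(x, 0), rfl, hIi x⟩
    · rintro ⟨⟨x, s⟩, hs, rfl⟩
      have : s = 0 := hs
      subst this
      exact ⟨x, (hIi x).symm⟩
  obtain ⟨Vp, Vm, hVp, hVm, hne, hall, hsp, hsm⟩ := CS.tube_components hdim hI hM
  have hW : 4 ≤ Module.finrank ℝ (EuclideanSpace ℝ (Fin (m - 1)) × ℝ) := by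
    simp only [Module.finrank_prod, finrank_euclideanSpace_fin, Module.finrank_self]
    omega
  have e : (ℝ × EuclideanSpace ℝ (Fin (m - 1))) ≃L[ℝ] EuclideanSpace ℝ (Fin m) :=
    ContinuousLinearEquiv.ofFinrankEq (by
      simp only [Module.finrank_prod, finrank_euclideanSpace_fin, Module.finrank_self]
      omega)
  have Λ : EuclideanSpace ℝ (Fin (m + 1)) ≃L[ℝ] CS.PP (EuclideanSpace ℝ (Fin (m - 1))) :=
    ContinuousLinearEquiv.ofFinrankEq (by
      simp only [CS.PP, Module.finrank_prod, finrank_euclideanSpace_fin, Module.finrank_self]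
      omega)
  refine ⟨⟨Vp, Vm, hne, ?_⟩, ?_⟩
  · ext c
    constructor
    · rintro ⟨x, hx, rfl⟩
      exact hall x hx
    · rintro (rfl | rfl)
      · exact hVp
      · exact hVm
  · rintro c ⟨x, hx, rfl⟩
    rcases hall x hx with h | h
    · rw [h]
      exact CS.side_final hdim hW e Λ hI hsp hIi
    · rw [h]
      exact CS.side_final hdim hW e Λ hI.flip hsm (fun x => by simpa using hIi x)
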